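/- Let p be a prime, k a field of characteristic p, and d ≥ 1 an integer. The following are equivalent: (1) for every field F, every continuous homomorphism Gal(F_s/F) → GL_d(k) admits a lift to a continuous homomorphism Gal(F_s/F) → GL_d(W_2(k)) along the reduction W_2(k) → k; (2) if k has at least 3 elements then d ≤ 2, and if k has exactly 2 elements (equivalently p = 2 and k = 𝔽_2) then d ≤ 4. -/

import Mathlib

open scoped MatrixGroups

/-- The canonical reduction `W₂(k) → k` on length-2 truncated Witt vectors. -/
noncomputable def wittRed (p : ℕ) [Fact p.Prime] (k : Type) [CommRing k] :
    TruncatedWittVector p 2 k →+* k :=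
  RingHom.liftOfRightInverse (WittVector.truncate 2) TruncatedWittVector.out
    TruncatedWittVector.truncateFun_out
    ⟨WittVector.constantCoeff, by
      intro x hx
      rw [WittVector.mem_ker_truncate] at hx
      simpa [RingHom.mem_ker] using hx 0 (by norm_num)⟩

/-- The absolute Galois group `Gal(F_s/F)`, with its Krull topology. -/
abbrev AbsGal (F : Type) [Field F] : Type :=
  SeparableClosure F ≃ₐ[F] SeparableClosure F

/-- A ring extension of `k` by the ideal `ε k`, on which `r` acts through the `p`-th power of
its reduction, and which contains `p = ε 1`. -/
structure IsWittExt (p : ℕ) {k R : Type} [Field k] [CommRing R] (π : R →+* k) (ε : k →+ R) :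
    Prop where
  surj : Function.Surjective π
  inj : Function.Injective ε
  red_eq_zero : ∀ r, π r = 0 → ∃ a, ε a = r
  red_eps : ∀ a, π (ε a) = 0
  mul_eps : ∀ r a, r * ε a = ε (π r ^ p * a)
  natCast : (p : R) = ε 1

section WittInterface

variable (p : ℕ) [Fact p.Prime] (k : Type) [Field k]

theorem wittRed_truncate (x : WittVector p k) :
    wittRed p k (WittVector.truncate 2 x) = x.coeff 0 := by
  exact RingHom.liftOfRightInverse_comp_apply (WittVector.truncate 2) TruncatedWittVector.out
    TruncatedWittVector.truncateFun_out _ x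

theorem truncate_verschiebung_congr {x y : WittVector p k} (h : x.coeff 0 = y.coeff 0) :
    WittVector.truncate (p := p) 2 (WittVector.verschiebung x) =
      WittVector.truncate 2 (WittVector.verschiebung y) := by
  apply TruncatedWittVector.ext
  intro i
  rw [WittVector.coeff_truncate, WittVector.coeff_truncate]
  fin_cases i
  · simp
  · simpa using h

/-- The additive embedding `a ↦ (0, a)` of `k` into `W₂(k)`. -/
noncomputable def wittEps : k →+ TruncatedWittVector p 2 k :=
  AddMonoidHom.mk' (fun a => WittVector.truncate 2 (WittVector.verschiebung
    (WittVector.teichmuller p a))) (by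
      intro a b
      rw [← map_add, ← map_add]
      apply truncate_verschiebung_congr
      simp [WittVector.add_coeff_zero])

theorem wittEps_coeff (x : WittVector p k) :
    wittEps p k (x.coeff 0) = WittVector.truncate 2 (WittVector.verschiebung x) :=
  truncate_verschiebung_congr p k (by simp)

theorem isWittExt [CharP k p] : IsWittExt p (wittRed p k) (wittEps p k) where
  surj a := ⟨WittVector.truncate 2 (WittVector.teichmuller p a), by
    rw [wittRed_truncate]; simp⟩
  inj a b h := by
    have := congrArg (fun x => TruncatedWittVector.coeff (1 : Fin 2) x) h
    simp only [wittEps, AddMonoidHom.mk'_apply, WittVector.coeff_truncate] at this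
    simpa using this
  red_eq_zero r hr := by
    obtain ⟨x, rfl⟩ := WittVector.truncate_surjective p 2 k r
    rw [wittRed_truncate] at hr
    refine ⟨x.coeff 1, ?_⟩
    have : x.coeff 1 = (WittVector.teichmuller p (x.coeff 1)).coeff 0 := by simp
    rw [this, wittEps_coeff]
    apply TruncatedWittVector.ext
    intro i
    rw [WittVector.coeff_truncate, WittVector.coeff_truncate]
    fin_cases i
    · simp [hr]
    · simp
  red_eps a := by
    have h : wittEps p k a = WittVector.truncate 2
      (WittVector.verschiebung (WittVector.teichmuller p a)) := rfl
    rw [h, wittRed_truncate]; simp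
  mul_eps r a := by
    obtain ⟨x, rfl⟩ := WittVector.truncate_surjective p 2 k r
    rw [wittRed_truncate]
    have h : x.coeff 0 ^ p * a =
        (WittVector.teichmuller p a * WittVector.frobenius x).coeff 0 := by
      simp [WittVector.mul_coeff_zero, WittVector.coeff_frobenius_charP, mul_comm]
    rw [h, wittEps_coeff, WittVector.verschiebung_mul_frobenius, map_mul, mul_comm]
    rfl
  natCast := by
    have h : (1 : k) = (WittVector.frobenius (1 : WittVector p k)).coeff 0 := by simp
    rw [h, wittEps_coeff, WittVector.verschiebung_frobenius]
    simp

end WittInterface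

namespace IsWittExt

variable {p : ℕ} {k R : Type} [Field k] [CommRing R] {π : R →+* k} {ε : k →+ R}

theorem eps_mul_eps (h : IsWittExt p π ε) (hp : p ≠ 0) (a b : k) : ε a * ε b = 0 := by
  rw [h.mul_eps, h.red_eps]; simp [hp]

theorem natCast_mul_eps [CharP k p] (a : k) : (p : R) * ε a = 0 := by
  rw [← nsmul_eq_mul, ← map_nsmul]; simp

theorem isUnit_of_red (h : IsWittExt p π ε) (hp : p ≠ 0) {r : R} (hr : IsUnit (π r)) :
    IsUnit r := by
  obtain ⟨s, hs⟩ := h.surj (π r)⁻¹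
  have h1 : π (r * s - 1) = 0 := by
    rw [map_sub, map_mul, hs, mul_inv_cancel₀ hr.ne_zero]; simp
  obtain ⟨a, ha⟩ := h.red_eq_zero _ h1
  have h2 : r * s * (1 - ε a) = 1 := by
    have : r * s = 1 + ε a := by rw [ha]; ring
    rw [this]
    have := h.eps_mul_eps hp a a
    linear_combination -this
  exact IsUnit.of_mul_eq_one (s * (1 - ε a)) (by linear_combination h2)

end IsWittExt

/-- **Gaschütz.** A homomorphism lifts along a surjection with abelian kernel of exponent `p` as
soon as its restriction to a subgroup of finite index prime to `p` does. -/
theorem exists_lift_of_coprime_index {Γ E Q : Type*} [Group Γ] [Group E] [Group Q]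
    (Γ' : Subgroup Γ) [Γ'.FiniteIndex] {p : ℕ} (hp : 1 < p) (hcop : Nat.Coprime Γ'.index p)
    (π : E →* Q) (hπ : Function.Surjective π) (hab : ∀ a ∈ π.ker, ∀ b ∈ π.ker, a * b = b * a)
    (hexp : ∀ a ∈ π.ker, a ^ p = 1) (ρ : Γ →* Q) (ρ' : Γ' →* E) (hρ' : ∀ h, π (ρ' h) = ρ h) :
    ∃ ρ₂ : Γ →* E, π.comp ρ₂ = ρ ∧ ∀ N : Subgroup Γ, N.Normal →
      (∀ n ∈ N, ∃ h : n ∈ Γ', ρ' ⟨n, h⟩ = 1) → ∀ n ∈ N, ρ₂ n = 1 := by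
  classical
  let _ : CommGroup π.ker :=
    { (inferInstance : Group π.ker) with
      mul_comm := fun a b => Subtype.ext (hab a a.2 b b.2) }
  let _ : Fintype (Γ ⧸ Γ') := Fintype.ofFinite _
  choose t ht using fun q : Γ ⧸ Γ' => hπ (ρ q.out)
  have hout : ∀ g : Γ, ((g : Γ ⧸ Γ').out)⁻¹ * g ∈ Γ' := fun g => by
    rw [← QuotientGroup.eq]; simp
  obtain ⟨s, hs, hsm⟩ : ∃ s : Γ → E, (∀ g, π (s g) = ρ g) ∧
      ∀ g (h : Γ'), s (g * h) = s g * ρ' h := by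
    refine ⟨fun g => t g * ρ' ⟨_, hout g⟩, fun g => ?_, fun g h => ?_⟩
    · rw [map_mul, ht, hρ', ← map_mul]; simp
    · have hq : ((g * h : Γ) : Γ ⧸ Γ') = g := by simp
      rw [mul_assoc, ← map_mul]
      simp only [hq]
      congr 2
      ext
      simp [mul_assoc]
  have hcmem : ∀ x y, s x * s y * (s (x * y))⁻¹ ∈ π.ker := fun x y => by
    simp [MonoidHom.mem_ker, hs]
  let c : Γ → Γ → π.ker := fun x y => ⟨_, hcmem x y⟩
  have hcoc : ∀ x y z, MulAut.conjNormal (s x) (c y z) * c x (y * z) = c x y * c (x * y) z := by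
    intro x y z
    ext
    simp [c, mul_assoc]
  have hcΓ : ∀ x y (h : Γ'), c x (y * h) = c x y := by
    intro x y h
    ext
    simp [c, hsm, ← mul_assoc]
  let c' : Γ → Γ ⧸ Γ' → π.ker := fun x q => c x q.out
  have hc' : ∀ x (y : Γ), c' x y = c x y := by
    intro x y
    have := hcΓ x (y : Γ ⧸ Γ').out ⟨_, hout y⟩
    simpa using this.symm
  let C : Γ → π.ker := fun x => ∏ q, c' x q
  have hC : ∀ x y, MulAut.conjNormal (s x) (C y) * C x = c x y ^ Γ'.index * C (x * y) := by
    intro x y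
    have h1 : ∏ q : Γ ⧸ Γ', c' x (y • q) = C x :=
      Fintype.prod_equiv (MulAction.toPerm y) _ _ fun _ => rfl
    rw [← h1, map_prod, ← Finset.prod_mul_distrib, Subgroup.index, Nat.card_eq_fintype_card,
      ← Finset.card_univ, ← Finset.prod_const, ← Finset.prod_mul_distrib]
    refine Finset.prod_congr rfl fun q _ => ?_
    induction q using QuotientGroup.induction_on with
    | H z =>
      have : y • (z : Γ ⧸ Γ') = ((y * z : Γ) : Γ ⧸ Γ') := rfl
      rw [this, hc', hc', hc', hcoc]
  obtain ⟨m, hm⟩ : ∃ m : ℕ, Γ'.index * m ≡ 1 [MOD p] := by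
    obtain ⟨m, hm⟩ := Nat.exists_mul_mod_eq_one_of_coprime hcop hp
    exact ⟨m, hm.2.trans (Nat.mod_eq_of_lt hp).symm⟩
  have hpow : ∀ a : π.ker, a ^ (Γ'.index * m) = a := by
    intro a
    have ha : a ^ p = 1 := Subtype.ext (hexp a a.2)
    conv_rhs => rw [← pow_one a]
    rw [pow_eq_pow_iff_modEq]
    exact hm.of_dvd (orderOf_dvd_of_pow_eq_one ha)
  let f : Γ → E := fun x => ((C x ^ m)⁻¹ : π.ker) * s x
  have hf : ∀ x y, f (x * y) = f x * f y := by
    intro x y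
    have h1 : MulAut.conjNormal (s x) (C y ^ m) * C x ^ m = c x y * C (x * y) ^ m := by
      rw [map_pow, ← mul_pow, hC, mul_pow, ← pow_mul, hpow]
    have h2 : (C (x * y) ^ m)⁻¹ = (C x ^ m)⁻¹ * MulAut.conjNormal (s x) ((C y ^ m)⁻¹) * c x y := by
      rw [map_inv, ← mul_inv, mul_comm (C x ^ m), h1]; simp
    have h3 : (c x y : E) = s x * s y * (s (x * y))⁻¹ := rfl
    have h4 := congrArg (Subtype.val) h2
    simp only [Subgroup.coe_mul, MulAut.conjNormal_apply, h3] at h4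
    simp only [f]
    rw [h4]
    group
  refine ⟨MonoidHom.mk' f hf, ?_, ?_⟩
  · ext x
    have : π ((C x ^ m)⁻¹ : π.ker) = 1 := ((C x ^ m)⁻¹ : π.ker).2
    change π (_ * _) = _
    rw [map_mul, this, one_mul, hs]
  · intro N hN hN' n hn
    have h1 : ∀ y, s (n * y) = s y := by
      intro y
      obtain ⟨h, h'⟩ := hN' _ (hN.conj_mem n hn y⁻¹)
      have := hsm y ⟨_, h⟩
      rw [h', mul_one] at this
      rw [← this]; congr 1; simp [mul_assoc]
    have hsn : s n = s 1 := by simpa using h1 1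
    have h2 : f n = f 1 := by
      have : C n = C 1 := by
        refine Finset.prod_congr rfl fun q _ => ?_
        ext
        simp [c', c, h1, hsn]
      simp only [f, this, hsn]
    have : MonoidHom.mk' f hf n = MonoidHom.mk' f hf 1 := h2
    rw [this, map_one]

/-- An action of a topological group on a field by automorphisms which behaves like that of an
open subgroup of a Galois group with its Krull topology. -/
structure IsGaloisAction (Γ Ω : Type*) [Group Γ] [TopologicalSpace Γ] [Field Ω]
    [MulSemiringAction Γ Ω] : Prop where
  finite_quotient : ∀ U : Subgroup Γ, IsOpen (U : Set Γ) → Finite (Γ ⧸ U)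
  isOpen_stabilizer : ∀ x : Ω, IsOpen (MulAction.stabilizer Γ x : Set Γ)
  mem_of_fixes : ∀ U : Subgroup Γ, IsOpen (U : Set Γ) →
    ∀ g : Γ, (∀ x : Ω, (∀ u ∈ U, u • x = x) → g • x = x) → g ∈ U

theorem isGaloisAction_aut (F Ω : Type*) [Field F] [Field Ω] [Algebra F Ω] [IsGalois F Ω] :
    IsGaloisAction (Ω ≃ₐ[F] Ω) Ω where
  finite_quotient U hU := U.quotient_finite_of_isOpen hU
  isOpen_stabilizer x := stabilizer_isOpen_of_isIntegral (K := F) x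
  mem_of_fixes U hU g hg := by
    have h := InfiniteGalois.fixingSubgroup_fixedField (k := F) (K := Ω)
      ⟨U, U.isClosed_of_isOpen hU⟩
    change IntermediateField.fixingSubgroup (IntermediateField.fixedField U) = U at h
    rw [← h, IntermediateField.mem_fixingSubgroup_iff]
    intro x hx
    exact hg x fun u hu => hx ⟨u, hu⟩

theorem sum_out_mul {Γ M : Type*} [Group Γ] [AddCommMonoid M] (U : Subgroup Γ) [Fintype (Γ ⧸ U)]
    (f : Γ → M) (hf : ∀ g, ∀ u ∈ U, f (g * u) = f g) (h : Γ) :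
    ∑ q : Γ ⧸ U, f (h * q.out) = ∑ q : Γ ⧸ U, f q.out := by
  have key : ∀ g : Γ, f (g : Γ ⧸ U).out = f g := by
    intro g
    have h1 : g⁻¹ * (g : Γ ⧸ U).out ∈ U := by rw [← QuotientGroup.eq]; simp
    rw [← hf g _ h1]; simp
  refine Fintype.sum_equiv (MulAction.toPerm h) _ _ fun q => ?_
  induction q using QuotientGroup.induction_on with
  | H z =>
    have h1 : MulAction.toPerm h (z : Γ ⧸ U) = ((h * z : Γ) : Γ ⧸ U) := rfl
    rw [h1, key]
    have h2 : z⁻¹ * (z : Γ ⧸ U).out ∈ U := by rw [← QuotientGroup.eq]; simp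
    rw [← hf (h * z) _ h2]; simp [mul_assoc]

namespace IsGaloisAction

variable {Γ Ω : Type*} [Group Γ] [TopologicalSpace Γ] [Field Ω] [MulSemiringAction Γ Ω]

theorem subgroup [IsTopologicalGroup Γ] (h : IsGaloisAction Γ Ω) (H : Subgroup Γ)
    (hH : IsOpen (H : Set Γ)) : IsGaloisAction H Ω where
  finite_quotient U hU := by
    have h1 : IsOpen (U.map H.subtype : Set Γ) := by
      rw [Subgroup.coe_map]; exact hH.isOpenMap_subtype_val _ hU
    have := h.finite_quotient _ h1
    have : (U.map H.subtype).FiniteIndex := Subgroup.finiteIndex_of_finite_quotient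
    have h2 : (U.map H.subtype).subgroupOf H = U := by
      rw [Subgroup.subgroupOf, Subgroup.comap_map_eq_self_of_injective H.subtype_injective]
    rw [← h2]
    infer_instance
  isOpen_stabilizer x := by
    have := (h.isOpen_stabilizer x).preimage (continuous_subtype_val (p := fun g => g ∈ H))
    exact this
  mem_of_fixes U hU g hg := by
    have h1 : IsOpen (U.map H.subtype : Set Γ) := by
      rw [Subgroup.coe_map]; exact hH.isOpenMap_subtype_val _ hU
    have h2 := h.mem_of_fixes _ h1 g fun x hx => hg x fun u hu => hx u ⟨u, hu, rfl⟩
    obtain ⟨u, hu, hug⟩ := h2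
    rwa [← Subtype.ext hug]

theorem exists_sum_ne_zero (h : IsGaloisAction Γ Ω) (U : Subgroup Γ) (hU : IsOpen (U : Set Γ))
    [Fintype (Γ ⧸ U)] (c : Γ → Ω) (hc : ∀ g, c g ≠ 0) :
    ∃ x : Ω, (∀ u ∈ U, u • x = x) ∧ ∑ q : Γ ⧸ U, c q.out * q.out • x ≠ 0 := by
  let S : Submonoid Ω :=
    { carrier := {x | ∀ u ∈ U, u • x = x}
      mul_mem' := fun ha hb u hu => by rw [smul_mul', ha u hu, hb u hu]
      one_mem' := fun u _ => smul_one u }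
  let χ : Γ ⧸ U → (S →* Ω) := fun q =>
    { toFun := fun x => q.out • (x : Ω)
      map_one' := smul_one _
      map_mul' := fun x y => smul_mul' _ _ _ }
  have hχ : Function.Injective χ := by
    intro q q' hqq
    have h1 : (q'.out)⁻¹ * q.out ∈ U := by
      refine h.mem_of_fixes U hU _ fun x hx => ?_
      have := DFunLike.congr_fun hqq (⟨x, hx⟩ : S)
      change q.out • x = q'.out • x at this
      rw [mul_smul, this, inv_smul_smul]
    rw [← QuotientGroup.eq] at h1
    simpa using h1.symm
  have hli := (linearIndependent_monoidHom S Ω).comp χ hχ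
  by_contra! hcon
  have h0 := Fintype.linearIndependent_iff.mp hli (fun q => c q.out) (by
    ext x
    simpa [χ] using hcon x x.2)
  exact hc _ (h0 ((1 : Γ) : Γ ⧸ U))

/-- Hilbert 90 for an open subgroup of a Galois group. -/
theorem exists_units_of_cocycle (h : IsGaloisAction Γ Ω) (U : Subgroup Γ)
    (hU : IsOpen (U : Set Γ)) (c : Γ → Ω) (hc0 : ∀ g, c g ≠ 0) (hcU : ∀ u ∈ U, c u = 1)
    (hc : ∀ g g', c (g * g') = c g * g • c g') : ∃ a : Ω, a ≠ 0 ∧ ∀ g, c g * g • a = a := by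
  have := h.finite_quotient U hU
  let _ : Fintype (Γ ⧸ U) := Fintype.ofFinite _
  obtain ⟨x, hx, hx0⟩ := h.exists_sum_ne_zero U hU c hc0
  refine ⟨_, hx0, fun g => ?_⟩
  have hsum := sum_out_mul U (fun q => c q * q • x) (fun g u hu => by
    rw [hc, hcU u hu, smul_one, mul_one, mul_smul, hx u hu]) g
  conv_rhs => rw [← hsum]
  rw [Finset.smul_sum, Finset.mul_sum]
  refine Finset.sum_congr rfl fun q _ => ?_
  rw [hc, smul_mul', mul_smul]
  ring

/-- An element of trace one. -/
theorem exists_trace_eq_one (h : IsGaloisAction Γ Ω) (U : Subgroup Γ) (hU : IsOpen (U : Set Γ))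
    [Fintype (Γ ⧸ U)] :
    ∃ x : Ω, (∀ u ∈ U, u • x = x) ∧ ∑ q : Γ ⧸ U, q.out • x = 1 := by
  obtain ⟨x, hx, hx0⟩ := h.exists_sum_ne_zero U hU 1 (by simp)
  simp only [Pi.one_apply, one_mul] at hx0
  set t := ∑ q : Γ ⧸ U, q.out • x with ht
  have htg : ∀ g : Γ, g • t = t := by
    intro g
    rw [ht, Finset.smul_sum, ← sum_out_mul U (fun q => q • x) (fun g u hu => by
      rw [mul_smul, hx u hu]) g]
    simp only [mul_smul]
  refine ⟨t⁻¹ * x, fun u hu => by rw [smul_mul', smul_inv'', htg, hx u hu], ?_⟩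
  simp_rw [smul_mul', smul_inv'', htg]
  rw [← Finset.mul_sum, ← ht, inv_mul_cancel₀ hx0]

/-- Hilbert 90 for the multiplicative group of functions on a `Γ`-set. -/
theorem exists_units_of_cocycle_fun [IsTopologicalGroup Γ] (h : IsGaloisAction Γ Ω)
    {Y : Type*} [MulAction Γ Y]
    (U : Subgroup Γ) (hU : IsOpen (U : Set Γ)) (hUY : ∀ u ∈ U, ∀ y : Y, u • y = y)
    (c : Γ → Y → Ω) (hc0 : ∀ g y, c g y ≠ 0) (hcU : ∀ u ∈ U, ∀ y, c u y = 1)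
    (hc : ∀ g g' y, c (g * g') y = c g y * g • c g' (g⁻¹ • y)) :
    ∃ a : Y → Ω, (∀ y, a y ≠ 0) ∧ ∀ g y, c g y * g • a (g⁻¹ • y) = a y := by
  have hstab : ∀ y : Y, IsOpen (MulAction.stabilizer Γ y : Set Γ) := fun y =>
    Subgroup.isOpen_mono (H₁ := U) (fun u hu => hUY u hu y) hU
  have h1 : ∀ y : Y, ∃ a : Ω, a ≠ 0 ∧ ∀ g : Γ, g • y = y → c g y * g • a = a := by
    intro y
    obtain ⟨a, ha, ha'⟩ := (h.subgroup _ (hstab y)).exists_units_of_cocycle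
      (U.subgroupOf (MulAction.stabilizer Γ y)) (hU.preimage continuous_subtype_val)
      (fun g => c g y) (fun g => hc0 _ _) (fun u hu => hcU _ hu _) (fun g g' => by
        have : (g : Γ)⁻¹ • y = y := by
          rw [inv_smul_eq_iff]; exact g.2.symm
        rw [Subgroup.coe_mul, hc, this]
        rfl)
    exact ⟨a, ha, fun g hg => ha' ⟨g, hg⟩⟩
  choose a ha0 ha using h1
  let r : Y → Y := fun y => (Quotient.mk (MulAction.orbitRel Γ Y) y).out
  have hr : ∀ y, ∃ t : Γ, t • r y = y := by
    intro y
    have : (MulAction.orbitRel Γ Y) y (r y) :=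
      Quotient.exact (Quotient.out_eq (Quotient.mk (MulAction.orbitRel Γ Y) y)).symm
    exact MulAction.orbitRel_apply.mp this
  have hrg : ∀ (g : Γ) y, r (g • y) = r y := by
    intro g y
    have : Quotient.mk (MulAction.orbitRel Γ Y) (g • y) = Quotient.mk _ y :=
      Quotient.sound (MulAction.orbitRel_apply.mpr ⟨g, rfl⟩)
    simp only [r, this]
  choose t ht using hr
  refine ⟨fun y => c (t y) y * t y • a (r y), fun y => mul_ne_zero (hc0 _ _) ?_, fun g y => ?_⟩
  · rw [Ne, smul_eq_zero_iff_eq]; exact ha0 _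
  · obtain ⟨y, rfl⟩ : ∃ y', g • y' = y := ⟨g⁻¹ • y, by simp⟩
    simp only [inv_smul_smul, hrg]
    have hk : ((t (g • y))⁻¹ * (g * t y)) • r y = r y := by
      have h1 := ht (g • y)
      rw [hrg] at h1
      rw [mul_smul, mul_smul, ht, inv_smul_eq_iff, h1]
    have h2 := ha (r y) _ hk
    have h3 : (t (g • y))⁻¹ • g • y = r y := by
      rw [inv_smul_eq_iff]
      have h1 := ht (g • y)
      rw [hrg] at h1
      exact h1.symm
    have h4 : c (g * t y) (g • y) = c (t (g • y)) (g • y) * t (g • y) •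
        c ((t (g • y))⁻¹ * (g * t y)) (r y) := by
      conv_lhs => rw [← mul_inv_cancel_left (t (g • y)) (g * t y), hc, h3]
    have h5 := congrArg (fun z => t (g • y) • z) h2
    simp only [smul_mul', smul_smul] at h5
    rw [mul_inv_cancel_left] at h5
    have h6 := hc g (t y) (g • y)
    rw [inv_smul_smul, h4] at h6
    rw [smul_mul', smul_smul, ← mul_assoc, ← h6, mul_assoc, h5]

end IsGaloisAction

theorem zmodChar_injective {Ω : Type*} [Field Ω] {n : ℕ} [NeZero n] {ζ : Ω}
    (hζ : IsPrimitiveRoot ζ n) : Function.Injective (AddChar.zmodChar n hζ.pow_eq_one) := by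
  intro a b hab
  rw [AddChar.zmodChar_apply, AddChar.zmodChar_apply] at hab
  exact ZMod.val_injective n (hζ.pow_inj (ZMod.val_lt a) (ZMod.val_lt b) hab)

theorem exists_zmodChar_eq {Ω : Type*} [Field Ω] {n : ℕ} [NeZero n] {ζ : Ω}
    (hζ : IsPrimitiveRoot ζ n) {z : Ω} (hz : z ^ n = 1) :
    ∃ a : ZMod n, AddChar.zmodChar n hζ.pow_eq_one a = z := by
  obtain ⟨i, -, hi⟩ := hζ.eq_pow_of_pow_eq_one hz
  exact ⟨i, by rw [AddChar.zmodChar_apply', hi]⟩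

namespace IsGaloisAction

variable {Γ Ω : Type*} [Group Γ] [TopologicalSpace Γ] [Field Ω]
  [MulSemiringAction Γ Ω]

/-- The conclusion of the lifting theorem for cocycles modulo `p`. -/
def LiftsCocycles (p : ℕ) (Γ Y : Type*) [Group Γ] [TopologicalSpace Γ] [MulAction Γ Y] : Prop :=
  ∃ χ : Γ →* ZMod (p ^ 2), (∃ V : Subgroup Γ, IsOpen (V : Set Γ) ∧ ∀ v ∈ V, χ v = 1) ∧
    (∀ g, (χ g).cast = (1 : ZMod p)) ∧
    ∀ c : Γ → Y → ZMod p, (∀ g h y, c (g * h) y = c g y + c h (g⁻¹ • y)) →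
      (∃ U : Subgroup Γ, IsOpen (U : Set Γ) ∧ ∀ u ∈ U, ∀ y, c u y = 0) →
      ∃ b : Γ → Y → ZMod (p ^ 2), (∀ g h y, b (g * h) y = b g y + χ g * b h (g⁻¹ • y)) ∧
        (∃ V : Subgroup Γ, IsOpen (V : Set Γ) ∧ ∀ v ∈ V, ∀ y, b v y = 0) ∧
        ∀ g y, (b g y).cast = c g y

theorem isOpen_iInf_stabilizer (h : IsGaloisAction Γ Ω) {Y : Type*} [Finite Y] (β : Y → Ω) :
    IsOpen ((⨅ y, MulAction.stabilizer Γ (β y) : Subgroup Γ) : Set Γ) := by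
  rw [Subgroup.coe_iInf]
  exact isOpen_iInter_of_finite fun y => h.isOpen_stabilizer _

omit [TopologicalSpace Γ] in
theorem smul_zmodChar_of_fixed {n : ℕ} [NeZero n] {ζ : Ω} (hζ : ζ ^ n = 1) (g : Γ)
    (hg : g • ζ = ζ) (a : ZMod n) :
    g • AddChar.zmodChar n hζ a = AddChar.zmodChar n hζ a := by
  rw [AddChar.zmodChar_apply, smul_pow', hg]

omit [TopologicalSpace Γ] in
theorem smul_zmodChar {n : ℕ} [NeZero n] {ζ : Ω} (hζ : ζ ^ n = 1) (g : Γ) (t : ZMod n)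
    (hg : g • ζ = AddChar.zmodChar n hζ t) (a : ZMod n) :
    g • AddChar.zmodChar n hζ a = AddChar.zmodChar n hζ (t * a) := by
  rw [AddChar.zmodChar_apply, smul_pow', hg, ← AddChar.map_nsmul_eq_pow, nsmul_eq_mul,
    ZMod.natCast_val, ZMod.cast_id, mul_comm]

theorem liftsCocycles_of_ne_char [IsTopologicalGroup Γ] [IsSepClosed Ω] (h : IsGaloisAction Γ Ω) (p : ℕ)
    [Fact p.Prime] (hp : (p : Ω) ≠ 0) (hfix : ∀ (g : Γ) (z : Ω), z ^ p = 1 → g • z = z)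
    (Y : Type*) [Finite Y] [MulAction Γ Y]
    (hY : ∃ U : Subgroup Γ, IsOpen (U : Set Γ) ∧ ∀ u ∈ U, ∀ y : Y, u • y = y) :
    LiftsCocycles p Γ Y := by
  have hp0 : p ≠ 0 := (Fact.out : p.Prime).ne_zero
  have : NeZero (p : Ω) := ⟨hp⟩
  have : NeZero ((p ^ 2 : ℕ) : Ω) := ⟨by simpa using hp⟩
  obtain ⟨ζ, hζ⟩ := HasEnoughRootsOfUnity.exists_primitiveRoot Ω (p ^ 2)
  have hζp : IsPrimitiveRoot (ζ ^ p) p := hζ.pow (by positivity) (by ring)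
  set e := AddChar.zmodChar (p ^ 2) hζ.pow_eq_one with he
  set e₁ := AddChar.zmodChar p hζp.pow_eq_one with he₁
  have heinj : Function.Injective e := zmodChar_injective hζ
  have he₁inj : Function.Injective e₁ := zmodChar_injective hζp
  have hep : ∀ a, e a ^ p = e₁ a.cast := by
    intro a
    obtain ⟨a, rfl⟩ := ZMod.natCast_zmod_surjective a
    rw [ZMod.cast_natCast (dvd_pow_self p two_ne_zero), he, he₁, AddChar.zmodChar_apply',
      AddChar.zmodChar_apply', ← pow_mul, ← pow_mul, mul_comm]
  have he1 : e 1 = ζ := by simpa using AddChar.zmodChar_apply' hζ.pow_eq_one 1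
  have h1 : ∀ g : Γ, ∃ t : ZMod (p ^ 2), g • ζ = e t := fun g => by
    obtain ⟨t, ht⟩ := exists_zmodChar_eq hζ (z := g • ζ)
      (by rw [← smul_pow', hζ.pow_eq_one, smul_one])
    exact ⟨t, ht.symm⟩
  choose χ hχ using h1
  have hsm : ∀ g a, g • e a = e (χ g * a) := fun g a =>
    smul_zmodChar hζ.pow_eq_one g (χ g) (hχ g) a
  have hsm₁ : ∀ (g : Γ) a, g • e₁ a = e₁ a := fun g a =>
    smul_zmodChar_of_fixed hζp.pow_eq_one g (hfix g _ hζp.pow_eq_one) a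
  refine ⟨MonoidHom.mk' (M := Γ) (G := (ZMod (p ^ 2))ˣ)
    (fun g => Units.mkOfMulEqOne (χ g) (χ g⁻¹) ?_) ?_ |> (Units.coeHom _).comp, ?_, ?_, ?_⟩
  · apply heinj
    rw [he1, ← hsm, ← hχ, smul_inv_smul]
  · intro g g'
    ext
    change χ (g * g') = χ g * χ g'
    apply heinj
    rw [← hχ, ← hsm, ← hχ, mul_smul]
  · refine ⟨_, h.isOpen_stabilizer ζ, fun v hv => ?_⟩
    apply heinj
    change e (χ v) = _
    rw [← hχ, he1]; exact hv
  · intro g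
    change (χ g).cast = _
    apply he₁inj
    rw [← hep, ← hχ, ← smul_pow', hfix _ _ hζp.pow_eq_one]
    simpa using (AddChar.zmodChar_apply' hζp.pow_eq_one 1).symm
  · intro c hc ⟨U, hU, hcU⟩
    obtain ⟨U', hU', hUY⟩ := hY
    obtain ⟨a, ha0, ha⟩ := h.exists_units_of_cocycle_fun (Y := Y) (U ⊓ U') (hU.inter hU')
      (fun u hu y => hUY u hu.2 y) (fun g y => e₁ (c g y)) (fun g y => (AddChar.val_isUnit e₁ _).ne_zero)
      (fun u hu y => by simp [hcU u hu.1 y]) (fun g g' y => by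
        rw [hc, AddChar.map_add_eq_mul, hsm₁])
    choose β hβ using fun y => IsSepClosed.exists_pow_nat_eq (a y) p
    have hβ0 : ∀ y, β y ≠ 0 := fun y hy => ha0 y (by rw [← hβ, hy, zero_pow hp0])
    have hgβ0 : ∀ (g : Γ) y, g • β y ≠ 0 := fun g y => by
      rw [Ne, smul_eq_zero_iff_eq]; exact hβ0 y
    have hz : ∀ (g : Γ) y, (β y / g • β (g⁻¹ • y)) ^ p = e₁ (c g y) := by
      intro g y
      rw [div_pow, ← smul_pow', hβ, hβ, div_eq_iff, ha]
      rw [Ne, smul_eq_zero_iff_eq]; exact ha0 _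
    have h2 : ∀ (g : Γ) y, ∃ b : ZMod (p ^ 2), β y = e b * g • β (g⁻¹ • y) := by
      intro g y
      obtain ⟨b, hb⟩ := exists_zmodChar_eq hζ (z := β y / g • β (g⁻¹ • y)) (by
        rw [pow_two, pow_mul, hz, ← AddChar.map_nsmul_eq_pow]; simp)
      refine ⟨b, ?_⟩
      rw [he, hb, div_mul_cancel₀ _ (hgβ0 _ _)]
    choose b hb using h2
    refine ⟨b, ?_, ⟨U' ⊓ ⨅ y, MulAction.stabilizer Γ (β y),
      hU'.inter (h.isOpen_iInf_stabilizer β), ?_⟩, ?_⟩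
    · intro g g' y
      apply heinj
      change _ = e (_ + χ g * _)
      have h3 := hb (g * g') y
      have h4 := hb g' (g⁻¹ • y)
      simp only [mul_inv_rev, mul_smul] at h3
      rw [hb g y, h4, smul_mul', ← mul_assoc, smul_smul g g'] at h3
      rw [AddChar.map_add_eq_mul, ← hsm]
      exact (mul_right_cancel₀ (hgβ0 _ _) (by rw [mul_smul]; rwa [mul_smul] at h3)).symm
    · intro v hv y
      apply heinj
      have h3 := hb v y
      have h4 : v⁻¹ • y = y := hUY _ (inv_mem hv.1) y
      have h5 : v • β y = β y := (Subgroup.mem_iInf.mp hv.2) y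
      rw [h4, h5] at h3
      rw [AddChar.map_zero_eq_one]
      exact mul_right_cancel₀ (hβ0 y) (by rw [← h3, one_mul])
    · intro g y
      apply he₁inj
      rw [← hep, ← hz]
      congr 1
      rw [eq_div_iff (hgβ0 _ _)]
      exact (hb g y).symm

end IsGaloisAction

/-- Multiplication by `p` as a map `ZMod p → ZMod (p ^ 2)`. -/
theorem exists_mul_p_hom (p : ℕ) [Fact p.Prime] : ∃ P : ZMod p →+ ZMod (p ^ 2),
    Function.Injective P ∧ (∀ r : ZMod (p ^ 2), (r.cast : ZMod p) = 0 → ∃ a, P a = r) ∧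
      ∀ a, ((P a).cast : ZMod p) = 0 := by
  have hp : p ∣ p ^ 2 := dvd_pow_self p two_ne_zero
  let P : ZMod p →+ ZMod (p ^ 2) := ZMod.lift p ⟨zmultiplesHom _ (p : ZMod (p ^ 2)), by
    simp only [zmultiplesHom_apply, natCast_zsmul, nsmul_eq_mul]
    exact_mod_cast (by rw [← pow_two]; exact ZMod.natCast_self (p ^ 2) :
      ((p * p : ℕ) : ZMod (p ^ 2)) = 0)⟩
  have hP : ∀ n : ℕ, P n = ((n * p : ℕ) : ZMod (p ^ 2)) := fun n => by
    have := ZMod.lift_coe p (⟨zmultiplesHom _ (p : ZMod (p ^ 2)), by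
      simp only [zmultiplesHom_apply, natCast_zsmul, nsmul_eq_mul]
      exact_mod_cast (by rw [← pow_two]; exact ZMod.natCast_self (p ^ 2) :
        ((p * p : ℕ) : ZMod (p ^ 2)) = 0)⟩ : {f : ℤ →+ ZMod (p ^ 2) // f p = 0}) (n : ℤ)
    simpa using this
  refine ⟨P, ?_, ?_, ?_⟩
  · rw [injective_iff_map_eq_zero]
    intro a ha
    obtain ⟨n, rfl⟩ := ZMod.natCast_zmod_surjective a
    rw [hP, ZMod.natCast_eq_zero_iff, pow_two] at ha
    rw [ZMod.natCast_eq_zero_iff]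
    exact Nat.dvd_of_mul_dvd_mul_right (Fact.out : p.Prime).pos ha
  · intro r hr
    obtain ⟨n, rfl⟩ := ZMod.natCast_zmod_surjective r
    rw [ZMod.cast_natCast hp, ZMod.natCast_eq_zero_iff] at hr
    obtain ⟨m, rfl⟩ := hr
    exact ⟨m, by rw [hP, mul_comm]⟩
  · intro a
    obtain ⟨n, rfl⟩ := ZMod.natCast_zmod_surjective a
    rw [hP, ZMod.cast_natCast hp]
    simp

namespace IsGaloisAction

variable {Γ Ω : Type*} [Group Γ] [TopologicalSpace Γ] [Field Ω] [MulSemiringAction Γ Ω]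

theorem liftsCocycles_of_char [IsSepClosed Ω] (h : IsGaloisAction Γ Ω) (p : ℕ)
    [Fact p.Prime] [CharP Ω p] (Y : Type*) [Finite Y] [MulAction Γ Y]
    (hY : ∃ U : Subgroup Γ, IsOpen (U : Set Γ) ∧ ∀ u ∈ U, ∀ y : Y, u • y = y) :
    LiftsCocycles p Γ Y := by
  have hp : p ∣ p ^ 2 := dvd_pow_self p two_ne_zero
  refine ⟨1, ⟨⊤, isOpen_univ, fun _ _ => rfl⟩, fun g => ZMod.cast_one hp, ?_⟩
  intro c hc ⟨U, hU, hcU⟩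
  obtain ⟨P, hPinj, hPex, hPcast⟩ := exists_mul_p_hom p
  obtain ⟨U', hU', hUY⟩ := hY
  obtain ⟨s, hs0, hs⟩ : ∃ s : ZMod p → ZMod (p ^ 2), s 0 = 0 ∧ ∀ a, ((s a).cast : ZMod p) = a :=
    ⟨fun a => a.val, by simp, fun a => by rw [ZMod.cast_natCast hp]; simp⟩
  have hE : ∀ (g g' : Γ) (y : Y), ∃ a, P a =
      s (c g y) + s (c g' (g⁻¹ • y)) - s (c (g * g') y) := by
    intro g g' y
    apply hPex
    rw [ZMod.cast_sub hp, ZMod.cast_add hp, hs, hs, hs, hc, sub_self]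
  choose E hE using hE
  have hEcoc : ∀ g g' q y, E g' q (g⁻¹ • y) + E g (g' * q) y = E (g * g') q y + E g g' y := by
    intro g g' q y
    apply hPinj
    simp only [map_add, hE, mul_inv_rev, mul_smul, mul_assoc]
    abel
  have hcu : ∀ g, ∀ u ∈ U, ∀ y, c (g * u) y = c g y := fun g u hu y => by
    rw [hc, hcU u hu, add_zero]
  have hEu : ∀ g q, ∀ u ∈ U, ∀ y, E g (q * u) y = E g q y := by
    intro g q u hu y
    apply hPinj
    rw [hE, hE, ← mul_assoc, hcu _ u hu, hcu _ u hu]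
  have hEu' : ∀ u ∈ U ⊓ U', ∀ g y, E u g y = 0 := by
    intro u hu g y
    apply hPinj
    rw [hE, hc, hcU u hu.1, hs0, zero_add, zero_add, sub_self, map_zero]
  set W := U ⊓ U' with hW
  have hWo : IsOpen (W : Set Γ) := hU.inter hU'
  have := h.finite_quotient W hWo
  let _ : Fintype (Γ ⧸ W) := Fintype.ofFinite _
  obtain ⟨θ, hθ, hθ1⟩ := h.exists_trace_eq_one W hWo
  let ι : ZMod p →+* Ω := ZMod.castHom dvd_rfl Ω
  have hι : ∀ (g : Γ) a, g • ι a = ι a := by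
    intro g a
    have : (MulSemiringAction.toRingHom Γ Ω g).comp ι = ι := Subsingleton.elim _ _
    exact RingHom.congr_fun this a
  have hιp : ∀ a, ι a ^ p = ι a := fun a => by rw [← map_pow, ZMod.pow_card]
  let b : Γ → Y → Ω := fun g y => ∑ q : Γ ⧸ W, ι (E g q.out y) * (g * q.out) • θ
  have hb : ∀ g g' y, b (g * g') y = b g y + g • b g' (g⁻¹ • y) - ι (E g g' y) := by
    intro g g' y
    have h1 := sum_out_mul W (fun q => ι (E g q y) * (g * q) • θ) (fun q u hu => by
      rw [hEu g q u hu.1, ← mul_assoc, mul_smul _ u, hθ u hu]) g'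
    have h2 : ι (E g g' y) = ∑ q : Γ ⧸ W, ι (E g g' y) * (g * g' * q.out) • θ := by
      rw [← Finset.mul_sum]
      simp only [mul_smul]
      rw [← Finset.smul_sum, ← Finset.smul_sum, hθ1, smul_one, smul_one, mul_one]
    simp only [b]
    rw [← h1, h2, Finset.smul_sum, ← Finset.sum_add_distrib, ← Finset.sum_sub_distrib]
    refine Finset.sum_congr rfl fun q _ => ?_
    rw [smul_mul', hι, smul_smul, ← mul_assoc, ← add_mul, ← sub_mul, ← map_add,
      ← map_sub]
    congr 2
    linear_combination -hEcoc g g' q.out y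
  have hbW : ∀ u ∈ W, ∀ y, b u y = 0 := by
    intro u hu y
    refine Finset.sum_eq_zero fun q _ => ?_
    rw [hEu' u hu, map_zero, zero_mul]
  let μ : Γ → Y → Ω := fun g y => b g y ^ p - b g y
  have hμ : ∀ g g' y, μ (g * g') y = μ g y + g • μ g' (g⁻¹ • y) := by
    intro g g' y
    simp only [μ]
    rw [hb, sub_pow_char, add_pow_char, hιp, smul_sub, smul_pow']
    ring
  have hμW : ∀ u ∈ W, ∀ y, μ u y = 0 := by
    intro u hu y
    simp only [μ]
    rw [hbW u hu, zero_pow (Fact.out : p.Prime).ne_zero, sub_zero]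
  let m : Y → Ω := fun y => ∑ q : Γ ⧸ W, μ q.out y * q.out • θ
  have hm : ∀ (g : Γ) y, g • m (g⁻¹ • y) = m y - μ g y := by
    intro g y
    have h1 := sum_out_mul W (fun q => μ q y * q • θ) (fun q u hu => by
      rw [hμ, hμW u hu, smul_zero, add_zero, mul_smul, hθ u hu]) g
    have h2 : μ g y = ∑ q : Γ ⧸ W, μ g y * (g * q.out) • θ := by
      rw [← Finset.mul_sum]
      simp only [mul_smul]
      rw [← Finset.smul_sum, hθ1, smul_one, mul_one]
    simp only [m]
    rw [← h1, h2, Finset.smul_sum, ← Finset.sum_sub_distrib]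
    refine Finset.sum_congr rfl fun q _ => ?_
    rw [hμ, smul_mul', smul_smul]
    ring
  have hm' : ∀ y, ∃ x, x ^ p - x = m y := by
    intro y
    obtain ⟨x, hx⟩ := IsSepClosed.exists_root_C_mul_X_pow_add_C_mul_X_add_C' p p 1 (-1) (-m y)
      dvd_rfl (Fact.out : p.Prime).two_le (by simp)
    exact ⟨x, by linear_combination hx⟩
  choose m' hm' using hm'
  have hn : ∀ (g : Γ) y, ∃ n : ZMod p, ι n = b g y - (m' y - g • m' (g⁻¹ • y)) := by
    intro g y
    have h1 : (b g y - (m' y - g • m' (g⁻¹ • y))) ^ p =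
        b g y - (m' y - g • m' (g⁻¹ • y)) := by
      rw [sub_pow_char, sub_pow_char, ← smul_pow']
      have h2 := hm g y
      rw [← hm', ← hm', smul_sub] at h2
      simp only [μ] at h2
      linear_combination h2
    rw [← Subfield.mem_bot_iff_pow_eq_self Ω p] at h1
    have h2 : (⊥ : Subfield Ω) ≤ ι.fieldRange := bot_le
    exact h2 h1
  choose n hn using hn
  have hncoc : ∀ g g' y, n (g * g') y = n g y + n g' (g⁻¹ • y) - E g g' y := by
    intro g g' y
    apply ι.injective
    have h1 := congrArg (fun z => g • z) (hn g' (g⁻¹ • y))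
    simp only [hι, smul_sub, smul_smul] at h1
    rw [map_sub, map_add, hn, h1, hn, hb]
    simp only [mul_inv_rev, mul_smul]
    ring
  refine ⟨fun g y => s (c g y) - P (n g y), ?_,
    ⟨W ⊓ ⨅ y, MulAction.stabilizer Γ (m' y), hWo.inter (h.isOpen_iInf_stabilizer m'), ?_⟩, ?_⟩
  · intro g g' y
    beta_reduce
    rw [hncoc, map_sub, map_add, hE, MonoidHom.one_apply]
    ring
  · intro v hv y
    have h4 : v⁻¹ • y = y := hUY _ (inv_mem hv.1.2) y
    have h5 : v • m' y = m' y := (Subgroup.mem_iInf.mp hv.2) y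
    have h6 : n v y = 0 := by
      apply ι.injective
      rw [hn, h4, h5, hbW v hv.1, sub_self, sub_zero, map_zero]
    simp only [h6, hcU v hv.1.1, hs0, map_zero, sub_zero]
  · intro g y
    simp only
    rw [ZMod.cast_sub hp, hs, hPcast, sub_zero]

end IsGaloisAction

section BlockPerm

variable {X X' : Type} [Fintype X] [Fintype X'] [DecidableEq X] [DecidableEq X']
  {R : Type} [CommRing R]

/-- The block matrix `[[s • τ, B], [0, τ']]` with permutation matrices `τ`, `τ'`. -/
def blockPerm (τ : Equiv.Perm X) (τ' : Equiv.Perm X') (B : Matrix X X' R) (s : R) :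
    Matrix (X ⊕ X') (X ⊕ X') R :=
  Matrix.fromBlocks (Matrix.of fun i j => if i = τ j then s else 0) B 0
    (Matrix.of fun i j => if i = τ' j then 1 else 0)

theorem blockPerm_mul (τ σ : Equiv.Perm X) (τ' σ' : Equiv.Perm X') (B C : Matrix X X' R)
    (s t : R) : blockPerm τ τ' B s * blockPerm σ σ' C t =
      blockPerm (τ * σ) (τ' * σ')
        (Matrix.of fun x y => s * C (τ⁻¹ x) y + B x (σ' y)) (s * t) := by
  have h1 : ∀ x z, x = τ z ↔ z = τ⁻¹ x := fun x z => by
    rw [Equiv.Perm.eq_inv_iff_eq, eq_comm]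
  unfold blockPerm
  rw [Matrix.fromBlocks_multiply]
  congr 1
  · ext i j
    rw [Matrix.mul_zero, add_zero, Matrix.mul_apply]
    simp only [Matrix.of_apply, ite_mul, mul_ite, mul_zero, zero_mul, Finset.sum_ite_eq',
      Finset.mem_univ, if_true]
    split_ifs with h2 h3 h3
    · rfl
    · exact absurd h2 h3
    · exact absurd h3 h2
    · rfl
  · ext i j
    simp only [Matrix.mul_apply, Matrix.add_apply, Matrix.of_apply, mul_ite, mul_one, mul_zero,
      ite_mul, zero_mul]
    simp only [h1, Finset.sum_ite_eq', Finset.mem_univ, if_true]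
  · simp
  · ext i j
    rw [Matrix.zero_mul, zero_add, Matrix.mul_apply]
    simp only [Matrix.of_apply, mul_ite, mul_zero, mul_one, Finset.sum_ite_eq',
      Finset.mem_univ, if_true]
    split_ifs with h2 h3 h3
    · rfl
    · exact absurd h2 h3
    · exact absurd h3 h2
    · rfl

omit [Fintype X] [Fintype X'] in
theorem blockPerm_one : blockPerm (1 : Equiv.Perm X) (1 : Equiv.Perm X') (0 : Matrix X X' R) 1 =
    1 := by
  unfold blockPerm
  rw [← Matrix.fromBlocks_one]
  congr 1

omit [Fintype X] [Fintype X'] in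
theorem blockPerm_inj [Nontrivial R] {τ σ : Equiv.Perm X} {τ' σ' : Equiv.Perm X'}
    {B C : Matrix X X' R} (h : blockPerm τ τ' B 1 = blockPerm σ σ' C 1) :
    τ = σ ∧ τ' = σ' ∧ B = C := by
  unfold blockPerm at h
  rw [Matrix.fromBlocks_inj] at h
  refine ⟨?_, ?_, h.2.1⟩
  · ext j
    have := congrFun (congrFun h.1 (τ j)) j
    by_contra hne
    simp [hne] at this
  · ext j
    have := congrFun (congrFun h.2.2.2 (τ' j)) j
    by_contra hne
    simp [hne] at this

end BlockPerm

theorem IsWittExt.natCast_sq {p : ℕ} {k R : Type} [Field k] [CommRing R] {π : R →+* k} {ε : k →+ R}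
    [CharP k p] (h : IsWittExt p π ε) : ((p ^ 2 : ℕ) : R) = 0 := by
  have h1 := IsWittExt.natCast_mul_eps (p := p) (ε := ε) 1
  rw [← h.natCast] at h1
  rw [pow_two]; exact_mod_cast h1

theorem exists_lift_of_blockPerm {p : ℕ} [Fact p.Prime] {k R : Type} [Field k] [CharP k p]
    [CommRing R] {π : R →+* k} {ε : k →+ R} (hW : IsWittExt p π ε)
    {Γ : Type} [Group Γ] [TopologicalSpace Γ] [IsTopologicalGroup Γ]
    (hfin : ∀ U : Subgroup Γ, IsOpen (U : Set Γ) → Finite (Γ ⧸ U))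
    (hL : ∀ (Y : Type) [Finite Y] [MulAction Γ Y],
      (∃ U : Subgroup Γ, IsOpen (U : Set Γ) ∧ ∀ u ∈ U, ∀ y : Y, u • y = y) →
        IsGaloisAction.LiftsCocycles p Γ Y)
    {X X' : Type} [Fintype X] [Fintype X'] [DecidableEq X] [DecidableEq X']
    (ρ : Γ →* GL (X ⊕ X') k) (hρ : ∃ U : Subgroup Γ, IsOpen (U : Set Γ) ∧ ∀ u ∈ U, ρ u = 1)
    (hB : ∀ g, ∃ τ τ' B, (ρ g : Matrix (X ⊕ X') (X ⊕ X') k) = blockPerm τ τ' B 1) :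
    ∃ ρ₂ : Γ →* GL (X ⊕ X') R, (∃ V : Subgroup Γ, IsOpen (V : Set Γ) ∧ ∀ v ∈ V, ρ₂ v = 1) ∧
      (Matrix.GeneralLinearGroup.map π).comp ρ₂ = ρ := by
  choose τ τ' B hB using hB
  obtain ⟨U, hU, hUρ⟩ := hρ
  have hmul : ∀ g h, τ (g * h) = τ g * τ h ∧ τ' (g * h) = τ' g * τ' h ∧
      B (g * h) = Matrix.of fun x y => B h ((τ g)⁻¹ x) y + B g x (τ' h y) := by
    intro g h
    apply blockPerm_inj
    rw [← hB, map_mul, Units.val_mul, hB, hB, blockPerm_mul]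
    simp
  have hone : ∀ u ∈ U, τ u = 1 ∧ τ' u = 1 ∧ B u = 0 := by
    intro u hu
    apply blockPerm_inj
    rw [← hB, blockPerm_one, hUρ u hu]
    rfl
  let T : Γ →* Equiv.Perm X := MonoidHom.mk' τ fun g h => (hmul g h).1
  let T' : Γ →* Equiv.Perm X' := MonoidHom.mk' τ' fun g h => (hmul g h).2.1
  let _ : MulAction Γ X := MulAction.compHom X T
  let _ : MulAction Γ X' := MulAction.compHom X' T'
  have hTs : ∀ (g : Γ) (x : X), g • x = τ g x := fun _ _ => rfl
  have hTs' : ∀ (g : Γ) (x : X'), g • x = τ' g x := fun _ _ => rfl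
  have hTi : ∀ (g : Γ) (x : X), g⁻¹ • x = (τ g)⁻¹ x := fun g x => by
    rw [Equiv.Perm.eq_inv_iff_eq, ← hTs, smul_inv_smul]
  have hTi' : ∀ (g : Γ) (x : X'), g⁻¹ • x = (τ' g)⁻¹ x := fun g x => by
    rw [Equiv.Perm.eq_inv_iff_eq, ← hTs', smul_inv_smul]
  have hUY : ∀ u ∈ U, ∀ y : X × X', u • y = y := by
    intro u hu y
    ext
    · rw [Prod.smul_fst, hTs, (hone u hu).1]; rfl
    · rw [Prod.smul_snd, hTs', (hone u hu).2.1]; rfl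
  let c : Γ → X × X' → k := fun g y => B g y.1 (g⁻¹ • y.2)
  have hc : ∀ g h y, c (g * h) y = c g y + c h (g⁻¹ • y) := by
    intro g h y
    simp only [c]
    rw [(hmul g h).2.2, Matrix.of_apply, mul_inv_rev, mul_smul, Prod.smul_fst, Prod.smul_snd,
      ← hTs', smul_inv_smul, hTi g y.1, add_comm]
  have hcU : ∀ u ∈ U, ∀ y, c u y = 0 := by
    intro u hu y
    simp only [c]
    rw [(hone u hu).2.2]; rfl
  have := hfin U hU
  let _ : Fintype (Γ ⧸ U) := Fintype.ofFinite _
  let _ : Algebra (ZMod p) k := ZMod.algebra k p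
  let bas := Module.Basis.ofVectorSpace (ZMod p) k
  classical
  obtain ⟨S, hS⟩ : ∃ S : Finset (Module.Basis.ofVectorSpaceIndex (ZMod p) k),
      ∀ g y, ∀ i ∉ S, bas.repr (c g y) i = 0 := by
    refine ⟨Finset.univ.biUnion fun z : (Γ ⧸ U) × (X × X') =>
      (bas.repr (c z.1.out z.2)).support, fun g y i hi => ?_⟩
    have h1 : c (g : Γ ⧸ U).out y = c g y := by
      have h2 : g⁻¹ * (g : Γ ⧸ U).out ∈ U := by rw [← QuotientGroup.eq]; simp
      have h3 := hc g (g⁻¹ * (g : Γ ⧸ U).out) y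
      rwa [hcU _ h2, add_zero, mul_inv_cancel_left] at h3
    by_contra h0
    refine hi (Finset.mem_biUnion.mpr ⟨((g : Γ ⧸ U), y), Finset.mem_univ _, ?_⟩)
    simpa [h1] using h0
  obtain ⟨χ, ⟨V₀, hV₀, hχV⟩, hχ1, hlift⟩ := hL (X × X') ⟨U, hU, hUY⟩
  have h1 : ∀ i, ∃ b : Γ → X × X' → ZMod (p ^ 2),
      (∀ g h y, b (g * h) y = b g y + χ g * b h (g⁻¹ • y)) ∧
        (∃ V : Subgroup Γ, IsOpen (V : Set Γ) ∧ ∀ v ∈ V, ∀ y, b v y = 0) ∧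
        ∀ g y, (b g y).cast = bas.repr (c g y) i := fun i =>
    hlift (fun g y => bas.repr (c g y) i) (fun g h y => by rw [hc, map_add]; rfl)
      ⟨U, hU, fun u hu y => by rw [hcU u hu, map_zero]; rfl⟩
  choose b hbc hbV hb using h1
  choose V hV hbV using hbV
  let j : ZMod (p ^ 2) →+* R := ZMod.castHom (ringChar.dvd hW.natCast_sq) R
  have hj : ∀ a, π (j a) = algebraMap (ZMod p) k a.cast := by
    intro a
    have h2 : π.comp j = (algebraMap (ZMod p) k).comp
      (ZMod.castHom (dvd_pow_self p two_ne_zero) (ZMod p)) := Subsingleton.elim _ _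
    exact RingHom.congr_fun h2 a
  choose e he using fun i => hW.surj (bas i)
  let C : Γ → X × X' → R := fun g y => ∑ i ∈ S, j (b i g y) * e i
  have hCc : ∀ g h y, C (g * h) y = C g y + j (χ g) * C h (g⁻¹ • y) := by
    intro g h y
    simp only [C, Finset.mul_sum, ← Finset.sum_add_distrib]
    refine Finset.sum_congr rfl fun i _ => ?_
    rw [hbc, map_add, map_mul]
    ring
  have hCπ : ∀ g y, π (C g y) = c g y := by
    intro g y
    simp only [C, map_sum, map_mul, hj, hb, he]
    conv_rhs => rw [← bas.linearCombination_repr (c g y)]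
    rw [Finsupp.linearCombination_apply, Finsupp.sum_of_support_subset (s := S)]
    · simp only [Algebra.smul_def]
    · intro i hi
      by_contra hiS
      exact (Finsupp.mem_support_iff.mp hi) (hS g y i hiS)
    · simp
  let M : Γ → Matrix (X ⊕ X') (X ⊕ X') R := fun g =>
    blockPerm (τ g) (τ' g) (Matrix.of fun x y => C g (x, τ' g y)) (j (χ g))
  have hM : ∀ g h, M (g * h) = M g * M h := by
    intro g h
    simp only [M]
    rw [blockPerm_mul, (hmul g h).1, (hmul g h).2.1, map_mul, map_mul]
    congr 1
    ext x y
    simp only [Matrix.of_apply]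
    rw [hCc, Prod.smul_mk, hTi, hTi', Equiv.Perm.mul_apply, add_comm]
    simp
  have hMV : ∀ v : Γ, v ∈ U → χ v = 1 → (∀ i ∈ S, ∀ y, b i v y = 0) → M v = 1 := by
    intro v hv hv1 hv2
    simp only [M]
    rw [(hone v hv).1, (hone v hv).2.1, hv1, map_one, ← blockPerm_one]
    congr 1
    ext x y
    exact Finset.sum_eq_zero fun i hi => by rw [hv2 i hi, map_zero, zero_mul]
  have hM1 : M 1 = 1 := hMV 1 (one_mem _) (map_one _) fun i _ y => hbV i 1 (one_mem _) y
  refine ⟨MonoidHom.toHomUnits ⟨⟨M, hM1⟩, hM⟩, ⟨U ⊓ V₀ ⊓ ⨅ i : S, V i, ?_, ?_⟩, ?_⟩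
  · refine (hU.inter hV₀).inter ?_
    change IsOpen ((⨅ i : S, V i : Subgroup Γ) : Set Γ)
    rw [Subgroup.coe_iInf]
    exact isOpen_iInter_of_finite fun i => hV _
  · intro v hv
    apply Units.ext
    exact hMV v hv.1.1 (hχV v hv.1.2) fun i hi y => hbV i v (Subgroup.mem_iInf.mp hv.2 ⟨i, hi⟩) y
  · ext g i l
    change π (M g i l) = (ρ g).1 i l
    rw [hB]
    rcases i with i | i <;> rcases l with l | l
    · simp only [M, blockPerm, Matrix.fromBlocks_apply₁₁, Matrix.of_apply]
      split_ifs <;> simp [hj, hχ1]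
    · simp only [M, blockPerm, Matrix.fromBlocks_apply₁₂, Matrix.of_apply]
      rw [hCπ]
      simp [c, hTi']
    · simp [M, blockPerm]
    · simp only [M, blockPerm, Matrix.fromBlocks_apply₂₂, Matrix.of_apply]
      split_ifs <;> simp

theorem exists_sylow_comap {Γ : Type*} [Group Γ] (p : ℕ) [Fact p.Prime] (N : Subgroup Γ) [N.Normal]
    [Finite (Γ ⧸ N)] : ∃ Γ' : Subgroup Γ, N ≤ Γ' ∧ Nat.Coprime Γ'.index p ∧
      ∀ g ∈ Γ', ∃ a : ℕ, g ^ p ^ a ∈ N := by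
  obtain ⟨P⟩ : Nonempty (Sylow p (Γ ⧸ N)) := inferInstance
  refine ⟨P.1.comap (QuotientGroup.mk' N), fun n hn => ?_, ?_, fun g hg => ?_⟩
  · rw [Subgroup.mem_comap, (QuotientGroup.eq_one_iff n).mpr hn |> fun h =>
      (show QuotientGroup.mk' N n = 1 from h)]
    exact one_mem _
  · rw [Subgroup.index_comap_of_surjective _ (QuotientGroup.mk'_surjective N), Nat.coprime_comm]
    exact (Fact.out : p.Prime).coprime_iff_not_dvd.mpr P.not_dvd_index
  · obtain ⟨a, ha⟩ := P.2 ⟨_, hg⟩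
    refine ⟨a, ?_⟩
    rw [← QuotientGroup.eq_one_iff]
    exact congrArg Subtype.val ha

namespace IsWittExt

variable {p : ℕ} {k R : Type} [Field k] [CommRing R] {π : R →+* k} {ε : k →+ R}
  {n : Type*} [Fintype n] [DecidableEq n]

theorem map_GL_surjective (h : IsWittExt p π ε) (hp : p ≠ 0) :
    Function.Surjective (Matrix.GeneralLinearGroup.map (n := n) π) := by
  intro g
  choose f hf using h.surj
  have h1 : π.mapMatrix (g.1.map f) = g.1 := by
    ext i j
    simp [hf]
  have h2 : IsUnit (g.1.map f).det := by
    apply h.isUnit_of_red hp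
    rw [RingHom.map_det, h1]
    exact (Matrix.isUnit_iff_isUnit_det _).mp g.isUnit
  refine ⟨Matrix.GeneralLinearGroup.mk'' _ h2, ?_⟩
  ext i j
  exact congrFun (congrFun h1 i) j

theorem exists_eps_of_map_eq_zero (h : IsWittExt p π ε) (M : Matrix n n R)
    (hM : π.mapMatrix M = 0) : ∃ A : Matrix n n k, A.map ε = M := by
  choose f hf using fun i j => h.red_eq_zero (M i j) (congrFun (congrFun hM i) j)
  exact ⟨Matrix.of f, by ext i j; exact hf i j⟩

omit [DecidableEq n] in
theorem map_eps_mul_map_eps (h : IsWittExt p π ε) (hp : p ≠ 0) (A B : Matrix n n k) :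
    A.map ε * B.map ε = 0 := by
  ext i j
  simp [Matrix.mul_apply, h.eps_mul_eps hp]

theorem exists_eps_of_mem_ker (h : IsWittExt p π ε) {g : GL n R}
    (hg : g ∈ (Matrix.GeneralLinearGroup.map (n := n) π).ker) :
    ∃ A : Matrix n n k, (g : Matrix n n R) = 1 + A.map ε := by
  have h0 : π.mapMatrix g.1 = 1 := congrArg Units.val (MonoidHom.mem_ker.mp hg)
  obtain ⟨A, hA⟩ := h.exists_eps_of_map_eq_zero (g.1 - 1) (by rw [map_sub, h0, map_one, sub_self])
  exact ⟨A, by rw [hA]; abel⟩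

theorem one_add_map_eps_pow [CharP k p] (h : IsWittExt p π ε) (hp : p ≠ 0) (A : Matrix n n k) :
    (1 + A.map ε) ^ p = 1 := by
  have h1 : ∀ m : ℕ, (1 + A.map ε) ^ m = 1 + m • A.map ε := by
    intro m
    induction m with
    | zero => simp
    | succ m ih =>
      rw [pow_succ, ih, mul_add, mul_one, add_mul, one_mul, smul_mul_assoc,
        h.map_eps_mul_map_eps hp, smul_zero, add_zero, succ_nsmul, add_assoc]
  rw [h1]
  have : p • A.map ε = 0 := by
    ext i j
    rw [Matrix.smul_apply, Matrix.map_apply, nsmul_eq_mul, natCast_mul_eps]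
    rfl
  rw [this, add_zero]

theorem ker_map_GL_pow [CharP k p] (h : IsWittExt p π ε) (hp : p ≠ 0) {g : GL n R}
    (hg : g ∈ (Matrix.GeneralLinearGroup.map (n := n) π).ker) : g ^ p = 1 := by
  obtain ⟨A, hA⟩ := h.exists_eps_of_mem_ker hg
  apply Units.ext
  rw [Units.val_pow_eq_pow_val, hA, h.one_add_map_eps_pow hp]
  rfl

theorem ker_map_GL_comm (h : IsWittExt p π ε) (hp : p ≠ 0) {g g' : GL n R}
    (hg : g ∈ (Matrix.GeneralLinearGroup.map (n := n) π).ker)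
    (hg' : g' ∈ (Matrix.GeneralLinearGroup.map (n := n) π).ker) : g * g' = g' * g := by
  obtain ⟨A, hA⟩ := h.exists_eps_of_mem_ker hg
  obtain ⟨B, hB⟩ := h.exists_eps_of_mem_ker hg'
  apply Units.ext
  rw [Units.val_mul, Units.val_mul, hA, hB, add_mul, add_mul, mul_add, mul_add, mul_add, mul_add,
    h.map_eps_mul_map_eps hp, h.map_eps_mul_map_eps hp]
  simp only [one_mul, mul_one, add_zero]
  abel

end IsWittExt

theorem smul_eq_self_of_smul_pow {Ω Γ : Type*} [Field Ω] [Group Γ] [MulSemiringAction Γ Ω]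
    {p : ℕ} [Fact p.Prime] [NeZero (p : Ω)] [IsSepClosed Ω] {g : Γ} {a : ℕ}
    (hg : ∀ z : Ω, z ^ p = 1 → g ^ p ^ a • z = z) (z : Ω) (hz : z ^ p = 1) : g • z = z := by
  obtain ⟨ζ, hζ⟩ := HasEnoughRootsOfUnity.exists_primitiveRoot Ω p
  have h1 : (g • ζ) ^ p = 1 := by rw [← smul_pow', hζ.pow_eq_one, smul_one]
  obtain ⟨t, ht⟩ := exists_zmodChar_eq hζ h1
  have h2 : ∀ m : ℕ, g ^ m • ζ = AddChar.zmodChar p hζ.pow_eq_one (t ^ m) := by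
    intro m
    induction m with
    | zero =>
      rw [pow_zero, one_smul, pow_zero, AddChar.zmodChar_apply, ZMod.val_one, pow_one]
    | succ m ih =>
      rw [pow_succ', mul_smul, ih, IsGaloisAction.smul_zmodChar hζ.pow_eq_one g t ht.symm, pow_succ']
  have h3 : t = 1 := by
    have h4 := h2 (p ^ a)
    rw [hg ζ hζ.pow_eq_one, ZMod.pow_card_pow] at h4
    apply zmodChar_injective hζ
    rw [← h4, AddChar.zmodChar_apply, ZMod.val_one, pow_one]
  obtain ⟨b, rfl⟩ := exists_zmodChar_eq hζ hz
  rw [IsGaloisAction.smul_zmodChar hζ.pow_eq_one g t ht.symm, h3, one_mul]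

/-- Every finite `p`-subgroup of `GL n k` is conjugate into the group of block triangular matrices
with two blocks of permutation matrices. -/
def HasBlockShape (p : ℕ) (n k : Type) [Fintype n] [DecidableEq n] [Field k] : Prop :=
  ∀ H : Subgroup (GL n k), Finite H → IsPGroup p H →
    ∃ (X X' : Type) (_ : Fintype X) (_ : Fintype X') (_ : DecidableEq X) (_ : DecidableEq X')
      (e : n ≃ X ⊕ X') (q : GL n k), ∀ g ∈ H, ∃ τ τ' B,
        Matrix.reindex e e (q * g * q⁻¹ : GL n k).1 = blockPerm (τ : Equiv.Perm X)
          (τ' : Equiv.Perm X') B 1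

theorem exists_lift_of_hasBlockShape {p : ℕ} [Fact p.Prime] {k R : Type} [Field k] [CharP k p]
    [CommRing R] {π : R →+* k} {ε : k →+ R} (hW : IsWittExt p π ε) {n : Type} [Fintype n]
    [DecidableEq n] (hS : HasBlockShape p n k) {F : Type} [Field F] (ρ : AbsGal F →* GL n k)
    (hρ : IsOpen (ρ.ker : Set (AbsGal F))) :
    ∃ ρ₂ : AbsGal F →* GL n R, IsOpen (ρ₂.ker : Set (AbsGal F)) ∧
      (Matrix.GeneralLinearGroup.map π).comp ρ₂ = ρ := by
  have hp : p.Prime := Fact.out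
  let Ω := SeparableClosure F
  have hgal : IsGaloisAction (AbsGal F) Ω := isGaloisAction_aut F Ω
  let N₀ : Subgroup (AbsGal F) :=
    { carrier := {g | ∀ z : Ω, z ^ p = 1 → g • z = z}
      mul_mem' := fun ha hb z hz => by rw [mul_smul, hb z hz, ha z hz]
      one_mem' := fun z _ => one_smul _ z
      inv_mem' := fun {g} hg z hz => by rw [inv_smul_eq_iff, hg z hz] }
  have hN₀n : N₀.Normal := ⟨fun g hg h z hz => by
    have h1 : (h⁻¹ • z) ^ p = 1 := by rw [← smul_pow', hz, smul_one]
    rw [mul_smul, mul_smul, hg _ h1, smul_inv_smul]⟩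
  have hN₀ : IsOpen (N₀ : Set (AbsGal F)) := by
    have hf : {z : Ω | z ^ p = 1}.Finite := by
      classical
      refine (Polynomial.nthRoots p (1 : Ω)).toFinset.finite_toSet.subset fun z hz => ?_
      simpa [Polynomial.mem_nthRoots hp.pos] using hz
    have : Finite {z : Ω | z ^ p = 1} := hf
    refine Subgroup.isOpen_mono (fun g hg z hz => ?_)
      (hgal.isOpen_iInf_stabilizer (fun z : {z : Ω | z ^ p = 1} => z.1))
    exact Subgroup.mem_iInf.mp hg ⟨z, hz⟩
  let N := ρ.ker ⊓ N₀
  have hN : IsOpen (N : Set (AbsGal F)) := hρ.inter hN₀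
  have : Finite (AbsGal F ⧸ N) := hgal.finite_quotient N hN
  obtain ⟨Γ', hNΓ, hcop, hpow⟩ := exists_sylow_comap p N
  have hΓ' : IsOpen (Γ' : Set (AbsGal F)) := Subgroup.isOpen_mono hNΓ hN
  have : Finite (AbsGal F ⧸ Γ') := hgal.finite_quotient Γ' hΓ'
  have : Γ'.FiniteIndex := Subgroup.finiteIndex_of_finite_quotient
  have hgal' : IsGaloisAction Γ' Ω := hgal.subgroup Γ' hΓ'
  have hL : ∀ (Y : Type) [Finite Y] [MulAction Γ' Y],
      (∃ U : Subgroup Γ', IsOpen (U : Set Γ') ∧ ∀ u ∈ U, ∀ y : Y, u • y = y) →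
        IsGaloisAction.LiftsCocycles p Γ' Y := by
    intro Y _ _ hY
    by_cases h0 : (p : Ω) = 0
    · have : CharP Ω p := (CharP.charP_iff_prime_eq_zero hp).mpr h0
      exact hgal'.liftsCocycles_of_char p Y hY
    · have : NeZero (p : Ω) := ⟨h0⟩
      refine hgal'.liftsCocycles_of_ne_char p h0 (fun g z hz => ?_) Y hY
      obtain ⟨a, ha⟩ := hpow g.1 g.2
      exact smul_eq_self_of_smul_pow (g := g.1) (a := a) ha.2 z hz
  let H : Subgroup (GL n k) := Γ'.map ρ
  have hHf : Finite H := by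
    have : Finite ρ.range := by
      have := hgal.finite_quotient _ hρ
      exact Finite.of_equiv _ (QuotientGroup.quotientKerEquivRange ρ).toEquiv
    have hle : H ≤ ρ.range := by rintro _ ⟨g, -, rfl⟩; exact ⟨g, rfl⟩
    exact Finite.of_injective _ (Subgroup.inclusion_injective hle)
  have hHp : IsPGroup p H := by
    rintro ⟨_, g, hg, rfl⟩
    obtain ⟨a, ha⟩ := hpow g hg
    refine ⟨a, Subtype.ext ?_⟩
    change ρ g ^ p ^ a = 1
    rw [← map_pow]
    exact ha.1
  obtain ⟨X, X', _, _, _, _, e, q, hq⟩ := hS H hHf hHp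
  let E (S : Type) [CommRing S] : GL n S ≃* GL (X ⊕ X') S :=
    Units.mapEquiv (Matrix.reindexAlgEquiv S S e).toMulEquiv
  have hE : ∀ g : GL n R, Matrix.GeneralLinearGroup.map π (E R g) =
      E k (Matrix.GeneralLinearGroup.map π g) := by
    intro g
    ext i j
    rfl
  let ρ' : Γ' →* GL (X ⊕ X') k :=
    (E k).toMonoidHom.comp ((MulAut.conj q).toMonoidHom.comp (ρ.comp Γ'.subtype))
  obtain ⟨σ, ⟨V, hV, hσV⟩, hσ⟩ := exists_lift_of_blockPerm hW hgal'.finite_quotient hL ρ'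
    ⟨ρ.ker.subgroupOf Γ', hρ.preimage continuous_subtype_val, fun u hu => by
      have h1 : ρ u.1 = 1 := hu
      change E k (q * ρ u.1 * q⁻¹) = 1
      rw [h1, mul_one, mul_inv_cancel, map_one]⟩
    (fun g => hq _ ⟨g.1, g.2, rfl⟩)
  obtain ⟨q₂, hq₂⟩ := hW.map_GL_surjective hp.ne_zero q
  let σ' : Γ' →* GL n R := (MulAut.conj q₂⁻¹).toMonoidHom.comp ((E R).symm.toMonoidHom.comp σ)
  have hσ' : ∀ h, Matrix.GeneralLinearGroup.map π (σ' h) = ρ h := by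
    intro h
    have h1 : Matrix.GeneralLinearGroup.map π (σ h) = E k (q * ρ h * q⁻¹) :=
      DFunLike.congr_fun hσ h
    have h2 : Matrix.GeneralLinearGroup.map π ((E R).symm (σ h)) = q * ρ h * q⁻¹ := by
      apply (E k).injective
      rw [← hE, MulEquiv.apply_symm_apply, h1]
    change Matrix.GeneralLinearGroup.map π (q₂⁻¹ * (E R).symm (σ h) * q₂⁻¹⁻¹) = ρ h
    rw [inv_inv, map_mul, map_mul, h2, map_inv, hq₂]
    group
  obtain ⟨ρ₂, hρ₂, hker⟩ := exists_lift_of_coprime_index Γ' hp.one_lt hcop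
    (Matrix.GeneralLinearGroup.map π) (hW.map_GL_surjective hp.ne_zero)
    (fun a ha b hb => hW.ker_map_GL_comm hp.ne_zero ha hb)
    (fun a ha => hW.ker_map_GL_pow hp.ne_zero ha) ρ σ' hσ'
  refine ⟨ρ₂, ?_, hρ₂⟩
  have hV' : IsOpen (V.map Γ'.subtype : Set (AbsGal F)) := by
    rw [Subgroup.coe_map]; exact hΓ'.isOpenMap_subtype_val _ hV
  have := hgal.finite_quotient _ hV'
  have : (V.map Γ'.subtype).FiniteIndex := Subgroup.finiteIndex_of_finite_quotient
  have hcore : IsOpen ((V.map Γ'.subtype).normalCore : Set (AbsGal F)) :=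
    Subgroup.isOpen_of_isClosed_of_finiteIndex _
      (Subgroup.normalCore_isClosed _ (Subgroup.isClosed_of_isOpen _ hV'))
  refine Subgroup.isOpen_mono (fun g hg => ?_) hcore
  refine hker _ (Subgroup.normalCore_normal _) (fun m hm => ?_) g hg
  obtain ⟨v, hv, rfl⟩ := Subgroup.normalCore_le _ hm
  refine ⟨v.2, ?_⟩
  change q₂⁻¹ * (E R).symm (σ v) * q₂⁻¹⁻¹ = 1
  rw [hσV v hv]
  simp

theorem isPGroup_pow_card_eq {p : ℕ} {G : Type*} [Group G] {H : Subgroup G} (h : IsPGroup p H)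
    {g : G} (hg : g ∈ H) : ∃ a : ℕ, g ^ p ^ a = 1 := by
  obtain ⟨a, ha⟩ := h ⟨g, hg⟩
  exact ⟨a, congrArg Subtype.val ha⟩

theorem eq_one_of_pow_prime_pow {p : ℕ} [Fact p.Prime] {k : Type*} [Field k] [CharP k p] {x : k}
    {a : ℕ} (h : x ^ p ^ a = 1) : x = 1 := by
  have : ExpChar k p := ExpChar.prime Fact.out
  have h1 : (x - 1) ^ p ^ a = 0 := by rw [sub_pow_expChar_pow, h, one_pow, sub_self]
  exact sub_eq_zero.mp (pow_eq_zero_iff (pow_ne_zero a (Fact.out : p.Prime).ne_zero) |>.mp h1)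

theorem hasBlockShape_one (p : ℕ) [Fact p.Prime] (k : Type) [Field k] [CharP k p] :
    HasBlockShape p (Fin 1) k := by
  intro H hf hH
  refine ⟨Fin 1, Empty, inferInstance, inferInstance, inferInstance, inferInstance,
    (Equiv.sumEmpty _ _).symm, 1, fun g hg => ⟨1, 1, 0, ?_⟩⟩
  obtain ⟨a, ha⟩ := isPGroup_pow_card_eq hH hg
  have hd : Matrix.GeneralLinearGroup.det g ^ p ^ a = 1 := by rw [← map_pow, ha, map_one]
  have hd1 : g.1.det ^ p ^ a = 1 := congrArg Units.val hd
  have h1 := eq_one_of_pow_prime_pow hd1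
  rw [Matrix.det_fin_one] at h1
  ext i j
  rcases i with i | i
  · rcases j with j | j
    · fin_cases i; fin_cases j
      simpa [blockPerm] using h1
    · exact j.elim
  · exact i.elim

/-- A finite `p`-group acting linearly on a nonzero space of characteristic `p` has a nonzero fixed
vector. -/
theorem exists_fixed_vector {p : ℕ} [Fact p.Prime] {G V : Type*} [Group G] [Finite G]
    (hG : IsPGroup p G) [AddCommGroup V] [Module (ZMod p) V] [DistribMulAction G V] [Nontrivial V] :
    ∃ v : V, v ≠ 0 ∧ ∀ g : G, g • v = v := by
  obtain ⟨w, hw⟩ := exists_ne (0 : V)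
  let W : Submodule (ZMod p) V := Submodule.span (ZMod p) (Set.range fun g : G => g • w)
  have hWf : Module.Finite (ZMod p) W := by
    apply Module.Finite.span_of_finite
    exact Set.finite_range _
  have hWf' : Finite W := Module.finite_of_finite (ZMod p)
  have hmem : ∀ g : G, ∀ v ∈ W, g • v ∈ W := by
    intro g v hv
    induction hv using Submodule.span_induction with
    | mem x hx =>
      obtain ⟨h, rfl⟩ := hx
      exact Submodule.subset_span ⟨g * h, mul_smul _ _ _⟩
    | zero => rw [smul_zero]; exact zero_mem _
    | add x y _ _ hx hy => rw [smul_add]; exact add_mem hx hy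
    | smul a x _ hx =>
      have : g • a • x = a • g • x := by
        have := ZMod.map_smul (DistribSMul.toAddMonoidHom V g) a x
        simpa using this
      rw [this]; exact Submodule.smul_mem _ _ hx
  let _ : MulAction G W :=
    { smul := fun g v => ⟨g • v.1, hmem g v.1 v.2⟩
      one_smul := fun v => Subtype.ext (one_smul _ _)
      mul_smul := fun g h v => Subtype.ext (mul_smul _ _ _) }
  have hwW : w ∈ W := Submodule.subset_span ⟨1, one_smul _ _⟩
  have : Nontrivial W := ⟨⟨⟨w, hwW⟩, 0, fun h => hw (congrArg Subtype.val h)⟩⟩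
  have hdvd : p ∣ Nat.card W := by
    have h2 := Module.natCard_eq_pow_finrank (K := ZMod p) (V := W)
    rw [h2, Nat.card_zmod]
    exact dvd_pow_self p (Module.finrank_pos).ne'
  obtain ⟨b, hb, hb0⟩ := hG.exists_fixed_point_of_prime_dvd_card_of_fixed_point W hdvd
    (a := 0) (fun g => Subtype.ext (smul_zero g))
  exact ⟨b.1, fun h => hb0 (Subtype.ext h.symm), fun g => congrArg Subtype.val (hb g)⟩

theorem hasBlockShape_two (p : ℕ) [Fact p.Prime] (k : Type) [Field k] [CharP k p] :
    HasBlockShape p (Fin 2) k := by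
  intro H hf hH
  let _ : Algebra (ZMod p) k := ZMod.algebra k p
  let _ : DistribMulAction H (Fin 2 → k) :=
    { smul := fun g v => g.1.1.mulVec v
      one_smul := fun v => Matrix.one_mulVec v
      mul_smul := fun g h v => (Matrix.mulVec_mulVec v g.1.1 h.1.1).symm
      smul_zero := fun g => Matrix.mulVec_zero _
      smul_add := fun g => Matrix.mulVec_add _ }
  obtain ⟨v, hv0, hv⟩ := exists_fixed_vector (V := Fin 2 → k) hH
  obtain ⟨Q, hQ, hQv⟩ : ∃ Q : Matrix (Fin 2) (Fin 2) k, Q.det ≠ 0 ∧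
      ∀ i, Q i 0 = v i := by
    by_cases h0 : v 0 = 0
    · have h1 : v 1 ≠ 0 := fun h1 => hv0 (by ext i; fin_cases i <;> assumption)
      refine ⟨!![v 0, 1; v 1, 0], ?_, fun i => by fin_cases i <;> rfl⟩
      simp [Matrix.det_fin_two, h1]
    · refine ⟨!![v 0, 0; v 1, 1], ?_, fun i => by fin_cases i <;> rfl⟩
      simp [Matrix.det_fin_two, h0]
  let q : GL (Fin 2) k := Matrix.GeneralLinearGroup.mk'' Q hQ.isUnit
  have hq : ∀ g ∈ H, ∃ b, (q⁻¹ * g * q : GL (Fin 2) k).1 = !![1, b; 0, 1] := by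
    intro g hg
    set m : GL (Fin 2) k := q⁻¹ * g * q with hm
    have h1 : q * m = g * q := by rw [hm]; group
    have h2 : m.1.mulVec ![1, 0] = ![1, 0] := by
      have h3 : Q.mulVec ![1, 0] = v := by
        ext i; simp [Matrix.mulVec, dotProduct, Fin.sum_univ_two, hQv]
      have h4 : q.1.mulVec (m.1.mulVec ![1, 0]) = q.1.mulVec ![1, 0] := by
        rw [Matrix.mulVec_mulVec, ← Units.val_mul, h1, Units.val_mul, ← Matrix.mulVec_mulVec]
        change g.1.mulVec (Q.mulVec _) = Q.mulVec _
        rw [h3]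
        exact hv ⟨g, hg⟩
      exact Matrix.mulVec_injective_of_isUnit q.isUnit h4
    have h00 : m.1 0 0 = 1 := by
      have := congrFun h2 0
      simpa [Matrix.mulVec, dotProduct, Fin.sum_univ_two] using this
    have h10 : m.1 1 0 = 0 := by
      have := congrFun h2 1
      simpa [Matrix.mulVec, dotProduct, Fin.sum_univ_two] using this
    obtain ⟨a, ha⟩ := isPGroup_pow_card_eq hH hg
    have hd : Matrix.GeneralLinearGroup.det m ^ p ^ a = 1 := by
      have : Matrix.GeneralLinearGroup.det m = Matrix.GeneralLinearGroup.det g := by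
        rw [hm, map_mul, map_mul, map_inv, mul_right_comm, inv_mul_cancel, one_mul]
      rw [this, ← map_pow, ha, map_one]
    have hd1 : m.1.det ^ p ^ a = 1 := congrArg Units.val hd
    have h11 := eq_one_of_pow_prime_pow hd1
    rw [Matrix.det_fin_two, h00, h10, one_mul, mul_zero, sub_zero] at h11
    refine ⟨m.1 0 1, ?_⟩
    ext i j
    fin_cases i <;> fin_cases j
    · exact h00
    · rfl
    · exact h10
    · exact h11
  refine ⟨Fin 1, Fin 1, inferInstance, inferInstance, inferInstance, inferInstance,
    (finSumFinEquiv (m := 1) (n := 1)).symm, q⁻¹, fun g hg => ?_⟩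
  obtain ⟨b, hb⟩ := hq g hg
  refine ⟨1, 1, Matrix.of fun _ _ => b, ?_⟩
  rw [inv_inv, hb]
  ext i j
  rcases i with i | i <;> rcases j with j | j <;> fin_cases i <;> fin_cases j <;> simp [blockPerm] <;> rfl

theorem blockPerm_mul_one {X X' : Type} [Fintype X] [Fintype X'] [DecidableEq X] [DecidableEq X']
    {R : Type} [CommRing R] (τ σ : Equiv.Perm X) (τ' σ' : Equiv.Perm X') (B C : Matrix X X' R) :
    ∃ D, blockPerm τ τ' B 1 * blockPerm σ σ' C 1 = blockPerm (τ * σ) (τ' * σ') D 1 :=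
  ⟨_, by rw [blockPerm_mul, one_mul]⟩

theorem exists_blockPerm_inv {X X' : Type} [Fintype X] [Fintype X'] [DecidableEq X]
    [DecidableEq X'] {R : Type} [CommRing R] (τ : Equiv.Perm X) (τ' : Equiv.Perm X')
    (B : Matrix X X' R) : ∃ C, blockPerm τ τ' B 1 * blockPerm τ⁻¹ τ'⁻¹ C 1 = 1 := by
  refine ⟨Matrix.of fun x y => - B (τ x) (τ'⁻¹ y), ?_⟩
  rw [blockPerm_mul, mul_inv_cancel, mul_inv_cancel, one_mul, ← blockPerm_one]
  congr 1
  ext x y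
  simp

/-- The group of block triangular matrices with two blocks of permutation matrices. -/
def blockPermSubgroup (X X' k : Type) [Fintype X] [Fintype X'] [DecidableEq X] [DecidableEq X']
    [Field k] : Subgroup (GL (X ⊕ X') k) where
  carrier := {g | ∃ τ τ' B, g.1 = blockPerm τ τ' B 1}
  mul_mem' := by
    rintro a b ⟨τ, τ', B, h⟩ ⟨σ, σ', C, h'⟩
    obtain ⟨D, hD⟩ := blockPerm_mul_one τ σ τ' σ' B C
    exact ⟨_, _, D, by rw [Units.val_mul, h, h', hD]⟩
  one_mem' := ⟨1, 1, 0, blockPerm_one.symm⟩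
  inv_mem' := by
    rintro a ⟨τ, τ', B, h⟩
    obtain ⟨C, hC⟩ := exists_blockPerm_inv τ τ' B
    refine ⟨τ⁻¹, τ'⁻¹, C, ?_⟩
    rw [← h] at hC
    exact left_inv_eq_right_inv a.inv_mul hC

theorem card_blockPermSubgroup (X X' k : Type) [Fintype X] [Fintype X'] [DecidableEq X]
    [DecidableEq X'] [Field k] : Nat.card (blockPermSubgroup X X' k) =
      (Fintype.card X).factorial * (Fintype.card X').factorial *
        Nat.card k ^ (Fintype.card X * Fintype.card X') := by
  let f : Equiv.Perm X × Equiv.Perm X' × Matrix X X' k → blockPermSubgroup X X' k := fun t =>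
    ⟨⟨blockPerm t.1 t.2.1 t.2.2 1,
      blockPerm t.1⁻¹ t.2.1⁻¹ (exists_blockPerm_inv t.1 t.2.1 t.2.2).choose 1,
      (exists_blockPerm_inv t.1 t.2.1 t.2.2).choose_spec,
      mul_eq_one_comm.mp (exists_blockPerm_inv t.1 t.2.1 t.2.2).choose_spec⟩, _, _, _, rfl⟩
  have hf : Function.Bijective f := by
    constructor
    · intro a b h
      obtain ⟨h1, h2, h3⟩ := blockPerm_inj (congrArg (fun x => x.1.1) h)
      exact Prod.ext h1 (Prod.ext h2 h3)
    · rintro ⟨g, τ, τ', B, h⟩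
      exact ⟨(τ, τ', B), Subtype.ext (Units.ext h.symm)⟩
  rw [← Nat.card_eq_of_bijective f hf, Nat.card_prod, Nat.card_prod,
    Nat.card_eq_fintype_card (α := Equiv.Perm X), Nat.card_eq_fintype_card (α := Equiv.Perm X'), Fintype.card_perm, Fintype.card_perm, mul_assoc]
  congr 2
  have : Nat.card (Matrix X X' k) = Nat.card (X → X' → k) := rfl
  rw [this, Nat.card_fun, Nat.card_fun, ← pow_mul, mul_comm, Nat.card_eq_fintype_card (α := X),
    Nat.card_eq_fintype_card (α := X')]

theorem hasBlockShape_of_index {p : ℕ} [Fact p.Prime] {k X X' n : Type} [Fintype X] [Fintype X']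
    [DecidableEq X] [DecidableEq X'] [Fintype n] [DecidableEq n] [Field k] [Finite k]
    (e : n ≃ X ⊕ X') (h : ¬ p ∣ (blockPermSubgroup X X' k).index) : HasBlockShape p n k := by
  intro H hf hH
  let E : GL n k ≃* GL (X ⊕ X') k := Units.mapEquiv (Matrix.reindexAlgEquiv k k e).toMulEquiv
  let T := blockPermSubgroup X X' k
  have hT : Finite (GL (X ⊕ X') k ⧸ T) := Quotient.finite _
  have hH' : IsPGroup p (H.map E.toMonoidHom) := hH.map _
  obtain ⟨x, hx⟩ := hH'.nonempty_fixed_point_of_prime_not_dvd_card (GL (X ⊕ X') k ⧸ T) h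
  obtain ⟨q, rfl⟩ := QuotientGroup.mk_surjective x
  refine ⟨X, X', inferInstance, inferInstance, inferInstance, inferInstance, e, E.symm q⁻¹,
    fun g hg => ?_⟩
  have h1 : ((E g * q : GL (X ⊕ X') k) : GL (X ⊕ X') k ⧸ T) = (q : GL (X ⊕ X') k ⧸ T) :=
    hx ⟨E g, g, hg, rfl⟩
  rw [eq_comm, QuotientGroup.eq, ← mul_assoc] at h1
  obtain ⟨τ, τ', B, hB⟩ := h1
  refine ⟨τ, τ', B, ?_⟩
  rw [← hB]
  change (E (E.symm q⁻¹ * g * (E.symm q⁻¹)⁻¹)).1 = _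
  simp

theorem hasBlockShape_three {k : Type} [Field k] (hk : Nat.card k = 2) :
    HasBlockShape 2 (Fin 3) k := by
  have : Finite k := Nat.finite_of_card_ne_zero (by omega)
  let _ : Fintype k := Fintype.ofFinite k
  refine hasBlockShape_of_index (X := Fin 2) (X' := Fin 1)
    (finSumFinEquiv (m := 2) (n := 1)).symm fun hdvd => ?_
  have h1 := (blockPermSubgroup (Fin 2) (Fin 1) k).card_mul_index
  have h2 : Nat.card (GL (Fin 2 ⊕ Fin 1) k) = Nat.card (GL (Fin 3) k) :=
    Nat.card_congr (Units.mapEquiv (Matrix.reindexAlgEquiv k k (finSumFinEquiv (m := 2) (n := 1))).toMulEquiv).toEquiv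
  rw [h2, Matrix.card_GL_field, card_blockPermSubgroup, hk, ← Nat.card_eq_fintype_card (α := k), hk] at h1
  simp [Fin.prod_univ_succ] at h1
  omega

theorem hasBlockShape_four {k : Type} [Field k] (hk : Nat.card k = 2) :
    HasBlockShape 2 (Fin 4) k := by
  have : Finite k := Nat.finite_of_card_ne_zero (by omega)
  let _ : Fintype k := Fintype.ofFinite k
  refine hasBlockShape_of_index (X := Fin 2) (X' := Fin 2)
    (finSumFinEquiv (m := 2) (n := 2)).symm fun hdvd => ?_
  have h1 := (blockPermSubgroup (Fin 2) (Fin 2) k).card_mul_index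
  have h2 : Nat.card (GL (Fin 2 ⊕ Fin 2) k) = Nat.card (GL (Fin 4) k) :=
    Nat.card_congr (Units.mapEquiv (Matrix.reindexAlgEquiv k k (finSumFinEquiv (m := 2) (n := 2))).toMulEquiv).toEquiv
  rw [h2, Matrix.card_GL_field, card_blockPermSubgroup, hk, ← Nat.card_eq_fintype_card (α := k), hk] at h1
  simp [Fin.prod_univ_succ] at h1
  omega

theorem prime_eq_two_of_card {p : ℕ} [Fact p.Prime] {k : Type} [Field k] [CharP k p]
    (hk : Nat.card k = 2) : p = 2 := by
  have : Finite k := Nat.finite_of_card_ne_zero (by omega)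
  let _ : Fintype k := Fintype.ofFinite k
  have h1 : ((2 : ℕ) : k) = 0 := by
    rw [← hk, Nat.card_eq_fintype_card]
    exact Nat.cast_card_eq_zero k
  exact (Nat.prime_dvd_prime_iff_eq Fact.out Nat.prime_two).mp ((CharP.cast_eq_zero_iff k p 2).mp h1)

theorem hasBlockShape_of_small (p : ℕ) [Fact p.Prime] (k : Type) [Field k] [CharP k p]
    (d : ℕ) (hd : 1 ≤ d) (h3 : 3 ≤ Cardinal.mk k → d ≤ 2) (h2 : Cardinal.mk k = 2 → d ≤ 4) :
    HasBlockShape p (Fin d) k := by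
  by_cases hk : Cardinal.mk k = 2
  · have hk' : Nat.card k = 2 := by rw [Nat.card, hk]; simp
    obtain rfl := prime_eq_two_of_card (p := p) hk'
    have := h2 hk
    obtain rfl | rfl | rfl | rfl : d = 1 ∨ d = 2 ∨ d = 3 ∨ d = 4 := by omega
    · exact hasBlockShape_one 2 k
    · exact hasBlockShape_two 2 k
    · exact hasBlockShape_three hk'
    · exact hasBlockShape_four hk'
  · have hk3 : 3 ≤ Cardinal.mk k := by
      have h1 : 2 ≤ Cardinal.mk k := Cardinal.two_le_iff.mpr ⟨0, 1, zero_ne_one⟩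
      have h4 : 2 < Cardinal.mk k := lt_of_le_of_ne h1 (Ne.symm hk)
      have h5 := Order.succ_le_of_lt h4
      have h6 : Order.succ (2 : Cardinal) = 3 := by
        have := Cardinal.succ_natCast 2
        rw [Nat.cast_ofNat] at this
        rw [this]; norm_num
      rwa [h6] at h5
    have := h3 hk3
    obtain rfl | rfl : d = 1 ∨ d = 2 := by omega
    · exact hasBlockShape_one p k
    · exact hasBlockShape_two p k

theorem IsPGroup.exists_character {p : ℕ} [Fact p.Prime] {Q : Type*} [Group Q] [Finite Q]
    (hQ : IsPGroup p Q) {H : Subgroup Q} (hH : H ≠ ⊤) :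
    ∃ ϑ : Q →* Multiplicative (ZMod p), H ≤ ϑ.ker ∧ ∃ g, ϑ g = Multiplicative.ofAdd 1 := by
  have hp : p.Prime := Fact.out
  obtain ⟨n, hn⟩ := IsPGroup.iff_card.mp hQ
  obtain ⟨m, hm⟩ := IsPGroup.iff_card.mp (hQ.to_subgroup H)
  have hmn : m < n := by
    by_contra! hle
    apply hH
    apply Subgroup.eq_top_of_card_eq
    apply le_antisymm (Subgroup.card_le_card_group H)
    rw [hn, hm]
    exact Nat.pow_le_pow_right hp.pos hle
  obtain ⟨K, hK, hHK⟩ := Sylow.exists_subgroup_card_pow_prime_le p (n := m) (m := n - 1)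
    (by rw [hn]; exact pow_dvd_pow p (by omega)) H hm (by omega)
  have hidx : K.index = p := by
    have h1 := K.card_mul_index
    rw [hK, hn] at h1
    have h2 : p ^ n = p ^ (n - 1) * p := by rw [← pow_succ]; congr 1; omega
    rw [h2] at h1
    exact Nat.eq_of_mul_eq_mul_left (pow_pos hp.pos _) h1
  have hKn : K.Normal := by
    apply Subgroup.normal_of_index_eq_minFac_card
    rw [hidx, hn, hp.pow_minFac (by omega)]
  have hc : Nat.card (Q ⧸ K) = p := hidx
  let e : Q ⧸ K ≃* Multiplicative (ZMod p) :=
    mulEquivOfPrimeCardEq hc (Nat.card_zmod p)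
  refine ⟨e.toMonoidHom.comp (QuotientGroup.mk' K), fun h hh => ?_, ?_⟩
  · rw [MonoidHom.mem_ker]
    have h2 : (QuotientGroup.mk' K) h = 1 := (QuotientGroup.eq_one_iff h).mpr (hHK hh)
    rw [MonoidHom.comp_apply, h2, map_one]
  · obtain ⟨g, hg⟩ := QuotientGroup.mk'_surjective K (e.symm (Multiplicative.ofAdd 1))
    exact ⟨g, by rw [MonoidHom.comp_apply, hg]; exact e.apply_symm_apply _⟩

/-- The additive map `κ` kills the norms from kernels of nontrivial characters of order `p`. -/
def NormVanish (p : ℕ) (Q : Type*) {A B : Type*} [Group Q] [AddCommGroup A] [DistribMulAction Q A]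
    [AddCommGroup B] (κ : A →+ B) : Prop :=
  ∀ (ϑ : Q →* Multiplicative (ZMod p)) (g : Q) (a : A), ϑ g = Multiplicative.ofAdd 1 →
    (∀ h, ϑ h = 1 → h • a = a) → κ (∑ j ∈ Finset.range p, g ^ j • a) = 0

theorem character_pow {p : ℕ} {Q : Type*} [Group Q] {ϑ : Q →* Multiplicative (ZMod p)} {g : Q}
    (hg : ϑ g = Multiplicative.ofAdd 1) (j : ℕ) :
    ϑ (g ^ j) = Multiplicative.ofAdd (j : ZMod p) := by
  rw [map_pow, hg, ← ofAdd_nsmul, nsmul_one]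

section OrbitSums

variable {p : ℕ} [Fact p.Prime] {Q A B S : Type*} [Group Q] [Finite Q] [AddCommGroup A]
  [DistribMulAction Q A] [AddCommGroup B] [Fintype S] [DecidableEq S] [MulAction Q S]

open Classical in
theorem NormVanish.sum_orbit_eq_zero (hQ : IsPGroup p Q) {κ : A →+ B} (hκ : NormVanish p Q κ)
    (a : S → A) (ha : ∀ (g : Q) D, a (g • D) = g • a D) (D₀ : S) (hD₀ : ∃ g : Q, g • D₀ ≠ D₀) :
    ∑ D with D ∈ MulAction.orbit Q D₀, κ (a D) = 0 := by
  have hp : p.Prime := Fact.out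
  have hst : MulAction.stabilizer Q D₀ ≠ ⊤ := fun h => by
    obtain ⟨g, hg⟩ := hD₀
    have : g ∈ MulAction.stabilizer Q D₀ := h ▸ Subgroup.mem_top g
    exact hg this
  obtain ⟨ϑ, hϑ, g, hg⟩ := hQ.exists_character hst
  let O : ZMod p → Finset S := fun t =>
    {D | ∃ q : Q, q • D₀ = D ∧ ϑ q = Multiplicative.ofAdd t}
  have hO : ∀ t D, D ∈ O t ↔ ∃ q : Q, q • D₀ = D ∧ ϑ q = Multiplicative.ofAdd t := fun t D => by
    simp [O]
  have hmove : ∀ (q : Q) (s t : ZMod p), ϑ q = Multiplicative.ofAdd s →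
      ∑ D ∈ O (s + t), a D = q • ∑ D ∈ O t, a D := by
    intro q s t hq
    rw [Finset.smul_sum]
    symm
    refine Finset.sum_bij (fun D _ => q • D) ?_ (fun _ _ _ _ h => smul_left_cancel q h) ?_ ?_
    · intro D hD
      obtain ⟨r, hr, hr'⟩ := (hO _ _).mp hD
      exact (hO _ _).mpr ⟨q * r, by rw [mul_smul, hr], by rw [map_mul, hq, hr', ofAdd_add]⟩
    · intro D hD
      obtain ⟨r, hr, hr'⟩ := (hO _ _).mp hD
      refine ⟨q⁻¹ • D, (hO _ _).mpr ⟨q⁻¹ * r, by rw [mul_smul, hr], ?_⟩, smul_inv_smul _ _⟩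
      rw [map_mul, map_inv, hq, hr', ofAdd_add, inv_mul_cancel_left]
    · intro D _
      exact (ha q D).symm
  have hfix : ∀ h, ϑ h = 1 → h • ∑ D ∈ O 0, a D = ∑ D ∈ O 0, a D := fun h hh => by
    rw [← hmove h 0 0 hh, add_zero]
  have hsum : ∑ D with D ∈ MulAction.orbit Q D₀, κ (a D) =
      ∑ t : ZMod p, ∑ D ∈ O t, κ (a D) := by
    rw [← Finset.sum_biUnion]
    · refine Finset.sum_congr ?_ fun _ _ => rfl
      ext D
      simp only [Finset.mem_filter, Finset.mem_univ, true_and, Finset.mem_biUnion, hO]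
      constructor
      · rintro ⟨q, hq⟩
        exact ⟨(ϑ q).toAdd, q, hq, rfl⟩
      · rintro ⟨_, q, hq, -⟩
        exact ⟨q, hq⟩
    · intro s _ t _ hst
      rw [Function.onFun, Finset.disjoint_left]
      intro D hD hD'
      obtain ⟨q, hq, hq'⟩ := (hO _ _).mp hD
      obtain ⟨r, hr, hr'⟩ := (hO _ _).mp hD'
      apply hst
      have h1 : q⁻¹ * r ∈ MulAction.stabilizer Q D₀ := by
        rw [MulAction.mem_stabilizer_iff, mul_smul, hr, ← hq, inv_smul_smul]
      have h2 := MonoidHom.mem_ker.mp (hϑ h1)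
      rw [map_mul, map_inv, inv_mul_eq_one, hq', hr'] at h2
      exact Multiplicative.ofAdd.injective h2
  have h3 : ∀ t : ZMod p, ∑ D ∈ O t, κ (a D) = κ (g ^ t.val • ∑ D ∈ O 0, a D) := by
    intro t
    have h4 : ϑ (g ^ t.val) = Multiplicative.ofAdd t := by
      rw [character_pow hg, ZMod.natCast_val, ZMod.cast_id', id]
    rw [← hmove _ t 0 h4, add_zero, map_sum]
  rw [hsum, ← hκ ϑ g _ hg hfix, map_sum]
  refine (Finset.sum_congr rfl fun t _ => h3 t).trans ?_
  refine Finset.sum_bij (fun t _ => t.val) (fun t _ => Finset.mem_range.mpr (ZMod.val_lt t))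
    (fun _ _ _ _ h => ZMod.val_injective p h) (fun j hj => ?_) (fun _ _ => rfl)
  exact ⟨j, Finset.mem_univ _, ZMod.val_cast_of_lt (Finset.mem_range.mp hj)⟩

open Classical in
/-- Only the fixed points contribute to an invariant sum. -/
theorem NormVanish.sum_eq_sum_fixed [Module (ZMod p) B] (hQ : IsPGroup p Q) {κ : A →+ B}
    (hκ : NormVanish p Q κ) (a : S → A) (ha : ∀ (g : Q) D, a (g • D) = g • a D) (w : S → ZMod p)
    (hw : ∀ (g : Q) D, w (g • D) = w D) :
    ∑ D, w D • κ (a D) = ∑ D, (if ∀ g : Q, g • D = D then w D else 0) • κ (a D) := by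
  rw [← sub_eq_zero, ← Finset.sum_sub_distrib]
  have h1 : ∀ D, w D • κ (a D) - (if ∀ g : Q, g • D = D then w D else 0) • κ (a D) =
      (if ∀ g : Q, g • D = D then 0 else w D) • κ (a D) := by
    intro D
    split_ifs <;> simp
  simp only [h1]
  rw [← Finset.sum_fiberwise (s := Finset.univ)
    (g := fun D => (Quotient.mk (MulAction.orbitRel Q S) D))]
  refine Finset.sum_eq_zero fun o _ => ?_
  induction o using Quotient.inductionOn with
  | _ D₀ =>
  have h2 : ∀ D, Quotient.mk (MulAction.orbitRel Q S) D = Quotient.mk _ D₀ ↔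
      D ∈ MulAction.orbit Q D₀ := fun D => by
    rw [Quotient.eq]; exact MulAction.orbitRel_apply
  simp only [h2]
  by_cases hD₀ : ∀ g : Q, g • D₀ = D₀
  · refine Finset.sum_eq_zero fun D hD => ?_
    obtain ⟨q, rfl⟩ := (Finset.mem_filter.mp hD).2
    simp only [hD₀]
    rw [if_pos (fun _ => trivial), zero_smul]
  · have h3 : ∀ D ∈ MulAction.orbit Q D₀,
        (if ∀ g : Q, g • D = D then 0 else w D) = w D₀ := by
      rintro D ⟨q, rfl⟩
      rw [if_neg, hw]
      intro hfix
      apply hD₀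
      intro g
      have := hfix (q * g * q⁻¹)
      simp only [mul_smul, inv_smul_smul] at this
      exact smul_left_cancel q this
    rw [Finset.sum_congr rfl fun D hD => by rw [h3 D (Finset.mem_filter.mp hD).2],
      ← Finset.smul_sum, hκ.sum_orbit_eq_zero hQ a ha D₀ (not_forall.mp hD₀), smul_zero]

end OrbitSums

/-- The combinatorial shadow of a Kummer extension generated by `p`-th roots `r D` of primes `D`
which are permuted by `G`: here `lam γ D = γ (r D) / r (θ γ • D)`. -/
structure KummerDatum (p : ℕ) {Γ G 𝒟 C A : Type} [Group Γ] [Group G] [MulAction G 𝒟]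
    [CommGroup C] [AddCommGroup A] [DistribMulAction G A] (θ : Γ →* G)
    (e : Multiplicative (ZMod p) →* C) (lam : Γ → 𝒟 → C) (f : Γ → A) : Prop where
  surj : Function.Surjective θ
  inj : Function.Injective e
  exists_log : ∀ c : C, c ^ p = 1 → ∃ t, e t = c
  lam_mul : ∀ γ γ' D, lam (γ * γ') D = lam γ (θ γ' • D) * lam γ' D
  lam_pow : ∀ h, θ h = 1 → ∀ D, lam h D ^ p = 1
  exists_lam_eq : ∀ w : 𝒟 → ZMod p, ∃ h, θ h = 1 ∧ ∀ D, lam h D = e (Multiplicative.ofAdd (w D))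
  map_mul : ∀ h h', θ h = 1 → θ h' = 1 → f (h * h') = f h + f h'
  map_conj : ∀ γ h, θ h = 1 → f (γ * h * γ⁻¹) = θ γ • f h
  map_eq_zero : ∀ h, θ h = 1 → (∀ D, lam h D = 1) → f h = 0

namespace KummerDatum

variable {p : ℕ} {Γ G 𝒟 C A : Type} [Group Γ] [Group G] [MulAction G 𝒟]
    [CommGroup C] [AddCommGroup A] [DistribMulAction G A] {θ : Γ →* G}
    {e : Multiplicative (ZMod p) →* C} {lam : Γ → 𝒟 → C} {f : Γ → A}

/-- `w` is the vector of logarithms of `h`. -/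
def IsLog (θ : Γ →* G) (e : Multiplicative (ZMod p) →* C) (lam : Γ → 𝒟 → C) (h : Γ)
    (w : 𝒟 → ZMod p) : Prop :=
  θ h = 1 ∧ ∀ D, lam h D = e (Multiplicative.ofAdd (w D))

theorem lam_one (hK : KummerDatum p θ e lam f) (D : 𝒟) : lam 1 D = 1 := by
  have := hK.lam_mul 1 1 D
  rwa [mul_one, map_one, one_smul, left_eq_mul] at this

theorem exists_isLog (hK : KummerDatum p θ e lam f) {h : Γ} (hh : θ h = 1) :
    ∃ w, IsLog θ e lam h w := by
  choose t ht using fun D => hK.exists_log _ (hK.lam_pow h hh D)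
  exact ⟨fun D => (t D).toAdd, hh, fun D => (ht D).symm⟩

theorem isLog_one (hK : KummerDatum p θ e lam f) : IsLog θ e lam 1 0 :=
  ⟨map_one _, fun D => by rw [hK.lam_one]; simp⟩

theorem isLog_mul (hK : KummerDatum p θ e lam f) {h h' : Γ} {w w' : 𝒟 → ZMod p}
    (hw : IsLog θ e lam h w) (hw' : IsLog θ e lam h' w') : IsLog θ e lam (h * h') (w + w') :=
  ⟨by rw [_root_.map_mul, hw.1, hw'.1, one_mul], fun D => by
    rw [hK.lam_mul, hw'.1, one_smul, hw.2, hw'.2, Pi.add_apply, ofAdd_add, _root_.map_mul]⟩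

theorem isLog_inv (hK : KummerDatum p θ e lam f) {h : Γ} {w : 𝒟 → ZMod p}
    (hw : IsLog θ e lam h w) : IsLog θ e lam h⁻¹ (-w) :=
  ⟨by rw [map_inv, hw.1, inv_one], fun D => by
    have h1 := hK.lam_mul h⁻¹ h D
    rw [inv_mul_cancel, hK.lam_one, hw.1, one_smul, hw.2] at h1
    rw [Pi.neg_apply, ofAdd_neg, map_inv]
    exact eq_inv_of_mul_eq_one_left h1.symm⟩

theorem isLog_conj (hK : KummerDatum p θ e lam f) (γ : Γ) {h : Γ} {w : 𝒟 → ZMod p}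
    (hw : IsLog θ e lam h w) : IsLog θ e lam (γ * h * γ⁻¹) (fun D => w ((θ γ)⁻¹ • D)) :=
  ⟨by rw [_root_.map_mul, _root_.map_mul, hw.1, mul_one, map_inv, mul_inv_cancel], fun D => by
    have h1 := hK.lam_mul γ γ⁻¹ D
    rw [mul_inv_cancel, hK.lam_one, map_inv] at h1
    rw [hK.lam_mul, hK.lam_mul, hw.1, one_smul, map_inv, hw.2, mul_right_comm, ← h1, one_mul]⟩

theorem isLog_unique (hK : KummerDatum p θ e lam f) {h : Γ} {w w' : 𝒟 → ZMod p}
    (hw : IsLog θ e lam h w) (hw' : IsLog θ e lam h w') : w = w' := by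
  ext1 D
  exact Multiplicative.ofAdd.injective (hK.inj ((hw.2 D).symm.trans (hw'.2 D)))

theorem map_eq_zero_of_isLog (hK : KummerDatum p θ e lam f) {h : Γ} (hw : IsLog θ e lam h 0) :
    f h = 0 :=
  hK.map_eq_zero h hw.1 fun D => by rw [hw.2]; simp

theorem map_eq_of_isLog (hK : KummerDatum p θ e lam f) {h h' : Γ} {w : 𝒟 → ZMod p}
    (hw : IsLog θ e lam h w) (hw' : IsLog θ e lam h' w) : f h = f h' := by
  have h1 := hK.isLog_mul hw (hK.isLog_inv hw')
  rw [add_neg_cancel] at h1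
  have h2 := hK.map_mul (h * h'⁻¹) h' h1.1 hw'.1
  rwa [hK.map_eq_zero_of_isLog h1, inv_mul_cancel_right, zero_add] at h2

theorem exists_addMonoidHom (hK : KummerDatum p θ e lam f) :
    ∃ F : (𝒟 → ZMod p) →+ A, ∀ h w, IsLog θ e lam h w → f h = F w := by
  choose s hs using hK.exists_lam_eq
  have hs' : ∀ w, IsLog θ e lam (s w) w := hs
  refine ⟨AddMonoidHom.mk' (fun w => f (s w)) fun w w' => ?_, fun h w hw =>
    hK.map_eq_of_isLog hw (hs' w)⟩
  rw [← hK.map_mul _ _ (hs w).1 (hs w').1]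
  exact hK.map_eq_of_isLog (hs' _) (hK.isLog_mul (hs' w) (hs' w'))

theorem exists_sum_eq [Fintype 𝒟] [DecidableEq 𝒟] [Module (ZMod p) A]
    (hK : KummerDatum p θ e lam f) : ∃ a : 𝒟 → A, (∀ (g : G) D, a (g • D) = g • a D) ∧
      ∀ h w, IsLog θ e lam h w → f h = ∑ D, w D • a D := by
  obtain ⟨F, hF⟩ := hK.exists_addMonoidHom
  refine ⟨fun D => F (Pi.single D 1), fun g D => ?_, fun h w hw => ?_⟩
  · obtain ⟨γ, rfl⟩ := hK.surj g
    obtain ⟨h, hh⟩ := hK.exists_lam_eq (Pi.single D 1)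
    have h1 : IsLog θ e lam h (Pi.single D 1) := hh
    beta_reduce
    rw [← hF _ _ h1, ← hK.map_conj γ h hh.1]
    have h2 := hK.isLog_conj γ h1
    rw [hF _ _ h2]
    congr 1
    ext D'
    by_cases hD : D' = θ γ • D
    · rw [hD, inv_smul_smul, Pi.single_eq_same, Pi.single_eq_same]
    · rw [Pi.single_eq_of_ne hD, Pi.single_eq_of_ne]
      intro h3
      exact hD (by rw [← h3, smul_inv_smul])
  · rw [hF h w hw]
    have h1 : w = ∑ D, w D • Pi.single (M := fun _ => ZMod p) D 1 := by
      rw [← Finset.univ_sum_single w]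
      refine Finset.sum_congr rfl fun D _ => ?_
      rw [Finset.univ_sum_single, ← Pi.single_smul, smul_eq_mul, mul_one]
    conv_lhs => rw [h1]
    rw [map_sum]
    exact Finset.sum_congr rfl fun D _ => ZMod.map_smul F _ _

/-- Weighted products of `lam` over a weight invariant under `θ γ`. -/
theorem prod_lam_mul [Fintype 𝒟] (hK : KummerDatum p θ e lam f) (n : 𝒟 → ℕ) {γ γ' : Γ}
    (hn : ∀ D, n (θ γ' • D) = n D) :
    ∏ D, lam (γ * γ') D ^ n D = (∏ D, lam γ D ^ n D) * ∏ D, lam γ' D ^ n D := by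
  simp only [hK.lam_mul, mul_pow, Finset.prod_mul_distrib]
  congr 1
  refine Fintype.prod_equiv (MulAction.toPerm (θ γ')) _ _ fun D => ?_
  rw [MulAction.toPerm_apply, hn]

theorem prod_lam_commutator [Fintype 𝒟] (hK : KummerDatum p θ e lam f) (n : 𝒟 → ℕ) {γ γ' : Γ}
    (hn : ∀ D, n (θ γ • D) = n D) (hn' : ∀ D, n (θ γ' • D) = n D) :
    ∏ D, lam (γ * γ' * γ⁻¹ * γ'⁻¹) D ^ n D = 1 := by
  have h1 := hK.prod_lam_mul n (γ := γ * γ' * γ⁻¹ * γ'⁻¹) (γ' := γ' * γ) (fun D => by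
    rw [_root_.map_mul, mul_smul, hn', hn])
  have h2 : γ * γ' * γ⁻¹ * γ'⁻¹ * (γ' * γ) = γ * γ' := by group
  rw [h2, hK.prod_lam_mul n hn', hK.prod_lam_mul n hn, mul_comm, eq_comm] at h1
  exact mul_eq_right.mp h1

/-- Commuting elements of `G` lift to elements whose commutator has trivial logarithm. -/
theorem exists_lifts [Fact p.Prime] [Finite 𝒟] (hK : KummerDatum p θ e lam f) (s t : G)
    (hst : s * t = t * s) :
    ∃ γ γ', θ γ = s ∧ θ γ' = t ∧ IsLog θ e lam (γ * γ' * γ⁻¹ * γ'⁻¹) 0 := by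
  classical
  let _ : Fintype 𝒟 := Fintype.ofFinite 𝒟
  obtain ⟨γ, rfl⟩ := hK.surj s
  obtain ⟨γ', rfl⟩ := hK.surj t
  have hc : θ (γ * γ' * γ⁻¹ * γ'⁻¹) = 1 := by
    simp only [_root_.map_mul, map_inv]
    rw [hst]; group
  obtain ⟨w, hw⟩ := hK.exists_isLog hc
  let T (g : G) : (𝒟 → ZMod p) →ₗ[ZMod p] (𝒟 → ZMod p) :=
    LinearMap.funLeft (ZMod p) (ZMod p) (fun D => g⁻¹ • D) - LinearMap.id
  have hT : ∀ g u D, T g u D = u (g⁻¹ • D) - u D := fun g u D => rfl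
  have hmem : w ∈ LinearMap.range (T (θ γ)) ⊔ LinearMap.range (T (θ γ')) := by
    by_contra hw'
    obtain ⟨l, hlw, hl⟩ := Submodule.exists_le_ker_of_notMem hw'
    have hlT : ∀ g, LinearMap.range (T g) ≤ LinearMap.ker l →
        ∀ D, l (Pi.single (g • D) 1) = l (Pi.single D 1) := by
      intro g hg D
      have h1 : l (T g (Pi.single D 1)) = 0 := hg ⟨_, rfl⟩
      have h2 : T g (Pi.single D 1) = Pi.single (g • D) 1 - Pi.single D 1 := by
        ext D'
        rw [hT, Pi.sub_apply]
        congr 1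
        simp only [Pi.single_apply, inv_smul_eq_iff]
      rwa [h2, map_sub, sub_eq_zero] at h1
    have h1 := hlT _ (le_sup_left.trans hl)
    have h2 := hlT _ (le_sup_right.trans hl)
    apply hlw
    have h3 := hK.prod_lam_commutator (fun D => (l (Pi.single D 1)).val) (γ := γ) (γ' := γ')
      (fun D => by rw [h1]) (fun D => by rw [h2])
    simp only [hw.2, ← map_pow, ← map_prod] at h3
    have h4 := hK.inj (h3.trans (map_one e).symm)
    have h5 : ∑ D, (l (Pi.single D 1)).val • w D = 0 := by
      apply Multiplicative.ofAdd.injective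
      rw [ofAdd_zero, ← h4, ofAdd_sum]
      exact Finset.prod_congr rfl fun D _ => ofAdd_nsmul _ _
    rw [← h5, LinearMap.pi_apply_eq_sum_univ l w]
    refine Finset.sum_congr rfl fun D _ => ?_
    have h6 : (fun j => if D = j then (1 : ZMod p) else 0) = Pi.single D 1 := by
      ext j; simp [Pi.single_apply, eq_comm]
    rw [h6, nsmul_eq_mul, ZMod.natCast_val, ZMod.cast_id', id, smul_eq_mul, mul_comm]
  obtain ⟨_, ⟨u, rfl⟩, _, ⟨u', rfl⟩, huw⟩ := Submodule.mem_sup.mp hmem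
  obtain ⟨h, hh⟩ := hK.exists_lam_eq u'
  obtain ⟨h', hh'⟩ := hK.exists_lam_eq (-u)
  have hL : IsLog θ e lam h u' := hh
  have hL' : IsLog θ e lam h' (-u) := hh'
  refine ⟨h * γ, h' * γ', by rw [_root_.map_mul, hh.1, one_mul],
    by rw [_root_.map_mul, hh'.1, one_mul], ?_⟩
  have h1 := hK.isLog_mul (hK.isLog_mul (hK.isLog_mul (hK.isLog_mul hL (hK.isLog_conj γ hL')) hw)
    (hK.isLog_conj γ' (hK.isLog_inv hL))) (hK.isLog_inv hL')
  have h2 : h * (γ * h' * γ⁻¹) * (γ * γ' * γ⁻¹ * γ'⁻¹) * (γ' * h⁻¹ * γ'⁻¹) * h'⁻¹ =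
      h * γ * (h' * γ') * (h * γ)⁻¹ * (h' * γ')⁻¹ := by group
  rw [h2] at h1
  convert h1 using 1
  ext D
  have := congrFun huw D
  simp only [Pi.add_apply, Pi.neg_apply, hT, Pi.zero_apply] at this ⊢
  rw [← this]
  ring

end KummerDatum

namespace KummerDatum

variable {p : ℕ} {Γ G 𝒟 C A : Type} [Group Γ] [Group G] [MulAction G 𝒟]
    [CommGroup C] [AddCommGroup A] [DistribMulAction G A] {θ : Γ →* G}
    {e : Multiplicative (ZMod p) →* C} {lam : Γ → 𝒟 → C} {f : Γ → A}

theorem isLog_pow_commutator (hK : KummerDatum p θ e lam f) {γ γ' : Γ}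
    (h : IsLog θ e lam (γ * γ' * γ⁻¹ * γ'⁻¹) 0) (n : ℕ) :
    IsLog θ e lam (γ ^ n * γ' * (γ ^ n)⁻¹ * γ'⁻¹) 0 := by
  induction n with
  | zero => simpa using hK.isLog_one
  | succ n ih =>
    have h1 := hK.isLog_mul (hK.isLog_conj γ ih) h
    have h2 : γ * (γ ^ n * γ' * (γ ^ n)⁻¹ * γ'⁻¹) * γ⁻¹ * (γ * γ' * γ⁻¹ * γ'⁻¹) =
        γ ^ (n + 1) * γ' * (γ ^ (n + 1))⁻¹ * γ'⁻¹ := by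
      rw [pow_succ']; group
    rw [h2] at h1
    convert h1 using 1
    ext D
    simp

theorem log_smul_eq (hK : KummerDatum p θ e lam f) {γ γ' : Γ}
    (h : IsLog θ e lam (γ * γ' * γ⁻¹ * γ'⁻¹) 0) {n : ℕ} {w : 𝒟 → ZMod p}
    (hw : IsLog θ e lam (γ ^ n) w) (D : 𝒟) : w (θ γ' • D) = w D := by
  have h1 := hK.isLog_mul hw (hK.isLog_conj γ' (hK.isLog_inv hw))
  have h2 : γ ^ n * (γ' * (γ ^ n)⁻¹ * γ'⁻¹) = γ ^ n * γ' * (γ ^ n)⁻¹ * γ'⁻¹ := by group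
  rw [h2] at h1
  have h3 := congrFun (hK.isLog_unique h1 (hK.isLog_pow_commutator h n)) (θ γ' • D)
  simpa [add_neg_eq_zero] using h3

theorem map_pow_eq_zero [Fact p.Prime] [Finite 𝒟] [Finite G] [Module (ZMod p) A]
    (hK : KummerDatum p θ e lam f) (hG : IsPGroup p G) (M : Subgroup G) [M.Normal] {γ : Γ}
    {w : 𝒟 → ZMod p} (hw : IsLog θ e lam (γ ^ p) w) (hwM : ∀ m ∈ M, ∀ D, w (m • D) = w D)
    (hγM : θ γ ∈ M) (hcen : θ γ ∈ Subgroup.center G) (hcom : θ γ ∈ commutator G)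
    {B : Type} [AddCommGroup B] [Module (ZMod p) B] (κ : A →+ B)
    (hκM : NormVanish p M κ) (hκG : NormVanish p G κ) : κ (f (γ ^ p)) = 0 := by
  classical
  let _ : Fintype 𝒟 := Fintype.ofFinite 𝒟
  obtain ⟨a, ha, haf⟩ := hK.exists_sum_eq
  rw [haf _ _ hw, map_sum, Finset.sum_congr rfl fun D _ => ZMod.map_smul κ (w D) (a D),
    hκM.sum_eq_sum_fixed (hG.to_subgroup M) a (fun g D => ha g D) w (fun g D => hwM g g.2 D)]
  have hMfix : ∀ (g : G) (D : 𝒟), (∀ m : M, m • g • D = g • D) ↔ ∀ m : M, m • D = D := by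
    have key : ∀ (g : G) (D : 𝒟), (∀ m : M, m • D = D) → ∀ m : M, m • g • D = g • D := by
      intro g D h m
      have h1 := h ⟨g⁻¹ * m * g, by
        simpa using Subgroup.Normal.conj_mem (H := M) inferInstance m m.2 g⁻¹⟩
      rw [Subgroup.mk_smul, mul_smul, mul_smul, inv_smul_eq_iff] at h1
      exact h1
    intro g D
    refine ⟨fun h => ?_, key g D⟩
    simpa using key g⁻¹ _ h
  have hθp : θ (γ ^ p) = 1 := hw.1
  have hlamp : ∀ D, (∀ m : M, m • D = D) → e (Multiplicative.ofAdd (w D)) = lam γ D ^ p := by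
    intro D hD
    have hγD : θ γ • D = D := hD ⟨θ γ, hγM⟩
    have : ∀ n : ℕ, lam (γ ^ n) D = lam γ D ^ n := by
      intro n
      induction n with
      | zero => rw [pow_zero, pow_zero, hK.lam_one]
      | succ n ih => rw [pow_succ, hK.lam_mul, hγD, ih, pow_succ]
    rw [← hw.2, this p]
  have hinv : ∀ (g : G) (D : 𝒟), (∀ m : M, m • D = D) → w (g • D) = w D := by
    intro g D hD
    obtain ⟨δ, rfl⟩ := hK.surj g
    have hγD : θ γ • D = D := hD ⟨θ γ, hγM⟩
    have hh : θ (γ⁻¹ * δ⁻¹ * γ * δ) = 1 := by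
      have h1 := Subgroup.mem_center_iff.mp hcen (θ δ)
      simp only [_root_.map_mul, map_inv]
      rw [mul_assoc, ← h1]; group
    have h1 := hK.lam_mul γ δ D
    have h2 : γ * δ = δ * γ * (γ⁻¹ * δ⁻¹ * γ * δ) := by group
    rw [h2, hK.lam_mul, hK.lam_mul, hh, one_smul, hγD, mul_assoc, mul_comm (lam γ (θ δ • D))] at h1
    have h3 := congrArg (· ^ p) (mul_left_cancel h1)
    beta_reduce at h3
    rw [mul_pow, hK.lam_pow _ hh, mul_one, ← hlamp D hD, ← hlamp _ ((hMfix _ _).mpr hD)] at h3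
    exact Multiplicative.ofAdd.injective (hK.inj h3.symm)
  rw [hκG.sum_eq_sum_fixed hG a ha (fun D => if ∀ m : M, m • D = D then w D else 0) fun g D => by
    simp only [hMfix]
    split_ifs with h
    · exact hinv g D h
    · rfl]
  refine Finset.sum_eq_zero fun D _ => ?_
  split_ifs with hD hD'
  · have hlogD := hlamp D hD'
    let χ : Γ →* C := MonoidHom.mk' (fun δ => lam δ D ^ p) fun δ δ' => by
      rw [hK.lam_mul, hD, mul_pow]
    have hχ : χ γ = 1 := by
      have h1 : commutator G = (commutator Γ).map θ := by
        rw [commutator_def, commutator_def, Subgroup.map_commutator,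
          Subgroup.map_top_of_surjective θ hK.surj]
      rw [h1] at hcom
      obtain ⟨c, hc, hcγ⟩ := hcom
      have h2 : χ c = 1 := Abelianization.commutator_subset_ker χ hc
      have h3 : χ (c⁻¹ * γ) = 1 :=
        hK.lam_pow _ (by rw [_root_.map_mul, map_inv, hcγ, inv_mul_cancel]) D
      rw [_root_.map_mul, map_inv, h2, inv_one, one_mul] at h3
      exact h3
    have h1 : e (Multiplicative.ofAdd (w D)) = e 1 := by rw [hlogD, map_one]; exact hχ
    have h2 := hK.inj h1
    rw [show w D = 0 from Multiplicative.ofAdd.injective h2, zero_smul]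
  · rw [zero_smul]
  · rw [zero_smul]

/-- Lifts of two commuting elements, whose `p`-th powers and commutator are controlled. -/
theorem exists_controlled_lifts [Fact p.Prime] [Finite 𝒟] [Finite G] [Module (ZMod p) A]
    (hK : KummerDatum p θ e lam f) (hG : IsPGroup p G) (s t : G) (hst : s * t = t * s)
    (hs : s ^ p = 1) (ht : t ^ p = 1) (M : Subgroup G) (hMn : M.Normal)
    (hM : M = Subgroup.closure {s, t}) :
    ∃ γ γ', θ γ = s ∧ θ γ' = t ∧ f (γ * γ' * γ⁻¹ * γ'⁻¹) = 0 ∧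
      ∀ δ, (δ = γ ∨ δ = γ') → θ δ ∈ Subgroup.center G → θ δ ∈ commutator G →
        ∀ {B : Type} [AddCommGroup B] [Module (ZMod p) B] (κ : A →+ B),
          NormVanish p M κ → NormVanish p G κ → κ (f (δ ^ p)) = 0 := by
  obtain ⟨γ, γ', rfl, rfl, hlog⟩ := hK.exists_lifts s t hst
  refine ⟨γ, γ', rfl, rfl, hK.map_eq_zero_of_isLog hlog, ?_⟩
  have hlog' : IsLog θ e lam (γ' * γ * γ'⁻¹ * γ⁻¹) 0 := by
    have := hK.isLog_inv hlog
    rw [neg_zero] at this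
    convert this using 1
    group
  have hself : ∀ δ : Γ, IsLog θ e lam (δ * δ * δ⁻¹ * δ⁻¹) 0 := fun δ => by
    simpa using hK.isLog_one
  have hcomm : ∀ δ, (δ = γ ∨ δ = γ') → ∀ δ', (δ' = γ ∨ δ' = γ') →
      IsLog θ e lam (δ * δ' * δ⁻¹ * δ'⁻¹) 0 := by
    rintro δ (rfl | rfl) δ' (rfl | rfl)
    · exact hself _
    · exact hlog
    · exact hlog'
    · exact hself _
  intro δ hδ hcen hcom B _ _ κ hκM hκG
  have hδp : θ (δ ^ p) = 1 := by
    rw [map_pow]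
    rcases hδ with rfl | rfl <;> assumption
  obtain ⟨w, hw⟩ := hK.exists_isLog hδp
  refine hK.map_pow_eq_zero hG M hw (fun m hm => ?_) ?_ hcen hcom κ hκM hκG
  · rw [hM] at hm
    induction hm using Subgroup.closure_induction with
    | mem x hx =>
      intro D
      rcases hx with rfl | rfl
      · exact hK.log_smul_eq (hcomm δ hδ γ (Or.inl rfl)) hw D
      · exact hK.log_smul_eq (hcomm δ hδ γ' (Or.inr rfl)) hw D
    | one => intro D; rw [one_smul]
    | mul x y _ _ hx hy => intro D; rw [mul_smul, hx, hy]
    | inv x _ hx => intro D; rw [← hx, smul_inv_smul]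
  · rw [hM]
    refine Subgroup.subset_closure ?_
    rcases hδ with rfl | rfl
    · exact Or.inl rfl
    · exact Or.inr rfl

end KummerDatum

open scoped Pointwise in
/-- The primes dividing a `G`-invariant element, up to units, form a finite `G`-set. -/
theorem exists_prime_system {G R : Type} [Group G] [CommRing R] [IsDomain R]
    [UniqueFactorizationMonoid R] [MulSemiringAction G R] {b : R} (hb : b ≠ 0)
    (hinv : ∀ g : G, g • b = b) :
    ∃ (𝒟 : Type) (_ : Finite 𝒟) (_ : MulAction G 𝒟) (π : 𝒟 → R), (∀ D, Prime (π D)) ∧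
      (∀ (g : G) D, Associated (g • π D) (π (g • D))) ∧
      (∀ D D', Associated (π D) (π D') → D = D') ∧
      ∀ q, Prime q → q ∣ b → ∃ D, Associated q (π D) := by
  classical
  let S : SubMulAction G (Ideal R) :=
    { carrier := {I | ∃ x, Prime x ∧ x ∣ b ∧ I = Ideal.span {x}}
      smul_mem' := by
        rintro g _ ⟨x, hx, hxb, rfl⟩
        refine ⟨g • x, ?_, ?_, ?_⟩
        · exact (MulEquiv.prime_iff (MulSemiringAction.toRingEquiv G R g)).mpr hx
        · obtain ⟨y, hy⟩ := hxb
          exact ⟨g • y, by rw [← smul_mul', ← hy, hinv]⟩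
        · rw [Ideal.pointwise_smul_def, Ideal.map_span, Set.image_singleton]
          rfl }
  have hfin : Finite S := by
    have h1 : (S : Set (Ideal R)) ⊆
        ((UniqueFactorizationMonoid.factors b).toFinset.image fun x => Ideal.span {x} :
          Finset (Ideal R)) := by
      rintro _ ⟨x, hx, hxb, rfl⟩
      obtain ⟨y, hy, hxy⟩ :=
        UniqueFactorizationMonoid.exists_mem_factors_of_dvd hb hx.irreducible hxb
      rw [Finset.mem_coe, Finset.mem_image]
      exact ⟨y, Multiset.mem_toFinset.mpr hy, Ideal.span_singleton_eq_span_singleton.mpr hxy.symm⟩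
    exact (Finset.finite_toSet _).subset h1
  choose π hπ hπb hπI using fun D : S => D.2
  refine ⟨S, hfin, inferInstance, π, hπ, fun g D => ?_, fun D D' h => ?_, fun q hq hqb => ?_⟩
  · rw [← Ideal.span_singleton_eq_span_singleton, ← hπI (g • D), SubMulAction.val_smul, hπI D,
      Ideal.pointwise_smul_def, Ideal.map_span, Set.image_singleton]
    rfl
  · apply Subtype.ext
    rw [hπI D, hπI D', Ideal.span_singleton_eq_span_singleton]
    exact h
  · refine ⟨⟨Ideal.span {q}, q, hq, hqb, rfl⟩, ?_⟩
    rw [← Ideal.span_singleton_eq_span_singleton, ← hπI]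

/-- A Galois extension of rings `q : R → Ω` with group `G` as far as Kummer theory is concerned:
units of `R` and their `p`-th roots are constants, and `R` is the ring of a model of the fixed
field of the kernel of `θ`. -/
structure KummerSetup (p : ℕ) {Γ G Ω R : Type} [Group Γ] [TopologicalSpace Γ] [Group G] [Field Ω]
    [MulSemiringAction Γ Ω] [CommRing R] [MulSemiringAction G R] (θ : Γ →* G) (q : R →+* Ω) :
    Prop where
  galois : IsGaloisAction Γ Ω
  surj : Function.Surjective θ
  isOpen_ker : IsOpen (θ.ker : Set Γ)
  inj : Function.Injective q
  smul_map : ∀ γ b, γ • q b = q (θ γ • b)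
  exists_root : ∀ x : Ω, ∃ y, y ^ p = x
  exists_primitive : ∃ ζ : Ω, IsPrimitiveRoot ζ p
  smul_eq_of_pow : ∀ (x : Ω) (u : Rˣ), x ^ p = q u → ∀ γ : Γ, γ • x = x
  exists_fraction : ∀ x : Ω, (∀ h : Γ, θ h = 1 → h • x = x) → ∃ a b, b ≠ 0 ∧ x * q b = q a

namespace KummerSetup

variable {p : ℕ} [Fact p.Prime] {Γ G Ω R A : Type} [Group Γ] [TopologicalSpace Γ]
    [IsTopologicalGroup Γ] [Group G] [Field Ω] [MulSemiringAction Γ Ω] [CommRing R] [IsDomain R]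
    [UniqueFactorizationMonoid R] [MulSemiringAction G R] {θ : Γ →* G} {q : R →+* Ω}

omit [IsDomain R] [UniqueFactorizationMonoid R] in
theorem exists_eigenvector (hS : KummerSetup p θ q) {ζ : Ω} (hζ : IsPrimitiveRoot ζ p)
    {l : Γ → ZMod p} (hl : ∀ h h', θ h = 1 → θ h' = 1 → l (h * h') = l h + l h')
    (hlU : ∃ U : Subgroup Γ, IsOpen (U : Set Γ) ∧ U ≤ θ.ker ∧ ∀ u ∈ U, l u = 0) :
    ∃ α b, b ≠ 0 ∧ α ≠ 0 ∧ α ^ p = q b ∧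
      ∀ h, θ h = 1 → h • α = AddChar.zmodChar p hζ.pow_eq_one (l h) * α := by
  obtain ⟨U, hU, hUθ, hUl⟩ := hlU
  set e := AddChar.zmodChar p hζ.pow_eq_one with he
  have hζΓ : ∀ γ : Γ, γ • ζ = ζ := hS.smul_eq_of_pow ζ 1 (by simp [hζ.pow_eq_one])
  have heΓ : ∀ (γ : Γ) a, γ • e a = e a := fun γ a =>
    IsGaloisAction.smul_zmodChar_of_fixed hζ.pow_eq_one γ (hζΓ γ) a
  have hep : ∀ a, e a ^ p = 1 := fun a => by
    rw [← AddChar.map_nsmul_eq_pow, nsmul_eq_mul, ZMod.natCast_self, zero_mul,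
      AddChar.map_zero_eq_one]
  have he0 : ∀ a, e a ≠ 0 := fun a h => by
    have := hep a
    rw [h, zero_pow (Fact.out : p.Prime).ne_zero] at this
    exact zero_ne_one this
  obtain ⟨α, hα0, hα⟩ := (hS.galois.subgroup θ.ker hS.isOpen_ker).exists_units_of_cocycle
    (U.subgroupOf θ.ker) (hU.preimage continuous_subtype_val) (fun h => e (-(l h)))
    (fun h => he0 _) (fun u hu => by rw [hUl u hu, neg_zero, AddChar.map_zero_eq_one])
    (fun g g' => by
      change e (-(l _)) = e (-(l g)) * (g : Γ) • e (-(l g'))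
      rw [heΓ, Subgroup.coe_mul, hl _ _ g.2 g'.2, neg_add, AddChar.map_add_eq_mul])
  have hα' : ∀ h, θ h = 1 → h • α = e (l h) * α := by
    intro h hh
    have h1 : e (-(l h)) * h • α = α := hα ⟨h, hh⟩
    conv_rhs => rw [← h1, ← mul_assoc, ← AddChar.map_add_eq_mul, add_neg_cancel,
      AddChar.map_zero_eq_one, one_mul]
  obtain ⟨a, b, hb, hab⟩ := hS.exists_fraction (α ^ p) fun h hh => by
    rw [smul_pow', hα' h hh, mul_pow, hep, one_mul]
  have hqb : q b ≠ 0 := fun h => hb (hS.inj (h.trans (map_zero q).symm))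
  have ha : a ≠ 0 := by
    rintro rfl
    rw [map_zero] at hab
    exact mul_ne_zero (pow_ne_zero p hα0) hqb hab
  have hp1 : p - 1 + 1 = p := Nat.sub_add_cancel (Fact.out : p.Prime).one_le
  refine ⟨α * q b, a * b ^ (p - 1), fun h => ?_, mul_ne_zero hα0 hqb, ?_, fun h hh => ?_⟩
  · have h1 := congrArg q h
    rw [map_mul, map_pow, ← hab, map_zero] at h1
    exact mul_ne_zero (mul_ne_zero (pow_ne_zero p hα0) hqb) (pow_ne_zero _ hqb) h1
  · rw [map_mul, map_pow, ← hab, mul_pow, mul_assoc, ← pow_succ', hp1]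
  · rw [smul_mul', hα' h hh, hS.smul_map, hh, one_smul, mul_assoc]

omit [UniqueFactorizationMonoid R] in
/-- Finitely many radicands control `f`. -/
theorem exists_radicand (hS : KummerSetup p θ q) [Finite G] [AddCommGroup A] [Module (ZMod p) A]
    {f : Γ → A} (hf : ∀ h h', θ h = 1 → θ h' = 1 → f (h * h') = f h + f h')
    (hfU : ∃ U : Subgroup Γ, IsOpen (U : Set Γ) ∧ U ≤ θ.ker ∧ ∀ u ∈ U, f u = 0) :
    ∃ b : R, b ≠ 0 ∧ (∀ g : G, g • b = b) ∧
      ∀ h, θ h = 1 → f h ≠ 0 → ∃ α c, c ∣ b ∧ α ^ p = q c ∧ h • α ≠ α := by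
  classical
  obtain ⟨ζ, hζ⟩ := hS.exists_primitive
  obtain ⟨U, hU, hUθ, hUf⟩ := hfU
  have := hS.galois.finite_quotient U hU
  let _ : Fintype (Γ ⧸ U) := Fintype.ofFinite _
  let _ : Fintype G := Fintype.ofFinite G
  have hex : ∀ v : A, ∃ α b, b ≠ 0 ∧ α ^ p = q b ∧ ∀ h, θ h = 1 → f h = v → v ≠ 0 → h • α ≠ α := by
    intro v
    by_cases hv : v = 0
    · exact ⟨1, 1, one_ne_zero, by simp, fun h _ _ h0 => absurd hv h0⟩
    obtain ⟨l, hl⟩ : ∃ l : Module.Dual (ZMod p) A, l v ≠ 0 := by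
      by_contra! hcon
      exact hv ((Module.forall_dual_apply_eq_zero_iff (ZMod p) v).mp hcon)
    obtain ⟨α, b, hb, hα0, hαb, hα⟩ := hS.exists_eigenvector hζ (l := fun h => l (f h))
      (fun h h' hh hh' => by rw [hf h h' hh hh', map_add])
      ⟨U, hU, hUθ, fun u hu => by rw [hUf u hu, map_zero]⟩
    refine ⟨α, b, hb, hαb, fun h hh hfv _ hfix => hl ?_⟩
    rw [hα h hh, mul_eq_right₀ hα0, hfv] at hfix
    exact zmodChar_injective hζ (hfix.trans (AddChar.map_zero_eq_one _).symm)
  choose α b hb hαb hα using hex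
  refine ⟨∏ g : G, g • ∏ j : Γ ⧸ U, b (f j.out), ?_, fun g => ?_, fun h hh hfh => ?_⟩
  · refine Finset.prod_ne_zero_iff.mpr fun g _ => ?_
    rw [Ne, smul_eq_zero_iff_eq]
    exact Finset.prod_ne_zero_iff.mpr fun j _ => hb _
  · rw [Finset.smul_prod']
    exact Fintype.prod_equiv (Equiv.mulLeft g) _ _ fun x => by rw [Equiv.coe_mulLeft, mul_smul]
  · have h1 : f ((h : Γ ⧸ U).out) = f h := by
      have h2 : h⁻¹ * (h : Γ ⧸ U).out ∈ U := by rw [← QuotientGroup.eq]; simp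
      have h3 := hf h (h⁻¹ * (h : Γ ⧸ U).out) hh (hUθ h2)
      rwa [mul_inv_cancel_left, hUf _ h2, add_zero] at h3
    refine ⟨α (f h), b (f h), ?_, hαb _, hα _ h hh rfl hfh⟩
    refine dvd_trans ?_ (Finset.dvd_prod_of_mem _ (Finset.mem_univ (1 : G)))
    rw [one_smul]
    conv_lhs => rw [← h1]
    exact Finset.dvd_prod_of_mem (fun j : Γ ⧸ U => b (f j.out)) (Finset.mem_univ _)

end KummerSetup

namespace KummerSetup

variable {p : ℕ} [Fact p.Prime] {Γ G Ω R A : Type} [Group Γ] [TopologicalSpace Γ]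
    [IsTopologicalGroup Γ] [Group G] [Field Ω] [MulSemiringAction Γ Ω] [CommRing R] [IsDomain R]
    [UniqueFactorizationMonoid R] [MulSemiringAction G R] {θ : Γ →* G} {q : R →+* Ω}

omit [IsTopologicalGroup Γ] [IsDomain R] in
/-- If `h` fixes `p`-th roots of all prime divisors of `b`, it fixes `p`-th roots of divisors of
`b`. -/
theorem smul_eq_self_of_dvd (hS : KummerSetup p θ q) {𝒟 : Type} {π : 𝒟 → R} {r : 𝒟 → Ω}
    (hr : ∀ D, r D ^ p = q (π D)) {b : R} (hπ : ∀ x, Prime x → x ∣ b → ∃ D, Associated x (π D))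
    {h : Γ} (hh : ∀ D, h • r D = r D) {c : R} (hc : c ∣ b) (u : Rˣ) {α : Ω}
    (hα : α ^ p = q (u * c)) : h • α = α := by
  have hp0 : p ≠ 0 := (Fact.out : p.Prime).ne_zero
  induction c using UniqueFactorizationMonoid.induction_on_prime generalizing u α with
  | h₁ =>
    rw [mul_zero, map_zero] at hα
    rw [eq_zero_of_pow_eq_zero hα, smul_zero]
  | h₂ x hx =>
    exact hS.smul_eq_of_pow α (u * hx.unit) (by simpa using hα) h
  | h₃ a x ha hx ih =>
    obtain ⟨D, v, hv⟩ := hπ x hx ((dvd_mul_right x a).trans hc)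
    have hrD : r D ≠ 0 := by
      intro h0
      have h1 := hr D
      rw [h0, zero_pow hp0] at h1
      have h2 : π D = 0 := hS.inj (h1.symm.trans (map_zero q).symm)
      rw [h2] at hv
      exact hx.ne_zero ((Units.mul_left_eq_zero v).mp hv)
    have h1 := ih ((dvd_mul_left a x).trans hc) (u * v⁻¹) (α := α / r D) (by
      rw [div_pow, hr, hα, div_eq_iff (by rw [← hr]; exact pow_ne_zero p hrD), ← map_mul, ← hv,
        Units.val_mul]
      congr 1
      have h3 : (v : R) * (↑v⁻¹ : R) = 1 := v.mul_inv
      linear_combination (-(u : R) * a * x) * h3)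
    have h2 : α = α / r D * r D := by rw [div_mul_cancel₀ _ hrD]
    rw [h2, smul_mul', h1, hh]

theorem exists_kummerDatum (hS : KummerSetup p θ q) [Finite G] [AddCommGroup A]
    [Module (ZMod p) A] [DistribMulAction G A] {f : Γ → A}
    (hf : ∀ h h', θ h = 1 → θ h' = 1 → f (h * h') = f h + f h')
    (hconj : ∀ γ h, θ h = 1 → f (γ * h * γ⁻¹) = θ γ • f h)
    (hfU : ∃ U : Subgroup Γ, IsOpen (U : Set Γ) ∧ U ≤ θ.ker ∧ ∀ u ∈ U, f u = 0) :
    ∃ (𝒟 : Type) (_ : Finite 𝒟) (_ : MulAction G 𝒟) (e : Multiplicative (ZMod p) →* Ωˣ)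
      (lam : Γ → 𝒟 → Ωˣ), KummerDatum p θ e lam f := by
  classical
  have hp0 : p ≠ 0 := (Fact.out : p.Prime).ne_zero
  obtain ⟨ζ, hζ⟩ := hS.exists_primitive
  obtain ⟨b, hb, hbG, hbf⟩ := hS.exists_radicand hf hfU
  obtain ⟨𝒟, hfin, _, π, hπ, hπG, hπinj, hπb⟩ := exists_prime_system hb hbG
  let _ : Fintype 𝒟 := Fintype.ofFinite 𝒟
  choose r hr using fun D => hS.exists_root (q (π D))
  have hqπ : ∀ D, q (π D) ≠ 0 := fun D h => (hπ D).ne_zero (hS.inj (h.trans (map_zero q).symm))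
  have hr0 : ∀ D, r D ≠ 0 := fun D h => hqπ D (by rw [← hr, h, zero_pow hp0])
  set e₀ := AddChar.zmodChar p hζ.pow_eq_one with he₀
  let e : Multiplicative (ZMod p) →* Ωˣ := e₀.toMonoidHom.toHomUnits
  have hee : ∀ t : ZMod p, (e (Multiplicative.ofAdd t) : Ω) = e₀ t := fun t => rfl
  let lam : Γ → 𝒟 → Ωˣ := fun γ D => Units.mk0 (γ • r D) (by
    rw [Ne, smul_eq_zero_iff_eq]; exact hr0 D) / Units.mk0 (r (θ γ • D)) (hr0 _)
  have hlam : ∀ γ D, (lam γ D : Ω) = γ • r D / r (θ γ • D) := fun γ D => by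
    simp [lam]
  have hlamr : ∀ γ D, γ • r D = lam γ D * r (θ γ • D) := fun γ D => by
    rw [hlam, div_mul_cancel₀ _ (hr0 _)]
  have hlamp : ∀ γ D, ∃ u : Rˣ, (lam γ D : Ω) ^ p = q u := by
    intro γ D
    obtain ⟨u, hu⟩ := (hπG (θ γ) D).symm
    refine ⟨u, ?_⟩
    rw [hlam, div_pow, ← smul_pow', hr, hr, hS.smul_map, ← hu, map_mul, mul_comm,
      mul_div_assoc, div_self (hqπ _), mul_one]
  have hlamΓ : ∀ γ D (δ : Γ), δ • (lam γ D : Ω) = lam γ D := by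
    intro γ D δ
    obtain ⟨u, hu⟩ := hlamp γ D
    exact hS.smul_eq_of_pow _ u hu δ
  have hlam_mul : ∀ γ γ' D, lam (γ * γ') D = lam γ (θ γ' • D) * lam γ' D := by
    intro γ γ' D
    apply Units.ext
    rw [Units.val_mul, hlam (γ * γ'), mul_smul, hlamr, smul_mul', hlamΓ, hlamr, map_mul, mul_smul,
      ← mul_assoc, mul_div_assoc, div_self (hr0 _), mul_one, mul_comm]
  have hlam_pow : ∀ h, θ h = 1 → ∀ D, lam h D ^ p = 1 := by
    intro h hh D
    apply Units.ext
    rw [Units.val_pow_eq_pow_val, hlam, hh, one_smul, div_pow, ← smul_pow', hr, hS.smul_map, hh,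
      one_smul, div_self (hqπ D), Units.val_one]
  have hlog : ∀ c : Ωˣ, c ^ p = 1 → ∃ t, e t = c := by
    intro c hc
    obtain ⟨t, ht⟩ := exists_zmodChar_eq hζ (z := (c : Ω)) (by
      rw [← Units.val_pow_eq_pow_val, hc, Units.val_one])
    exact ⟨Multiplicative.ofAdd t, Units.ext ht⟩
  have hinj : Function.Injective e := by
    intro s t hst
    exact zmodChar_injective hζ (congrArg Units.val hst)
  refine ⟨𝒟, hfin, inferInstance, e, lam, hS.surj, hinj, hlog, hlam_mul, hlam_pow, fun w => ?_,
    hf, hconj, fun h hh hh1 => ?_⟩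
  · have hmulN : ∀ h h', θ h = 1 → θ h' = 1 → ∀ D, lam (h * h') D = lam h D * lam h' D := by
      intro h h' _ hh' D
      rw [hlam_mul, hh', one_smul]
    let W : AddSubgroup (𝒟 → ZMod p) :=
      { carrier := {w | ∃ h, θ h = 1 ∧ ∀ D, lam h D = e (Multiplicative.ofAdd (w D))}
        add_mem' := by
          rintro w w' ⟨h, hh, hw⟩ ⟨h', hh', hw'⟩
          exact ⟨h * h', by rw [map_mul, hh, hh', one_mul], fun D => by
            rw [hmulN h h' hh hh', hw, hw', Pi.add_apply, ofAdd_add, map_mul]⟩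
        zero_mem' := ⟨1, map_one θ, fun D => by
          have h1 := hmulN 1 1 (map_one θ) (map_one θ) D
          rw [mul_one, left_eq_mul] at h1
          rw [h1]; simp⟩
        neg_mem' := by
          rintro w ⟨h, hh, hw⟩
          have hhi : θ h⁻¹ = 1 := by rw [map_inv, hh, inv_one]
          refine ⟨h⁻¹, hhi, fun D => ?_⟩
          have h1 := hmulN 1 1 (map_one θ) (map_one θ) D
          have h2 := hmulN h⁻¹ h hhi hh D
          rw [mul_one, left_eq_mul] at h1
          rw [inv_mul_cancel, h1, hw] at h2
          rw [Pi.neg_apply, ofAdd_neg, map_inv]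
          exact eq_inv_of_mul_eq_one_left h2.symm }
    by_contra hw
    have hw' : w ∉ AddSubgroup.toZModSubmodule p W := hw
    obtain ⟨l, hlw, hl⟩ := Submodule.exists_le_ker_of_notMem hw'
    set n : 𝒟 → ℕ := fun D => (l (Pi.single D 1)).val with hn
    have hlsum : ∀ w, l w = ∑ D, w D * (n D : ZMod p) := by
      intro w
      rw [LinearMap.pi_apply_eq_sum_univ l w]
      refine Finset.sum_congr rfl fun D _ => ?_
      have h6 : (fun j => if D = j then (1 : ZMod p) else 0) = Pi.single D 1 := by
        ext j; simp [Pi.single_apply, eq_comm]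
      rw [h6, hn, ZMod.natCast_val, ZMod.cast_id', id, smul_eq_mul]
    have hfix : ∀ h, θ h = 1 → h • ∏ D, r D ^ n D = ∏ D, r D ^ n D := by
      intro h hh
      choose t ht using fun D => hlog _ (hlam_pow h hh D)
      have hker : l (fun D => (t D).toAdd) = 0 := hl (show _ ∈ W from ⟨h, hh, fun D => (ht D).symm⟩)
      rw [Finset.smul_prod']
      have hsum : ∀ x : 𝒟 → ZMod p, e₀ (∑ D, x D) = ∏ D, e₀ (x D) := fun x =>
        map_prod e₀.toMonoidHom (fun D => Multiplicative.ofAdd (x D)) Finset.univ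
      have h1 : ∀ D, h • r D ^ n D = e₀ ((t D).toAdd * (n D : ZMod p)) * r D ^ n D := by
        intro D
        rw [smul_pow', hlamr, hh, one_smul, ← ht D, mul_pow]
        congr 1
        rw [mul_comm, ← nsmul_eq_mul, AddChar.map_nsmul_eq_pow]
        rfl
      rw [Finset.prod_congr rfl fun D _ => h1 D, Finset.prod_mul_distrib,
        ← hsum, ← hlsum, hker, AddChar.map_zero_eq_one, one_mul]
    obtain ⟨a, c, hc, hac⟩ := hS.exists_fraction _ hfix
    have hacp : a ^ p = (∏ D, π D ^ n D) * c ^ p := by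
      apply hS.inj
      rw [map_pow, ← hac, mul_pow, map_mul, map_pow, map_prod, ← Finset.prod_pow]
      congr 1
      refine Finset.prod_congr rfl fun D _ => ?_
      rw [map_pow, ← hr, ← pow_mul, ← pow_mul, mul_comm]
    obtain ⟨d, rfl⟩ : c ∣ a :=
      (IsIntegrallyClosed.pow_dvd_pow_iff hp0).mp ⟨_, hacp.trans (mul_comm _ _)⟩
    have hd : d ^ p = ∏ D, π D ^ n D := by
      rw [mul_pow, mul_comm] at hacp
      exact mul_right_cancel₀ (pow_ne_zero p hc) hacp
    have hn0 : ∀ D, n D = 0 := by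
      intro D
      by_contra hnD
      have h1 : π D ∣ d := by
        refine (hπ D).dvd_of_dvd_pow (n := p) ?_
        rw [hd]
        exact (dvd_pow_self _ hnD).trans (Finset.dvd_prod_of_mem _ (Finset.mem_univ D))
      have h2 : π D ^ n D * π D ∣ π D ^ n D * ∏ D' ∈ Finset.univ.erase D, π D' ^ n D' := by
        rw [Finset.mul_prod_erase _ (fun D' => π D' ^ n D') (Finset.mem_univ D), ← hd, ← pow_succ]
        exact (pow_dvd_pow _ (ZMod.val_lt _)).trans (pow_dvd_pow_of_dvd h1 p)
      have h3 := (mul_dvd_mul_iff_left (pow_ne_zero _ (hπ D).ne_zero)).mp h2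
      obtain ⟨D', hD', h4⟩ := (hπ D).exists_mem_finset_dvd h3
      have h5 := (hπ D).dvd_of_dvd_pow h4
      exact (Finset.mem_erase.mp hD').1
        (hπinj _ _ (((hπ D).dvd_prime_iff_associated (hπ D')).mp h5)).symm
    apply hlw
    rw [hlsum]
    simp [hn0]
  · by_contra hfh
    obtain ⟨α, c, hcb, hαc, hα⟩ := hbf h hh hfh
    refine hα (hS.smul_eq_self_of_dvd hr hπb (h := h) (fun D => ?_) hcb 1 (by simpa using hαc))
    rw [hlamr, hh1, hh, one_smul, Units.val_one, one_mul]

end KummerSetup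

theorem exists_kummerSetup_of_isFractionRing (p : ℕ) [Fact p.Prime] {G R L : Type} [Group G]
    [CommRing R] [IsDomain R] [MulSemiringAction G R] [Field L] [CharZero L]
    [Algebra R L] [IsFractionRing R L] [MulSemiringAction G L]
    {K : Type} [Field K] [Algebra K L] [FiniteDimensional K L] [IsGalois K L]
    (σ : G ≃* (L ≃ₐ[K] L)) (hσ : ∀ g x, σ g x = g • x)
    (hsmul : ∀ (g : G) (b : R), g • algebraMap R L b = algebraMap R L (g • b)) (ι : ℂ →+* R)
    (hι : ∀ (g : G) c, g • ι c = ι c) (hunit : ∀ u : Rˣ, ∃ c, ι c = u) :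
    ∃ (θ : AbsGal K →* G) (q : R →+* SeparableClosure K),
      KummerSetup p θ q := by
  have hp0 : p ≠ 0 := (Fact.out : p.Prime).ne_zero
  let Ω := SeparableClosure K
  let φ : L →ₐ[K] Ω := IsSepClosed.lift
  let _ : Algebra L Ω := φ.toRingHom.toAlgebra
  have : IsScalarTower K L Ω := IsScalarTower.of_algebraMap_eq fun x => (φ.commutes x).symm
  let θ : AbsGal K →* G := σ.symm.toMonoidHom.comp
    (AlgEquiv.restrictNormalHom L)
  have hφ : ∀ (γ : AbsGal K) (x : L), γ (φ x) = φ (θ γ • x) := by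
    intro γ x
    have h1 : φ (AlgEquiv.restrictNormal γ L x) = γ (φ x) := AlgEquiv.restrictNormal_commutes γ L x
    have h2 : σ (θ γ) = AlgEquiv.restrictNormal γ L := MulEquiv.apply_symm_apply _ _
    rw [← h1, ← h2, hσ]
  have hker : θ.ker = φ.fieldRange.fixingSubgroup := by
    ext γ
    rw [MonoidHom.mem_ker, IntermediateField.mem_fixingSubgroup_iff]
    constructor
    · rintro h _ ⟨x, rfl⟩
      change γ (φ x) = φ x
      rw [hφ, h, one_smul]
    · intro h
      refine σ.injective (AlgEquiv.ext fun x => φ.injective ?_)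
      rw [hσ, hσ, one_smul]
      change φ (θ γ • x) = φ x
      rw [← hφ]
      exact h _ ⟨x, rfl⟩
  have : FiniteDimensional K φ.fieldRange := φ.toLinearMap.finiteDimensional_range
  let q : R →+* Ω := φ.toRingHom.comp (algebraMap R L)
  have hqdef : ∀ b, q b = φ (algebraMap R L b) := fun b => rfl
  have hqsmul : ∀ (γ : AbsGal K) b, γ (q b) = q (θ γ • b) := by
    intro γ b
    rw [hqdef, hφ, hsmul, hqdef]
  have hconst : ∀ (γ : AbsGal K) c, γ (q (ι c)) = q (ι c) := fun γ c => by rw [hqsmul, hι]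
  have hinj : Function.Injective q := φ.injective.comp (IsFractionRing.injective R L)
  have : CharZero Ω := charZero_of_injective_ringHom φ.injective
  have : NeZero (p : Ω) := ⟨Nat.cast_ne_zero.mpr hp0⟩
  obtain ⟨z, hz⟩ := HasEnoughRootsOfUnity.exists_primitiveRoot ℂ p
  have hζ : IsPrimitiveRoot (q (ι z)) p := hz.map_of_injective (f := q.comp ι)
    (q.comp ι).injective
  refine ⟨θ, q, isGaloisAction_aut K Ω, ?_, ?_, hinj, hqsmul,
    fun x => IsSepClosed.exists_pow_nat_eq x p, ⟨_, hζ⟩, fun x u hx γ => ?_, fun x hx => ?_⟩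
  · exact σ.symm.surjective.comp
      (AlgEquiv.restrictNormalHom_surjective Ω)
  · rw [hker]
    exact IntermediateField.fixingSubgroup_isOpen _
  · obtain ⟨c, hc⟩ := hunit u
    obtain ⟨d, rfl⟩ := IsAlgClosed.exists_pow_nat_eq c (Nat.pos_of_ne_zero hp0)
    have hd0 : q (ι d) ≠ 0 := by
      intro h0
      rw [map_pow] at hc
      have h1 : ι d = 0 := hinj (h0.trans (map_zero q).symm)
      rw [h1, zero_pow hp0] at hc
      exact u.ne_zero hc.symm
    have h1 : (x / q (ι d)) ^ p = 1 := by
      rw [div_pow, hx, ← hc, map_pow, map_pow, div_self (pow_ne_zero p hd0)]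
    obtain ⟨i, -, hi⟩ := hζ.eq_pow_of_pow_eq_one h1
    have h2 : x = q (ι (z ^ i * d)) := by
      rw [map_mul, map_mul, map_pow, map_pow, hi, div_mul_cancel₀ _ hd0]
    rw [h2]
    exact hconst γ _
  · have h1 : x ∈ IntermediateField.fixedField φ.fieldRange.fixingSubgroup := by
      rintro ⟨γ, hγ⟩
      rw [← hker] at hγ
      exact hx γ hγ
    rw [InfiniteGalois.fixedField_fixingSubgroup] at h1
    obtain ⟨y, rfl⟩ := h1
    obtain ⟨a, b, hb, rfl⟩ := IsFractionRing.div_surjective R y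
    have hb0 : algebraMap R L b ≠ 0 :=
      IsFractionRing.to_map_ne_zero_of_mem_nonZeroDivisors hb
    refine ⟨a, b, nonZeroDivisors.ne_zero hb, ?_⟩
    change φ _ * φ _ = φ _
    rw [← map_mul, div_mul_cancel₀ _ hb0]

/-- The action of a group on polynomials in variables indexed by the group. -/
noncomputable abbrev regularPolynomialAction (G : Type) [Group G] :
    MulSemiringAction G (MvPolynomial G ℂ) where
  smul g f := MvPolynomial.rename (g * ·) f
  one_smul f := by
    change MvPolynomial.rename (1 * ·) f = f
    simp only [one_mul]
    exact MvPolynomial.rename_id_apply f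
  mul_smul g h f := by
    change MvPolynomial.rename _ f = MvPolynomial.rename _ (MvPolynomial.rename _ f)
    rw [MvPolynomial.rename_rename]
    congr 2
    ext x
    exact mul_assoc _ _ _
  smul_zero g := map_zero (MvPolynomial.rename (g * ·))
  smul_add g := map_add (MvPolynomial.rename (g * ·))
  smul_one g := map_one (MvPolynomial.rename (g * ·))
  smul_mul g := map_mul (MvPolynomial.rename (g * ·))

theorem exists_galois_controlled_lifts (p : ℕ) [Fact p.Prime] (G : Type) [Group G] [Finite G]
    (hG : IsPGroup p G) :
    ∃ (K : Type) (_ : Field K) (θ : AbsGal K →* G), IsOpen (θ.ker : Set (AbsGal K)) ∧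
      ∀ {A : Type} [AddCommGroup A] [Module (ZMod p) A] [DistribMulAction G A] (f : AbsGal K → A),
        (∀ h h', θ h = 1 → θ h' = 1 → f (h * h') = f h + f h') →
        (∀ γ h, θ h = 1 → f (γ * h * γ⁻¹) = θ γ • f h) →
        (∃ U : Subgroup (AbsGal K), IsOpen (U : Set (AbsGal K)) ∧ U ≤ θ.ker ∧ ∀ u ∈ U, f u = 0) →
        ∀ s t : G, s * t = t * s → s ^ p = 1 → t ^ p = 1 →
        ∀ M : Subgroup G, M.Normal → M = Subgroup.closure {s, t} →
          ∃ γ γ', θ γ = s ∧ θ γ' = t ∧ f (γ * γ' * γ⁻¹ * γ'⁻¹) = 0 ∧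
            ∀ δ, (δ = γ ∨ δ = γ') → θ δ ∈ Subgroup.center G → θ δ ∈ commutator G →
              ∀ {B : Type} [AddCommGroup B] [Module (ZMod p) B] (κ : A →+ B),
                NormVanish p M κ → NormVanish p G κ → κ (f (δ ^ p)) = 0 := by
  let R := MvPolynomial G ℂ
  let L := FractionRing R
  let _ : MulSemiringAction G R := regularPolynomialAction G
  have hRdef : ∀ (g : G) (f : R), g • f = MvPolynomial.rename (g * ·) f := fun _ _ => rfl
  have : FaithfulSMul G R := ⟨fun {g h} hgh => by
    have h1 := hgh (MvPolynomial.X 1)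
    rw [hRdef, hRdef, MvPolynomial.rename_X, MvPolynomial.rename_X, mul_one, mul_one] at h1
    exact MvPolynomial.X_injective h1⟩
  let _ : MulSemiringAction G L := IsFractionRing.mulSemiringAction G R L
  have : SMulDistribClass G R L := IsFractionRing.smulDistribClass G R L
  have : FaithfulSMul G L := IsFractionRing.faithfulSMul G R L
  have : CharZero L := charZero_of_injective_ringHom (IsFractionRing.injective R L)
  obtain ⟨θ, q, hS⟩ := exists_kummerSetup_of_isFractionRing p (G := G) (R := R) (L := L)
    (FixedPoints.toAlgAutMulEquiv G L) (fun _ _ => rfl) (fun g b => (algebraMap.coe_smul' g b L).symm) MvPolynomial.C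
    (fun g c => by rw [hRdef, MvPolynomial.rename_C])
    (fun u => by
      obtain ⟨r, -, hr⟩ := MvPolynomial.isUnit_iff_eq_C_of_isReduced.mp u.isUnit
      exact ⟨r, hr.symm⟩)
  refine ⟨FixedPoints.subfield G L, inferInstance, θ, hS.isOpen_ker, ?_⟩
  intro A _ _ _ f hf hconj hfU s t hst hs ht M hMn hM
  obtain ⟨𝒟, _, _, e, lam, hK⟩ := hS.exists_kummerDatum hf hconj hfU
  exact hK.exists_controlled_lifts hG s t hst hs ht M hMn hM

/-- The norm-vanishing condition for the action of `Q` on matrices by conjugation through `j`. -/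
def ConjNormVanish (p : ℕ) {Q n k : Type} [Group Q] [Fintype n] [DecidableEq n] [Field k]
    (j : Q →* GL n k) (κ : Matrix n n k →+ k) : Prop :=
  ∀ (ϑ : Q →* Multiplicative (ZMod p)) (g : Q) (a : Matrix n n k), ϑ g = Multiplicative.ofAdd 1 →
    (∀ h, ϑ h = 1 → (j h).1 * a = a * (j h).1) →
    κ (∑ i ∈ Finset.range p, (j (g ^ i)).1 * a * (j (g ^ i)⁻¹).1) = 0

/-- Conjugation action on matrices through a linear representation. -/
abbrev conjMulAction {Q n k : Type} [Group Q] [Fintype n] [DecidableEq n] [Field k]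
    (j : Q →* GL n k) : DistribMulAction Q (Matrix n n k) where
  smul g a := (j g).1 * a * (j g⁻¹).1
  one_smul a := by
    change (j 1).1 * a * (j 1⁻¹).1 = a
    simp
  mul_smul g h a := by
    change (j (g * h)).1 * a * (j (g * h)⁻¹).1 = (j g).1 * ((j h).1 * a * (j h⁻¹).1) * (j g⁻¹).1
    simp only [mul_inv_rev, map_mul, Units.val_mul, mul_assoc]
  smul_zero g := by
    change (j g).1 * 0 * (j g⁻¹).1 = 0
    simp
  smul_add g a b := by
    change (j g).1 * (a + b) * (j g⁻¹).1 = (j g).1 * a * (j g⁻¹).1 + (j g).1 * b * (j g⁻¹).1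
    rw [mul_add, add_mul]

theorem ConjNormVanish.normVanish {p : ℕ} {Q n k : Type} [Group Q] [Fintype n] [DecidableEq n]
    [Field k] {j : Q →* GL n k} {κ : Matrix n n k →+ k} [inst : DistribMulAction Q (Matrix n n k)]
    (hsmul : ∀ (g : Q) (a : Matrix n n k), g • a = (j g).1 * a * (j g⁻¹).1)
    (hκ : ConjNormVanish p j κ) : NormVanish p Q κ := by
  intro ϑ g a hg ha
  simp only [hsmul] at ha ⊢
  refine hκ ϑ g a hg fun h hh => ?_
  conv_rhs => rw [← ha h hh]
  rw [mul_assoc _ (j h⁻¹).1, ← Units.val_mul, ← map_mul, inv_mul_cancel, map_one, Units.val_one,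
    mul_one]

variable {p : ℕ} {k R : Type} [Field k] [CommRing R] {π : R →+* k} {ε : k →+ R}
  {n : Type} [Fintype n] in
theorem IsWittExt.mul_map_eps (h : IsWittExt p π ε) (M : Matrix n n R) (A : Matrix n n k)
    [CharP k p] [Fact p.Prime] :
    M * A.map ε = (((M.map π).map (frobenius k p)) * A).map ε := by
  ext i j
  simp [Matrix.mul_apply, h.mul_eps, frobenius_def]

variable {p : ℕ} {k R : Type} [Field k] [CommRing R] {π : R →+* k} {ε : k →+ R}
  {n : Type} [Fintype n] in
theorem IsWittExt.map_eps_mul (h : IsWittExt p π ε) (M : Matrix n n R) (A : Matrix n n k)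
    [CharP k p] [Fact p.Prime] :
    A.map ε * M = (A * ((M.map π).map (frobenius k p))).map ε := by
  ext i j
  simp only [Matrix.mul_apply, Matrix.map_apply, map_sum, frobenius_def]
  refine Finset.sum_congr rfl fun x _ => ?_
  rw [mul_comm, h.mul_eps, mul_comm]

theorem exists_commuting_lifts {p : ℕ} [Fact p.Prime] {k R : Type} [Field k] [CharP k p]
    [CommRing R] {π : R →+* k} {ε : k →+ R} (h : IsWittExt p π ε)
    {n : Type} [Fintype n] [DecidableEq n]
    (hlift : ∀ (F : Type) [Field F],
      ∀ ρ : AbsGal F →* GL n k, IsOpen (ρ.ker : Set (AbsGal F)) →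
        ∃ ρ₂ : AbsGal F →* GL n R,
          IsOpen (ρ₂.ker : Set (AbsGal F)) ∧
          (Matrix.GeneralLinearGroup.map π).comp ρ₂ = ρ)
    {G : Type} [Group G] [Finite G] (hG : IsPGroup p G) (ι : G →* GL n k) (s t : G)
    (hst : s * t = t * s) (hs : s ^ p = 1) (ht : t ^ p = 1) (M : Subgroup G) (hMn : M.Normal)
    (hM : M = Subgroup.closure {s, t}) :
    ∃ (S T : Matrix n n R) (v w : Matrix n n k), S.map π = (ι s).1 ∧ T.map π = (ι t).1 ∧
      S * T = T * S ∧ S ^ p = 1 + v.map ε ∧ T ^ p = 1 + w.map ε ∧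
      ∀ κ : Matrix n n k →+ k,
        ConjNormVanish p (((Matrix.GeneralLinearGroup.map (frobenius k p)).comp ι).comp M.subtype) κ →
        ConjNormVanish p ((Matrix.GeneralLinearGroup.map (frobenius k p)).comp ι) κ →
        (s ∈ Subgroup.center G → s ∈ commutator G → κ v = 0) ∧
        (t ∈ Subgroup.center G → t ∈ commutator G → κ w = 0) := by
  obtain ⟨K, _, θ, hθ, H⟩ := exists_galois_controlled_lifts p G hG
  have hker : IsOpen ((ι.comp θ).ker : Set (AbsGal K)) := by
    refine Subgroup.isOpen_mono (fun x hx => ?_) hθ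
    rw [MonoidHom.mem_ker] at hx ⊢
    rw [MonoidHom.comp_apply, hx, map_one]
  obtain ⟨ρ₂, hρ₂, hcomp⟩ := hlift K (ι.comp θ) hker
  have hred : ∀ γ, Matrix.GeneralLinearGroup.map π (ρ₂ γ) = ι (θ γ) := fun γ =>
    DFunLike.congr_fun hcomp γ
  have hred' : ∀ γ, (ρ₂ γ).1.map π = (ι (θ γ)).1 := fun γ => by rw [← hred]; rfl
  have hp0 : p ≠ 0 := (Fact.out : p.Prime).ne_zero
  have hex : ∀ γ, ∃ A : Matrix n n k, θ γ = 1 → (ρ₂ γ).1 = 1 + A.map ε := by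
    intro γ
    by_cases hγ : θ γ = 1
    · obtain ⟨A, hA⟩ := h.exists_eps_of_mem_ker (g := ρ₂ γ) (by
        rw [MonoidHom.mem_ker, hred, hγ, map_one])
      exact ⟨A, fun _ => hA⟩
    · exact ⟨0, fun h => absurd h hγ⟩
  choose f hf using hex
  have hinj : ∀ A B : Matrix n n k, A.map ε = B.map ε → A = B := fun A B hAB => by
    ext i j
    exact h.inj (congrFun (congrFun hAB i) j)
  set j : G →* GL n k := (Matrix.GeneralLinearGroup.map (frobenius k p)).comp ι with hj
  have hjval : ∀ g, (j g).1 = (ι g).1.map (frobenius k p) := fun g => rfl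
  let _ : DistribMulAction G (Matrix n n k) := conjMulAction j
  have hsmul : ∀ (g : G) (a : Matrix n n k), g • a = (j g).1 * a * (j g⁻¹).1 := fun _ _ => rfl
  let _ : Algebra (ZMod p) k := ZMod.algebra k p
  obtain ⟨γ, γ', rfl, rfl, hcomm, hctrl⟩ := H (A := Matrix n n k) f
    (fun x y hx hy => by
      have hxy : θ (x * y) = 1 := by rw [map_mul, hx, hy, one_mul]
      have h1 := hf _ hxy
      rw [map_mul, Units.val_mul, hf _ hx, hf _ hy, mul_add, mul_one, add_mul, one_mul,
        h.map_eps_mul_map_eps hp0, add_zero, add_assoc] at h1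
      refine (hinj _ _ ?_).symm
      rw [← add_left_cancel h1, Matrix.map_add _ (map_add ε)])
    (fun γ x hx => by
      have hxy : θ (γ * x * γ⁻¹) = 1 := by rw [map_mul, map_mul, hx, mul_one, map_inv, mul_inv_cancel]
      have h1 := hf _ hxy
      rw [map_mul, map_mul, Units.val_mul, Units.val_mul, hf _ hx, mul_add, mul_one, add_mul,
        ← Units.val_mul, ← map_mul, mul_inv_cancel, map_one, Units.val_one, h.mul_map_eps,
        h.map_eps_mul, hred', hred', map_inv] at h1
      exact (hinj _ _ (add_left_cancel h1)).symm)
    ⟨ρ₂.ker ⊓ θ.ker, by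
      rw [Subgroup.coe_inf]
      exact hρ₂.inter hθ, inf_le_right, fun u hu => by
      have h1 := hf u hu.2
      rw [MonoidHom.mem_ker.mp hu.1, Units.val_one] at h1
      refine hinj _ _ ?_
      rw [Matrix.map_zero _ (map_zero ε)]
      exact (left_eq_add.mp h1)⟩
    s t hst hs ht M hMn hM
  have hpow : ∀ δ, θ δ ^ p = 1 → (ρ₂ δ).1 ^ p = 1 + (f (δ ^ p)).map ε := fun δ hδ => by
    rw [← hf _ (by rw [map_pow, hδ]), map_pow, Units.val_pow_eq_pow_val]
  refine ⟨(ρ₂ γ).1, (ρ₂ γ').1, f (γ ^ p), f (γ' ^ p), hred' _, hred' _, ?_, hpow _ hs, hpow _ ht,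
    fun κ hκM hκG => ?_⟩
  · have h1 := hf (γ * γ' * γ⁻¹ * γ'⁻¹) (by
      rw [map_mul, map_mul, map_mul, map_inv, map_inv, hst, mul_inv_cancel_right, mul_inv_cancel])
    rw [hcomm, Matrix.map_zero _ (map_zero ε), add_zero] at h1
    have h2 : ρ₂ (γ * γ' * γ⁻¹ * γ'⁻¹) = 1 := Units.ext h1
    rw [map_mul, map_mul, map_mul, map_inv, map_inv, mul_inv_eq_one, mul_inv_eq_iff_eq_mul] at h2
    exact congrArg Units.val h2
  · have h1 : NormVanish p M κ :=
      ConjNormVanish.normVanish (j := j.comp M.subtype) (fun g a => hsmul g a) hκM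
    have h2 : NormVanish p G κ := ConjNormVanish.normVanish hsmul hκG
    exact ⟨fun hc hd => hctrl γ (Or.inl rfl) hc hd (B := k) κ h1 h2,
      fun hc hd => hctrl γ' (Or.inr rfl) hc hd (B := k) κ h1 h2⟩

/-- Inclusions and projections of three consecutive blocks, of sizes `m`, `1`, `m`. -/
structure BlockFrame (n m S : Type) [Fintype n] [DecidableEq n] [Fintype m] [DecidableEq m]
    [CommRing S] where
  E₁ : Matrix n m S
  E₂ : Matrix n Unit S
  E₃ : Matrix n m S
  F₁ : Matrix m n S
  F₂ : Matrix Unit n S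
  F₃ : Matrix m n S
  F₁E₁ : F₁ * E₁ = 1
  F₁E₂ : F₁ * E₂ = 0
  F₁E₃ : F₁ * E₃ = 0
  F₂E₁ : F₂ * E₁ = 0
  F₂E₂ : F₂ * E₂ = 1
  F₂E₃ : F₂ * E₃ = 0
  F₃E₁ : F₃ * E₁ = 0
  F₃E₂ : F₃ * E₂ = 0
  F₃E₃ : F₃ * E₃ = 1

namespace BlockFrame

variable {n m l S : Type} [Fintype n] [DecidableEq n] [Fintype m] [DecidableEq m] [CommRing S]
  (W : BlockFrame n m S)

@[simp] theorem F₁E₁_assoc (z : Matrix m l S) : W.F₁ * (W.E₁ * z) = z := by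
  rw [← Matrix.mul_assoc, W.F₁E₁, Matrix.one_mul]
@[simp] theorem F₁E₂_assoc (z : Matrix Unit l S) : W.F₁ * (W.E₂ * z) = 0 := by
  rw [← Matrix.mul_assoc, W.F₁E₂, Matrix.zero_mul]
@[simp] theorem F₁E₃_assoc (z : Matrix m l S) : W.F₁ * (W.E₃ * z) = 0 := by
  rw [← Matrix.mul_assoc, W.F₁E₃, Matrix.zero_mul]
@[simp] theorem F₂E₁_assoc (z : Matrix m l S) : W.F₂ * (W.E₁ * z) = 0 := by
  rw [← Matrix.mul_assoc, W.F₂E₁, Matrix.zero_mul]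
@[simp] theorem F₂E₂_assoc (z : Matrix Unit l S) : W.F₂ * (W.E₂ * z) = z := by
  rw [← Matrix.mul_assoc, W.F₂E₂, Matrix.one_mul]
@[simp] theorem F₂E₃_assoc (z : Matrix m l S) : W.F₂ * (W.E₃ * z) = 0 := by
  rw [← Matrix.mul_assoc, W.F₂E₃, Matrix.zero_mul]
@[simp] theorem F₃E₁_assoc (z : Matrix m l S) : W.F₃ * (W.E₁ * z) = 0 := by
  rw [← Matrix.mul_assoc, W.F₃E₁, Matrix.zero_mul]
@[simp] theorem F₃E₂_assoc (z : Matrix Unit l S) : W.F₃ * (W.E₂ * z) = 0 := by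
  rw [← Matrix.mul_assoc, W.F₃E₂, Matrix.zero_mul]
@[simp] theorem F₃E₃_assoc (z : Matrix m l S) : W.F₃ * (W.E₃ * z) = z := by
  rw [← Matrix.mul_assoc, W.F₃E₃, Matrix.one_mul]

attribute [simp] F₁E₁ F₁E₂ F₁E₃ F₂E₁ F₂E₂ F₂E₃ F₃E₁ F₃E₂ F₃E₃

/-- The block unitriangular matrix with prescribed blocks above the diagonal. -/
def heis (X : Matrix m Unit S) (B : Matrix Unit m S) (Y : Matrix m m S) : Matrix n n S :=
  1 + W.E₁ * (X * W.F₂) + W.E₂ * (B * W.F₃) + W.E₁ * (Y * W.F₃)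

theorem heis_mul (X X' : Matrix m Unit S) (B B' : Matrix Unit m S) (Y Y' : Matrix m m S) :
    W.heis X B Y * W.heis X' B' Y' = W.heis (X + X') (B + B') (Y + Y' + X * B') := by
  simp only [heis, Matrix.mul_add, Matrix.add_mul, Matrix.mul_assoc, Matrix.one_mul,
    Matrix.mul_one, F₂E₁_assoc, F₂E₂_assoc,
    F₃E₁_assoc, F₃E₂_assoc, Matrix.mul_zero]
  abel

theorem heis_zero : W.heis 0 0 0 = 1 := by simp [heis]

theorem heis_mul_neg (X : Matrix m Unit S) (B : Matrix Unit m S) (Y : Matrix m m S) :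
    W.heis X B Y * W.heis (-X) (-B) (X * B - Y) = 1 := by
  rw [heis_mul, ← W.heis_zero]
  simp

/-- The upper right corner block of a matrix. -/
def corner : Matrix n n S →+ Matrix m m S where
  toFun a := W.F₁ * (a * W.E₃)
  map_zero' := by simp
  map_add' a b := by rw [Matrix.add_mul, Matrix.mul_add]

theorem corner_apply (a : Matrix n n S) : W.corner a = W.F₁ * (a * W.E₃) := rfl

theorem one_submatrix_mul_one_submatrix {α β : Type} (f : α → n) (g : β → n) :
    (1 : Matrix n n S).submatrix f id * (1 : Matrix n n S).submatrix id g =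
      (1 : Matrix n n S).submatrix f g := by
  rw [← Matrix.submatrix_mul _ _ _ _ _ Function.bijective_id, Matrix.one_mul]

/-- The frame given by an injection of the indices of the three blocks. -/
def ofEmbedding (S : Type) [CommRing S] (e : m ⊕ Unit ⊕ m ↪ n) : BlockFrame n m S where
  E₁ := (1 : Matrix n n S).submatrix id (fun i => e (.inl i))
  E₂ := (1 : Matrix n n S).submatrix id (fun i => e (.inr (.inl i)))
  E₃ := (1 : Matrix n n S).submatrix id (fun i => e (.inr (.inr i)))
  F₁ := (1 : Matrix n n S).submatrix (fun i => e (.inl i)) id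
  F₂ := (1 : Matrix n n S).submatrix (fun i => e (.inr (.inl i))) id
  F₃ := (1 : Matrix n n S).submatrix (fun i => e (.inr (.inr i))) id
  F₁E₁ := by
    rw [one_submatrix_mul_one_submatrix]
    ext i j
    simp [Matrix.one_apply]
  F₁E₂ := by
    rw [one_submatrix_mul_one_submatrix]
    ext i j
    simp
  F₁E₃ := by
    rw [one_submatrix_mul_one_submatrix]
    ext i j
    simp
  F₂E₁ := by
    rw [one_submatrix_mul_one_submatrix]
    ext i j
    simp
  F₂E₂ := by
    rw [one_submatrix_mul_one_submatrix]
    ext i j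
    simp
  F₂E₃ := by
    rw [one_submatrix_mul_one_submatrix]
    ext i j
    simp
  F₃E₁ := by
    rw [one_submatrix_mul_one_submatrix]
    ext i j
    simp
  F₃E₂ := by
    rw [one_submatrix_mul_one_submatrix]
    ext i j
    simp
  F₃E₃ := by
    rw [one_submatrix_mul_one_submatrix]
    ext i j
    simp [Matrix.one_apply]

theorem map_heis_ofEmbedding {T : Type} [CommRing T] (e : m ⊕ Unit ⊕ m ↪ n) (φ : S →+* T)
    (X : Matrix m Unit S) (B : Matrix Unit m S) (Y : Matrix m m S) :
    ((ofEmbedding S e).heis X B Y).map φ =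
      (ofEmbedding T e).heis (X.map φ) (B.map φ) (Y.map φ) := by
  simp only [heis, ofEmbedding, Matrix.map_add _ (map_add φ), Matrix.map_mul,
    Matrix.map_one φ (map_zero φ) (map_one φ), ← Matrix.submatrix_map]

/-- `X`-, `B`-, `Y`-parts in the conjugate of a matrix that is block upper triangular on the
frame. -/
theorem corner_conj (X : Matrix m Unit S) (B : Matrix Unit m S) (Y : Matrix m m S)
    (a : Matrix n n S) (h₂₁ : W.F₂ * (a * W.E₁) = 0) (h₃₁ : W.F₃ * (a * W.E₁) = 0)
    (h₃₂ : W.F₃ * (a * W.E₂) = 0)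
    (hX : W.F₁ * (a * W.E₁) * X = X * (W.F₂ * (a * W.E₂)))
    (hY : W.F₁ * (a * W.E₁) * Y = Y * (W.F₃ * (a * W.E₃))) :
    W.corner (W.heis X B Y * a * W.heis (-X) (-B) (X * B - Y)) =
      W.corner a - W.F₁ * (a * W.E₂) * B + X * (W.F₂ * (a * W.E₃)) := by
  have e₃ : W.heis (-X) (-B) (X * B - Y) * W.E₃ = W.E₃ - W.E₂ * B + W.E₁ * (X * B - Y) := by
    simp only [heis, Matrix.add_mul, Matrix.mul_assoc, F₂E₃, F₃E₃, Matrix.mul_zero,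
      Matrix.mul_one, Matrix.one_mul, Matrix.mul_neg]
    abel
  have f₁ : W.F₁ * W.heis X B Y = W.F₁ + X * W.F₂ + Y * W.F₃ := by
    simp only [heis, Matrix.mul_add, F₁E₁_assoc, F₁E₂_assoc, Matrix.mul_one]
    abel
  have h1 : W.corner (W.heis X B Y * a * W.heis (-X) (-B) (X * B - Y)) =
      (W.F₁ * W.heis X B Y) * (a * (W.heis (-X) (-B) (X * B - Y) * W.E₃)) := by
    simp only [corner_apply, Matrix.mul_assoc]
  rw [h1, e₃, f₁]
  have h2 : W.F₁ * (a * (W.E₁ * (X * B - Y))) =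
      X * (W.F₂ * (a * W.E₂)) * B - Y * (W.F₃ * (a * W.E₃)) := by
    rw [← hX, ← hY]
    simp only [Matrix.mul_sub, Matrix.mul_assoc]
  have h3 : W.F₂ * (a * (W.E₁ * (X * B - Y))) = 0 := by
    rw [← Matrix.mul_assoc a, ← Matrix.mul_assoc W.F₂, h₂₁, Matrix.zero_mul]
  have h4 : W.F₃ * (a * (W.E₁ * (X * B - Y))) = 0 := by
    rw [← Matrix.mul_assoc a, ← Matrix.mul_assoc W.F₃, h₃₁, Matrix.zero_mul]
  have h5 : W.F₃ * (a * (W.E₂ * B)) = 0 := by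
    rw [← Matrix.mul_assoc a, ← Matrix.mul_assoc W.F₃, h₃₂, Matrix.zero_mul]
  have h6 : W.F₁ * (a * (W.E₂ * B)) = W.F₁ * (a * W.E₂) * B := by
    simp only [Matrix.mul_assoc]
  have h7 : W.F₂ * (a * (W.E₂ * B)) = W.F₂ * (a * W.E₂) * B := by
    simp only [Matrix.mul_assoc]
  clear e₃ h1
  generalize X * B - Y = Z at h2 h3 h4 ⊢
  rw [Matrix.mul_add a, Matrix.mul_sub a]
  simp only [Matrix.add_mul, Matrix.mul_add, Matrix.mul_sub, Matrix.mul_assoc X,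
    Matrix.mul_assoc Y, h2, h3, h4, h5, h6, h7, Matrix.mul_zero, corner_apply]
  abel

end BlockFrame

/-- A Heisenberg-type group: block unitriangular matrices with blocks of sizes `1`, `μ`, `1`
whose upper right corner is replaced by a formal matrix. -/
@[ext] structure HeisGroup (μ S : Type) where
  x : Matrix μ Unit S
  b : Matrix Unit μ S
  y : Matrix μ μ S

namespace HeisGroup

variable {μ S : Type} [CommRing S]

instance : Group (HeisGroup μ S) where
  mul g h := ⟨g.x + h.x, g.b + h.b, g.y + h.y + g.x * h.b⟩
  one := ⟨0, 0, 0⟩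
  inv g := ⟨-g.x, -g.b, g.x * g.b - g.y⟩
  mul_assoc g h l := by
    refine HeisGroup.ext (add_assoc _ _ _) (add_assoc _ _ _) ?_
    change g.y + h.y + g.x * h.b + l.y + (g.x + h.x) * l.b =
      g.y + (h.y + l.y + h.x * l.b) + g.x * (h.b + l.b)
    rw [Matrix.add_mul, Matrix.mul_add]
    abel
  one_mul g := by
    refine HeisGroup.ext (zero_add _) (zero_add _) ?_
    change 0 + g.y + 0 * g.b = g.y
    rw [Matrix.zero_mul, zero_add, add_zero]
  mul_one g := by
    refine HeisGroup.ext (add_zero _) (add_zero _) ?_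
    change g.y + 0 + g.x * 0 = g.y
    rw [Matrix.mul_zero, add_zero, add_zero]
  inv_mul_cancel g := by
    refine HeisGroup.ext (neg_add_cancel _) (neg_add_cancel _) ?_
    change g.x * g.b - g.y + g.y + -g.x * g.b = 0
    rw [Matrix.neg_mul]
    abel

theorem mul_def (g h : HeisGroup μ S) :
    g * h = ⟨g.x + h.x, g.b + h.b, g.y + h.y + g.x * h.b⟩ := rfl
theorem one_def : (1 : HeisGroup μ S) = ⟨0, 0, 0⟩ := rfl
theorem inv_def (g : HeisGroup μ S) : g⁻¹ = ⟨-g.x, -g.b, g.x * g.b - g.y⟩ := rfl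

/-- The underlying set as a product. -/
def equivProd : HeisGroup μ S ≃ (Matrix μ Unit S × Matrix Unit μ S) × Matrix μ μ S where
  toFun g := ((g.x, g.b), g.y)
  invFun t := ⟨t.1.1, t.1.2, t.2⟩

instance [Finite μ] [Finite S] : Finite (HeisGroup μ S) :=
  Finite.of_equiv _ equivProd.symm

theorem isPGroup (p : ℕ) [Fact p.Prime] [Finite μ] : IsPGroup p (HeisGroup μ (ZMod p)) := by
  have := Fintype.ofFinite μ
  refine IsPGroup.of_card (n := Nat.card μ + Nat.card μ + Nat.card μ * Nat.card μ) ?_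
  rw [Nat.card_congr equivProd, Nat.card_prod, Nat.card_prod]
  simp only [Matrix, Nat.card_fun, Nat.card_zmod, Nat.card_unique, pow_one, pow_add, pow_mul]

theorem mem_center (y : Matrix μ μ S) : (⟨0, 0, y⟩ : HeisGroup μ S) ∈ Subgroup.center _ := by
  rw [Subgroup.mem_center_iff]
  intro g
  rw [mul_def, mul_def]
  simp [add_comm]

theorem mem_commutator [Fintype μ] [DecidableEq μ] (y : Matrix μ μ S) :
    (⟨0, 0, y⟩ : HeisGroup μ S) ∈ commutator _ := by
  induction y using Matrix.induction_on' with
  | h_zero => exact one_mem _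
  | h_add y z hy hz =>
    have h1 := mul_mem hy hz
    rw [mul_def] at h1
    simpa using h1
  | h_std_basis i j c =>
    have h1 := Subgroup.commutator_mem_commutator
      (Subgroup.mem_top (⟨Matrix.single i () c, 0, 0⟩ : HeisGroup μ S))
      (Subgroup.mem_top (⟨0, Matrix.single () j 1, 0⟩ : HeisGroup μ S))
    rw [← commutator_def] at h1
    convert h1 using 1
    rw [commutatorElement_def, inv_def, inv_def, mul_def, mul_def, mul_def]
    simp

theorem hom_eq_one {C : Type} [CommGroup C] [Fintype μ] [DecidableEq μ] (ϑ : HeisGroup μ S →* C)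
    (y : Matrix μ μ S) : ϑ ⟨0, 0, y⟩ = 1 :=
  Abelianization.commutator_subset_ker ϑ (mem_commutator y)

theorem x_pow (g : HeisGroup μ S) (j : ℕ) : (g ^ j).x = j • g.x := by
  induction j with
  | zero => rw [pow_zero, zero_smul]; rfl
  | succ j ih => rw [pow_succ, mul_def, ih, succ_nsmul]

theorem b_pow (g : HeisGroup μ S) (j : ℕ) : (g ^ j).b = j • g.b := by
  induction j with
  | zero => rw [pow_zero, zero_smul]; rfl
  | succ j ih => rw [pow_succ, mul_def, ih, succ_nsmul]

theorem mk_pow_of_b_eq_zero (x : Matrix μ Unit S) (y : Matrix μ μ S) (j : ℕ) :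
    (⟨x, 0, y⟩ : HeisGroup μ S) ^ j = ⟨j • x, 0, j • y⟩ := by
  induction j with
  | zero => simp [one_def]
  | succ j ih => rw [pow_succ, ih, mul_def]; simp [succ_nsmul]

variable {n m k : Type} [Fintype n] [DecidableEq n] [Fintype m] [DecidableEq m] [Fintype μ]
  [CommRing k]

/-- The representation of a Heisenberg-type group by block unitriangular matrices. -/
def rep (W : BlockFrame n m k) (c : S →+* k) (P : Matrix m μ k) : HeisGroup μ S →* GL n k where
  toFun g := ⟨W.heis (P * g.x.map c) (g.b.map c * P.transpose) (P * g.y.map c * P.transpose),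
    W.heis (-(P * g.x.map c)) (-(g.b.map c * P.transpose))
      (P * g.x.map c * (g.b.map c * P.transpose) - P * g.y.map c * P.transpose),
    W.heis_mul_neg _ _ _, mul_eq_one_comm.mp (W.heis_mul_neg _ _ _)⟩
  map_one' := by
    ext1
    simp [one_def, W.heis_zero]
  map_mul' g h := by
    ext1
    simp only [mul_def, Units.val_mul, W.heis_mul, Matrix.map_add _ (map_add c), Matrix.map_mul,
      Matrix.mul_add, Matrix.add_mul, Matrix.mul_assoc]

theorem rep_val (W : BlockFrame n m k) (c : S →+* k) (P : Matrix m μ k) (g : HeisGroup μ S) :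
    (rep W c P g).1 =
      W.heis (P * g.x.map c) (g.b.map c * P.transpose) (P * g.y.map c * P.transpose) := rfl

theorem rep_inv_val (W : BlockFrame n m k) (c : S →+* k) (P : Matrix m μ k) (g : HeisGroup μ S) :
    (rep W c P g⁻¹).1 =
      W.heis (-(P * g.x.map c)) (-(g.b.map c * P.transpose))
        (P * g.x.map c * (g.b.map c * P.transpose) - P * g.y.map c * P.transpose) := by
  rw [map_inv]
  rfl

theorem map_comp_rep (e : m ⊕ Unit ⊕ m ↪ n) {S k : Type} [CommRing S] [CommRing k] (φ : k →+* k)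
    (c : S →+* k) (P : Matrix m μ k) (hc : φ.comp c = c) :
    (Matrix.GeneralLinearGroup.map φ).comp (rep (BlockFrame.ofEmbedding k e) c P) =
      rep (BlockFrame.ofEmbedding k e) c (P.map φ) := by
  ext1 g
  apply Units.ext
  change (rep (BlockFrame.ofEmbedding k e) c P g).1.map φ = _
  have h1 : ∀ {α β : Type} (M : Matrix α β S), (M.map c).map φ = M.map c := fun M => by
    ext i j
    exact DFunLike.congr_fun hc _
  rw [rep_val, rep_val, BlockFrame.map_heis_ofEmbedding]
  simp only [Matrix.map_mul, h1, Matrix.transpose_map]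

end HeisGroup

namespace BlockFrame

variable {n m S : Type} [Fintype n] [DecidableEq n] [Fintype m] [DecidableEq m] [CommRing S]
  (W : BlockFrame n m S)

theorem blocks_of_commute {X : Matrix m Unit S} {B : Matrix Unit m S} {Y : Matrix m m S}
    {a : Matrix n n S} (h : W.heis X B Y * a = a * W.heis X B Y) :
    X * (W.F₂ * (a * W.E₁)) + Y * (W.F₃ * (a * W.E₁)) = 0 ∧
    X * (W.F₂ * (a * W.E₂)) + Y * (W.F₃ * (a * W.E₂)) = W.F₁ * (a * W.E₁) * X ∧
    X * (W.F₂ * (a * W.E₃)) + Y * (W.F₃ * (a * W.E₃)) =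
      W.F₁ * (a * W.E₂) * B + W.F₁ * (a * W.E₁) * Y ∧
    B * (W.F₃ * (a * W.E₃)) = W.F₂ * (a * W.E₂) * B + W.F₂ * (a * W.E₁) * Y := by
  have key : ∀ {α β : Type} [Fintype α] [Fintype β] (F : Matrix α n S) (E : Matrix n β S),
      F * (W.heis X B Y * (a * E)) = F * (a * (W.heis X B Y * E)) := fun F E => by
    rw [← Matrix.mul_assoc _ a, h, Matrix.mul_assoc]
  simp only [heis, Matrix.add_mul, Matrix.mul_add, Matrix.one_mul, Matrix.mul_assoc] at key ⊢
  refine ⟨?_, ?_, ?_, ?_⟩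
  · simpa [add_assoc] using key W.F₁ W.E₁
  · simpa [add_assoc] using key W.F₁ W.E₂
  · simpa [add_assoc] using key W.F₁ W.E₃
  · simpa [add_assoc] using key W.F₂ W.E₃

theorem corner_conj_of_zero (Z : Matrix m m S) (a : Matrix n n S)
    (h₃₁ : W.F₃ * (a * W.E₁) = 0) :
    W.corner (W.heis 0 0 Z * a * W.heis 0 0 (-Z)) =
      W.corner a + (Z * (W.F₃ * (a * W.E₃)) - W.F₁ * (a * W.E₁) * Z) := by
  have h4 : W.F₃ * (a * (W.E₁ * Z)) = 0 := by
    rw [← Matrix.mul_assoc a, ← Matrix.mul_assoc W.F₃, h₃₁, Matrix.zero_mul]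
  simp only [corner_apply, heis, Matrix.mul_assoc, Matrix.add_mul, Matrix.mul_add, Matrix.one_mul,
    Matrix.mul_one, Matrix.zero_mul, Matrix.mul_zero, add_zero, F₁E₁_assoc, F₃E₃, Matrix.neg_mul,
    Matrix.mul_neg, h4]
  abel

variable {W} in
/-- A matrix commuting with all corner transvections by invertible blocks. -/
theorem blocks_of_commute_corner {Z : Matrix m m S} (hZ : IsUnit Z) {a : Matrix n n S}
    (h : W.heis 0 0 Z * a = a * W.heis 0 0 Z) :
    W.F₂ * (a * W.E₁) = 0 ∧ W.F₃ * (a * W.E₁) = 0 ∧ W.F₃ * (a * W.E₂) = 0 ∧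
      Z * (W.F₃ * (a * W.E₃)) = W.F₁ * (a * W.E₁) * Z := by
  obtain ⟨h1, h2, h3, h4⟩ := W.blocks_of_commute h
  obtain ⟨U, hU⟩ := isUnit_iff_exists.mp hZ
  simp only [Matrix.zero_mul, zero_add, Matrix.mul_zero] at h1 h2 h3 h4
  refine ⟨?_, ?_, ?_, h3⟩
  · rw [← Matrix.mul_one (W.F₂ * (a * W.E₁)), ← hU.1, ← Matrix.mul_assoc, ← h4, Matrix.zero_mul]
  · rw [← Matrix.one_mul (W.F₃ * (a * W.E₁)), ← hU.2, Matrix.mul_assoc, h1, Matrix.mul_zero]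
  · rw [← Matrix.one_mul (W.F₃ * (a * W.E₂)), ← hU.2, Matrix.mul_assoc, h2, Matrix.mul_zero]

end BlockFrame

theorem Matrix.eq_zero_of_col_mul {m l k : Type} [Field k] {X : Matrix m Unit k} (hX : X ≠ 0)
    {r : Matrix Unit l k} (h : X * r = 0) : r = 0 := by
  by_contra hr
  apply hX
  obtain ⟨i, j, hij⟩ : ∃ i j, r i j ≠ 0 := by
    by_contra! h0
    exact hr (Matrix.ext h0)
  ext u v
  have h1 := congrFun (congrFun h u) j
  rw [Matrix.mul_apply] at h1
  simpa [hij] using h1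

theorem Matrix.eq_zero_of_mul_row {m l k : Type} [Field k] {B : Matrix Unit m k} (hB : B ≠ 0)
    {r : Matrix l Unit k} (h : r * B = 0) : r = 0 := by
  by_contra hr
  exact hB (Matrix.eq_zero_of_col_mul hr h)

namespace HeisGroup

variable {p : ℕ} [Fact p.Prime] {n m μ k : Type} [Fintype n] [DecidableEq n] [Fintype m]
  [DecidableEq m] [Fintype μ] [DecidableEq μ] [Field k] {W : BlockFrame n m k} {c : ZMod p →+* k}
  {Q : Matrix m μ k}

theorem blocks_of_fixed {T₁ : Matrix μ μ (ZMod p)} (hT₁ : Q * T₁.map c * Q.transpose = 1)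
    (ϑ : HeisGroup μ (ZMod p) →* Multiplicative (ZMod p)) {a : Matrix n n k}
    (ha : ∀ h, ϑ h = 1 → (rep W c Q h).1 * a = a * (rep W c Q h).1) :
    W.F₂ * (a * W.E₁) = 0 ∧ W.F₃ * (a * W.E₁) = 0 ∧ W.F₃ * (a * W.E₂) = 0 ∧
      W.F₁ * (a * W.E₁) = W.F₃ * (a * W.E₃) ∧
      ∀ y : Matrix μ μ (ZMod p), W.F₁ * (a * W.E₁) * (Q * y.map c * Q.transpose) =
        Q * y.map c * Q.transpose * (W.F₃ * (a * W.E₃)) := by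
  have h1 : ∀ y : Matrix μ μ (ZMod p), W.heis 0 0 (Q * y.map c * Q.transpose) * a =
      a * W.heis 0 0 (Q * y.map c * Q.transpose) := fun y => by
    have h2 := ha ⟨0, 0, y⟩ (hom_eq_one ϑ y)
    simpa [rep_val] using h2
  have h2 := h1 T₁
  rw [hT₁] at h2
  obtain ⟨h21, h31, h32, h3⟩ := BlockFrame.blocks_of_commute_corner isUnit_one h2
  rw [Matrix.one_mul, Matrix.mul_one] at h3
  refine ⟨h21, h31, h32, h3.symm, fun y => ?_⟩
  have h4 := (W.blocks_of_commute (h1 y)).2.2.1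
  simpa using h4.symm

theorem exists_x_ne_zero (hμ : 1 < Fintype.card μ)
    (ϑ : HeisGroup μ (ZMod p) →* Multiplicative (ZMod p)) :
    ∃ x : Matrix μ Unit (ZMod p), x ≠ 0 ∧ ϑ ⟨x, 0, 0⟩ = 1 := by
  obtain ⟨x, x', hne, h⟩ := Fintype.exists_ne_map_eq_of_card_lt
    (fun x : μ → ZMod p => ϑ ⟨Matrix.of fun i _ => x i, 0, 0⟩) (by
      rw [Fintype.card_multiplicative, Fintype.card_fun, ZMod.card]
      exact lt_self_pow₀ (Fact.out : p.Prime).one_lt hμ)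
  refine ⟨Matrix.of fun i _ => x i - x' i, fun h0 => hne (funext fun i => ?_), ?_⟩
  · exact sub_eq_zero.mp (congrFun (congrFun h0 i) ())
  · rw [← mul_inv_eq_one, ← map_inv, ← map_mul, inv_def, mul_def] at h
    rw [← h]
    congr 2
    · ext i j
      exact sub_eq_add_neg _ _
    · simp
    · simp

theorem exists_b_ne_zero (hμ : 1 < Fintype.card μ)
    (ϑ : HeisGroup μ (ZMod p) →* Multiplicative (ZMod p)) :
    ∃ b : Matrix Unit μ (ZMod p), b ≠ 0 ∧ ϑ ⟨0, b, 0⟩ = 1 := by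
  obtain ⟨x, x', hne, h⟩ := Fintype.exists_ne_map_eq_of_card_lt
    (fun x : μ → ZMod p => ϑ ⟨0, Matrix.of fun _ i => x i, 0⟩) (by
      rw [Fintype.card_multiplicative, Fintype.card_fun, ZMod.card]
      exact lt_self_pow₀ (Fact.out : p.Prime).one_lt hμ)
  refine ⟨Matrix.of fun _ i => x i - x' i, fun h0 => hne (funext fun i => ?_), ?_⟩
  · exact sub_eq_zero.mp (congrFun (congrFun h0 ()) i)
  · rw [← mul_inv_eq_one, ← map_inv, ← map_mul, inv_def, mul_def] at h
    rw [← h]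
    congr 2
    · simp
    · ext i j
      exact sub_eq_add_neg _ _
    · simp

theorem conjNormVanish_of_two_le [CharP k p] (hμ : 1 < Fintype.card μ)
    {T₁ : Matrix μ μ (ZMod p)} (hT₁ : Q * T₁.map c * Q.transpose = 1)
    (hQ : ∀ x : Matrix μ Unit (ZMod p), x ≠ 0 → Q * x.map c ≠ 0) (κ : Matrix m m k →+ k) :
    ConjNormVanish p (rep W c Q) (κ.comp W.corner) := by
  intro ϑ g a _ ha
  obtain ⟨h21, h31, h32, h11, hY⟩ := blocks_of_fixed hT₁ ϑ ha
  obtain ⟨x₀, hx₀, hϑx⟩ := exists_x_ne_zero hμ ϑ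
  obtain ⟨b₀, hb₀, hϑb⟩ := exists_b_ne_zero hμ ϑ
  have hX₀ := hQ x₀ hx₀
  have hB₀ : b₀.map c * Q.transpose ≠ 0 := fun h0 => by
    refine hQ b₀.transpose (fun h => hb₀ (Matrix.transpose_eq_zero.mp h)) ?_
    rw [← Matrix.transpose_eq_zero, Matrix.transpose_mul, ← Matrix.transpose_map,
      Matrix.transpose_transpose]
    exact h0
  have hcx := ha _ hϑx
  rw [rep_val] at hcx
  have hcb := ha _ hϑb
  rw [rep_val] at hcb
  have hx := (W.blocks_of_commute hcx).2.2.1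
  have hb := W.blocks_of_commute hcb
  have h23 : W.F₂ * (a * W.E₃) = 0 := Matrix.eq_zero_of_col_mul hX₀ (by simpa using hx)
  have h12 : W.F₁ * (a * W.E₂) = 0 := by
    refine Matrix.eq_zero_of_mul_row hB₀ ?_
    have := hb.2.2.1
    simpa using this.symm
  have h22 := hb.2.2.2
  rw [h21, Matrix.zero_mul, add_zero] at h22
  have hX : ∀ x : Matrix μ Unit (ZMod p), W.F₁ * (a * W.E₁) * (Q * x.map c) =
      Q * x.map c * (W.F₂ * (a * W.E₂)) := fun x => by
    rw [← sub_eq_zero]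
    refine Matrix.eq_zero_of_mul_row hB₀ ?_
    rw [Matrix.sub_mul, sub_eq_zero, Matrix.mul_assoc _ (W.F₂ * _), ← h22, Matrix.mul_assoc,
      ← Matrix.mul_assoc _ _ (W.F₃ * _)]
    have h1 := hY (x * b₀)
    simp only [Matrix.map_mul, Matrix.mul_assoc] at h1 ⊢
    exact h1
  have hterm : ∀ i : ℕ, W.corner ((rep W c Q (g ^ i)).1 * a * (rep W c Q (g ^ i)⁻¹).1) =
      W.corner a := fun i => by
    rw [rep_val, rep_inv_val, W.corner_conj _ _ _ a h21 h31 h32 (hX _) (hY _), h12, h23]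
    simp
  rw [AddMonoidHom.comp_apply, map_sum, Finset.sum_congr rfl fun i _ => hterm i, Finset.sum_const,
    Finset.card_range, ← Nat.cast_smul_eq_nsmul k, CharP.cast_eq_zero, zero_smul, map_zero]

end HeisGroup

namespace HeisGroup

/-- The functional `a ↦ tr (w a)`. -/
def traceMul {m k : Type} [Fintype m] [Field k] (w : Matrix m m k) : Matrix m m k →+ k :=
  (Matrix.traceAddMonoidHom m k).comp (AddMonoidHom.mulLeft w)

theorem traceMul_apply {m k : Type} [Fintype m] [Field k] (w a : Matrix m m k) :
    traceMul w a = (w * a).trace := rfl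

section Two

variable {n m μ k : Type} [Fintype n] [DecidableEq n] [Fintype m]
  [DecidableEq m] [Fintype μ] [Field k] {W : BlockFrame n m k} {c : ZMod 2 →+* k}
  {Q : Matrix m μ k} {T₁ T₂ : Matrix μ μ (ZMod 2)}

theorem mem_closure_corner_pair (hT₁ : Q * T₁.map c * Q.transpose = 1) {w : Matrix m m k}
    (hw : w * (Q * T₂.map c * Q.transpose) = Q * T₂.map c * Q.transpose * w)
    {g : HeisGroup μ (ZMod 2)}
    (hg : g ∈ Subgroup.closure ({⟨0, 0, T₁⟩, ⟨0, 0, T₂⟩} : Set (HeisGroup μ (ZMod 2)))) :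
    g.x = 0 ∧ g.b = 0 ∧ w * (Q * g.y.map c * Q.transpose) = Q * g.y.map c * Q.transpose * w := by
  induction hg using Subgroup.closure_induction with
  | mem g hg =>
    rcases hg with rfl | rfl
    · simp [hT₁]
    · simp [hw]
  | one => simp [one_def]
  | mul g h _ _ hg hh =>
    obtain ⟨hx, hb, hz⟩ := hg
    obtain ⟨hx', hb', hz'⟩ := hh
    refine ⟨by simp [mul_def, hx, hx'], by simp [mul_def, hb, hb'], ?_⟩
    simp only [mul_def, hx, Matrix.zero_mul, add_zero, Matrix.map_add _ (map_add c), Matrix.mul_add,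
      Matrix.add_mul, hz, hz']
  | inv g _ hg =>
    obtain ⟨hx, hb, hz⟩ := hg
    refine ⟨by simp [inv_def, hx], by simp [inv_def, hb], ?_⟩
    simp only [inv_def, hx, Matrix.zero_mul, Matrix.map_sub _ (map_sub c), Matrix.mul_sub,
      Matrix.sub_mul, hz, Matrix.map_zero _ (map_zero c), Matrix.mul_zero]

theorem conjNormVanish_closure_corner_pair [CharP k 2] {M : Subgroup (HeisGroup μ (ZMod 2))}
    (hM : M = Subgroup.closure {⟨0, 0, T₁⟩, ⟨0, 0, T₂⟩})
    (hT₁ : Q * T₁.map c * Q.transpose = 1)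
    (hu : IsUnit (Q * T₂.map c * Q.transpose)) (hu' : IsUnit (1 + Q * T₂.map c * Q.transpose))
    {w : Matrix m m k}
    (hw : w * (Q * T₂.map c * Q.transpose) = Q * T₂.map c * Q.transpose * w) :
    ConjNormVanish 2 ((rep W c Q).comp M.subtype) ((traceMul w).comp W.corner) := by
  intro ϑ g a _ ha
  set y := Q * T₂.map c * Q.transpose with hy
  have hm₁ : (⟨0, 0, T₁⟩ : HeisGroup μ (ZMod 2)) ∈ M := hM ▸ Subgroup.subset_closure (by simp)
  have hm₂ : (⟨0, 0, T₂⟩ : HeisGroup μ (ZMod 2)) ∈ M := hM ▸ Subgroup.subset_closure (by simp)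
  have hg := hM.le g.2
  obtain ⟨gx, gb, gw⟩ := mem_closure_corner_pair hT₁ hw hg
  obtain ⟨-, -, gy⟩ := mem_closure_corner_pair (w := y) hT₁ rfl hg
  set z := Q * g.1.y.map c * Q.transpose with hz
  obtain ⟨y₀, hm₀, hϑ₀, hy₀⟩ : ∃ (y₀ : Matrix μ μ (ZMod 2)) (h : (⟨0, 0, y₀⟩ : HeisGroup μ (ZMod 2)) ∈ M),
      ϑ ⟨⟨0, 0, y₀⟩, h⟩ = 1 ∧ (Q * y₀.map c * Q.transpose = 1 ∨
        Q * y₀.map c * Q.transpose = y ∨ Q * y₀.map c * Q.transpose = 1 + y) := by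
    by_cases h1 : ϑ ⟨_, hm₁⟩ = 1
    · exact ⟨T₁, hm₁, h1, Or.inl hT₁⟩
    by_cases h2 : ϑ ⟨_, hm₂⟩ = 1
    · exact ⟨T₂, hm₂, h2, Or.inr (Or.inl rfl)⟩
    have hmul : (⟨0, 0, T₁⟩ * ⟨0, 0, T₂⟩ : HeisGroup μ (ZMod 2)) = ⟨0, 0, T₁ + T₂⟩ := by
      simp [mul_def]
    have h3 : ϑ (⟨_, hm₁⟩ * ⟨_, hm₂⟩) = 1 := by
      rw [map_mul]
      have : ∀ u v : Multiplicative (ZMod 2), u ≠ 1 → v ≠ 1 → u * v = 1 := by decide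
      exact this _ _ h1 h2
    refine ⟨T₁ + T₂, hmul ▸ mul_mem hm₁ hm₂, ?_, Or.inr (Or.inr ?_)⟩
    · rw [← h3]
      congr 1
      exact Subtype.ext hmul.symm
    · rw [Matrix.map_add _ (map_add c), Matrix.mul_add, Matrix.add_mul, hT₁]
  set u := Q * y₀.map c * Q.transpose with hudef
  have huu : IsUnit u := by
    rcases hy₀ with h | h | h <;> rw [h]
    exacts [isUnit_one, hu, hu']
  have huw : w * u = u * w := by
    rcases hy₀ with h | h | h <;> rw [h]
    exacts [by simp, hw, by rw [Matrix.mul_add, Matrix.add_mul, hw, Matrix.mul_one, Matrix.one_mul]]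
  have huz : u * z = z * u := by
    rcases hy₀ with h | h | h <;> rw [h]
    exacts [by simp, gy, by rw [Matrix.mul_add, Matrix.add_mul, gy, Matrix.mul_one, Matrix.one_mul]]
  have h1 : W.heis 0 0 u * a = a * W.heis 0 0 u := by
    have h2 := ha _ hϑ₀
    simpa [rep_val] using h2
  obtain ⟨-, h31, -, h3⟩ := BlockFrame.blocks_of_commute_corner huu h1
  have hconj : W.corner ((rep W c Q g).1 * a * (rep W c Q g⁻¹).1) =
      W.corner a + (z * (W.F₃ * (a * W.E₃)) - W.F₁ * (a * W.E₁) * z) := by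
    rw [← W.corner_conj_of_zero z a h31, rep_inv_val, rep_val, gx, gb, ← hz]
    simp
  have hsum : ∑ i ∈ Finset.range 2, ((rep W c Q).comp M.subtype (g ^ i)).1 * a *
      ((rep W c Q).comp M.subtype (g ^ i)⁻¹).1 =
      a + (rep W c Q g).1 * a * (rep W c Q g⁻¹).1 := by
    simp [Finset.sum_range_succ]
  obtain ⟨u', hu'⟩ := isUnit_iff_exists.mp huu
  have htr : (w * (W.F₁ * (a * W.E₁) * z)).trace = (w * (z * (W.F₃ * (a * W.E₃)))).trace := by
    have e1 : w * (W.F₁ * (a * W.E₁) * z) = w * (u * (W.F₃ * (a * W.E₃)) * (u' * z)) := by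
      rw [h3, Matrix.mul_assoc (W.F₁ * (a * W.E₁)) u, ← Matrix.mul_assoc u, hu'.1, Matrix.one_mul]
    rw [e1, ← Matrix.mul_assoc, Matrix.trace_mul_comm]
    have e2 : u' * z * (w * (u * (W.F₃ * (a * W.E₃)))) = w * (z * (W.F₃ * (a * W.E₃))) := by
      rw [← Matrix.mul_assoc w, huw, Matrix.mul_assoc u', ← Matrix.mul_assoc z,
        ← Matrix.mul_assoc z, ← huz, Matrix.mul_assoc u, Matrix.mul_assoc u, ← Matrix.mul_assoc u',
        hu'.2, Matrix.one_mul, ← gw, Matrix.mul_assoc]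
    rw [e2]
  have htwo : (2 : k) = 0 := CharTwo.two_eq_zero
  rw [hsum, AddMonoidHom.comp_apply, map_add, hconj, traceMul_apply, Matrix.mul_add, Matrix.mul_add,
    Matrix.mul_sub, Matrix.trace_add, Matrix.trace_add, Matrix.trace_sub, htr]
  linear_combination (w * W.corner a).trace * htwo

end Two

end HeisGroup

namespace BlockFrame

variable {n m S : Type} [Fintype n] [DecidableEq n] [Fintype m] [DecidableEq m] [CommRing S]
  (W : BlockFrame n m S)

theorem corner_conj_of_b_eq_zero (X : Matrix m Unit S) (Y : Matrix m m S) (a : Matrix n n S)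
    (h₂₁ : W.F₂ * (a * W.E₁) = 0) (h₃₁ : W.F₃ * (a * W.E₁) = 0) :
    W.corner (W.heis X 0 Y * a * W.heis (-X) 0 (-Y)) =
      W.corner a + (X * (W.F₂ * (a * W.E₃)) + Y * (W.F₃ * (a * W.E₃)) -
        W.F₁ * (a * W.E₁) * Y) := by
  have h3 : W.F₂ * (a * (W.E₁ * Y)) = 0 := by
    rw [← Matrix.mul_assoc a, ← Matrix.mul_assoc W.F₂, h₂₁, Matrix.zero_mul]
  have h4 : W.F₃ * (a * (W.E₁ * Y)) = 0 := by
    rw [← Matrix.mul_assoc a, ← Matrix.mul_assoc W.F₃, h₃₁, Matrix.zero_mul]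
  simp only [corner_apply, heis, Matrix.mul_assoc, Matrix.add_mul, Matrix.mul_add, Matrix.one_mul,
    Matrix.mul_one, Matrix.zero_mul, Matrix.mul_zero, add_zero, F₁E₁_assoc, F₂E₃, F₃E₃,
    Matrix.neg_mul, Matrix.mul_neg, h3, h4]
  abel

theorem blocks_of_commute_of_b_eq_zero {X : Matrix m Unit S} {Y : Matrix m m S} {a : Matrix n n S}
    (h : W.heis X 0 Y * a = a * W.heis X 0 Y) : W.F₃ * (a * W.E₁) * X = 0 := by
  have key : W.F₃ * (W.heis X 0 Y * (a * W.E₂)) = W.F₃ * (a * (W.heis X 0 Y * W.E₂)) := by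
    rw [← Matrix.mul_assoc _ a, h, Matrix.mul_assoc]
  simp only [heis, Matrix.add_mul, Matrix.mul_add, Matrix.one_mul, Matrix.mul_assoc] at key ⊢
  simpa using key.symm

end BlockFrame

theorem Matrix.mul_comm_unit {k : Type} [CommRing k] (A B : Matrix Unit Unit k) :
    A * B = B * A := by
  ext i j
  simp [Matrix.mul_apply, mul_comm]

theorem sum_range_affine_eq_zero {p : ℕ} [Fact p.Prime] (hp : p ≠ 2) {k V : Type} [Field k]
    [CharP k p] [AddCommGroup V] [Module k V] (u v : V) :
    ∑ i ∈ Finset.range p, (u + i • v) = 0 := by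
  have h2 : (2 : k) ≠ 0 := by
    intro h
    have h1 : ((2 : ℕ) : k) = 0 := by exact_mod_cast h
    rw [CharP.cast_eq_zero_iff k p] at h1
    exact hp ((Nat.prime_dvd_prime_iff_eq Fact.out Nat.prime_two).mp h1)
  have h3 : ((∑ i ∈ Finset.range p, i : ℕ) : k) = 0 := by
    refine (mul_eq_zero_iff_right h2).mp ?_
    have h4 := congrArg (Nat.cast : ℕ → k) (Finset.sum_range_id_mul_two p)
    rw [Nat.cast_mul, Nat.cast_mul, CharP.cast_eq_zero k p, zero_mul] at h4
    exact_mod_cast h4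
  rw [Finset.sum_add_distrib, Finset.sum_const, Finset.card_range, ← Finset.sum_smul,
    ← Nat.cast_smul_eq_nsmul k p, ← Nat.cast_smul_eq_nsmul k (∑ i ∈ Finset.range p, i),
    CharP.cast_eq_zero k p, h3, zero_smul,
    zero_smul, add_zero]

namespace HeisGroup

variable {p : ℕ} [Fact p.Prime] {n k : Type} [Fintype n] [DecidableEq n] [Field k] [CharP k p]
  {W : BlockFrame n Unit k} {c : ZMod p →+* k}

theorem conjNormVanish_of_ne_two (hp : p ≠ 2) (κ : Matrix Unit Unit k →+ k) :
    ConjNormVanish p (rep W c (1 : Matrix Unit Unit k)) (κ.comp W.corner) := by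
  intro ϑ g a _ ha
  obtain ⟨h21, h31, h32, h11, -⟩ := blocks_of_fixed (T₁ := 1) (by
    rw [Matrix.map_one c (map_zero c) (map_one c)]
    simp) ϑ ha
  obtain ⟨⟨x, b⟩, ⟨x', b'⟩, hne, h⟩ := Fintype.exists_ne_map_eq_of_card_lt
    (fun t : ZMod p × ZMod p => ϑ ⟨Matrix.of fun _ _ => t.1, Matrix.of fun _ _ => t.2, 0⟩) (by
      rw [Fintype.card_multiplicative, Fintype.card_prod, ZMod.card]
      exact lt_mul_self (Fact.out : p.Prime).one_lt)
  rw [← mul_inv_eq_one, ← map_inv, ← map_mul] at h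
  have hcomm := ha _ h
  rw [rep_val] at hcomm
  obtain ⟨-, h2, -, h4⟩ := W.blocks_of_commute hcomm
  simp only [h32, h21, Matrix.mul_zero, Matrix.zero_mul, add_zero, mul_def, inv_def] at h2 h4
  have h22 : W.F₁ * (a * W.E₁) = W.F₂ * (a * W.E₂) := by
    rw [← sub_eq_zero]
    by_cases hx : x = x'
    · have hb : b ≠ b' := fun hb => hne (by rw [hx, hb])
      rw [← h11, Matrix.mul_comm_unit, ← sub_eq_zero, ← Matrix.sub_mul] at h4
      refine Matrix.eq_zero_of_mul_row (fun h0 => hb ?_) h4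
      have := congrFun (congrFun h0 ()) ()
      exact c.injective (by simpa [← sub_eq_add_neg, sub_eq_zero] using this)
    · rw [Matrix.mul_comm_unit, ← sub_eq_zero, ← Matrix.sub_mul] at h2
      rw [← neg_eq_zero, neg_sub]
      refine Matrix.eq_zero_of_mul_row (fun h0 => hx ?_) h2
      have := congrFun (congrFun h0 ()) ()
      exact c.injective (by simpa [← sub_eq_add_neg, sub_eq_zero] using this)
  have hterm : ∀ i : ℕ, W.corner ((rep W c 1 (g ^ i)).1 * a * (rep W c 1 (g ^ i)⁻¹).1) =
      W.corner a + i • (g.x.map c * (W.F₂ * (a * W.E₃)) - W.F₁ * (a * W.E₂) * g.b.map c) :=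
      fun i => by
    rw [rep_val, rep_inv_val, W.corner_conj _ _ _ a h21 h31 h32
      (by rw [Matrix.mul_comm_unit, h22]) (by rw [Matrix.mul_comm_unit, h11]), x_pow, b_pow]
    have h1 : ∀ M : Matrix Unit Unit (ZMod p), (i • M).map c = i • M.map c := fun M => by
      ext u v
      exact map_nsmul c i (M u v)
    rw [h1, h1, Matrix.one_mul, Matrix.transpose_one, Matrix.mul_one, smul_sub, Matrix.smul_mul,
      Matrix.mul_smul]
    abel
  rw [AddMonoidHom.comp_apply, map_sum, Finset.sum_congr rfl fun i _ => hterm i,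
    sum_range_affine_eq_zero (k := k) hp, map_zero]

theorem conjNormVanish_of_b_eq_zero (hp : p ≠ 2) {M : Subgroup (HeisGroup Unit (ZMod p))}
    (hM : ∀ g, g ∈ M ↔ g.b = 0) (κ : Matrix Unit Unit k →+ k) :
    ConjNormVanish p ((rep W c (1 : Matrix Unit Unit k)).comp M.subtype) (κ.comp W.corner) := by
  intro ϑ g a _ ha
  obtain ⟨⟨x, y⟩, ⟨x', y'⟩, hne, h⟩ := Fintype.exists_ne_map_eq_of_card_lt
    (fun t : ZMod p × ZMod p => ϑ ⟨⟨Matrix.of fun _ _ => t.1, 0, Matrix.of fun _ _ => t.2⟩,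
      (hM _).mpr rfl⟩) (by
      rw [Fintype.card_multiplicative, Fintype.card_prod, ZMod.card]
      exact lt_mul_self (Fact.out : p.Prime).one_lt)
  rw [← mul_inv_eq_one, ← map_inv, ← map_mul] at h
  have hcomm := ha _ h
  simp only [MonoidHom.comp_apply, Subgroup.subtype_apply, Subgroup.coe_mul, Subgroup.coe_inv] at hcomm
  rw [rep_val] at hcomm
  simp only [mul_def, inv_def, Matrix.mul_zero, neg_zero, add_zero, zero_sub,
    Matrix.map_zero _ (map_zero c), Matrix.one_mul, Matrix.transpose_one, Matrix.mul_one] at hcomm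
  obtain ⟨h1, -, -, h4⟩ := W.blocks_of_commute hcomm
  have h5 := W.blocks_of_commute_of_b_eq_zero hcomm
  rw [Matrix.zero_mul, Matrix.mul_zero, zero_add] at h4
  obtain ⟨h21, h31⟩ : W.F₂ * (a * W.E₁) = 0 ∧ W.F₃ * (a * W.E₁) = 0 := by
    by_cases hx : x = x'
    · have hy : y ≠ y' := fun hy => hne (by rw [hx, hy])
      have hy0 : (Matrix.of (fun _ _ => y) + -Matrix.of (fun _ _ => y') : Matrix Unit Unit (ZMod p)).map c ≠ 0 := fun h0 => hy (by
        have := congrFun (congrFun h0 ()) ()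
        exact c.injective (by simpa [← sub_eq_add_neg, sub_eq_zero] using this))
      have h21 := Matrix.eq_zero_of_mul_row hy0 h4.symm
      rw [h21, Matrix.mul_zero, zero_add] at h1
      exact ⟨h21, Matrix.eq_zero_of_col_mul hy0 h1⟩
    · have hx0 : (Matrix.of (fun _ _ => x) + -Matrix.of (fun _ _ => x') : Matrix Unit Unit (ZMod p)).map c ≠ 0 := fun h0 => hx (by
        have := congrFun (congrFun h0 ()) ()
        exact c.injective (by simpa [← sub_eq_add_neg, sub_eq_zero] using this))
      have h31 := Matrix.eq_zero_of_mul_row hx0 h5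
      rw [h31, Matrix.mul_zero, add_zero] at h1
      exact ⟨Matrix.eq_zero_of_col_mul hx0 h1, h31⟩
  have hterm : ∀ i : ℕ, W.corner (((rep W c 1).comp M.subtype (g ^ i)).1 * a *
      ((rep W c 1).comp M.subtype (g ^ i)⁻¹).1) =
      W.corner a + i • (g.1.x.map c * (W.F₂ * (a * W.E₃)) + g.1.y.map c * (W.F₃ * (a * W.E₃)) -
        W.F₁ * (a * W.E₁) * g.1.y.map c) := fun i => by
    have hgi : (g.1 ^ i) = ⟨i • g.1.x, 0, i • g.1.y⟩ := by
      rw [← mk_pow_of_b_eq_zero, ← (hM _).mp g.2]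
    have h1 : ∀ M : Matrix Unit Unit (ZMod p), (i • M).map c = i • M.map c := fun M => by
      ext u v
      exact map_nsmul c i (M u v)
    simp only [MonoidHom.comp_apply, Subgroup.subtype_apply, Subgroup.coe_inv, Subgroup.coe_pow, hgi]
    rw [rep_val, rep_inv_val]
    simp only [Matrix.map_zero _ (map_zero c), Matrix.mul_zero, neg_zero, zero_sub, h1,
      Matrix.one_mul, Matrix.transpose_one, Matrix.mul_one]
    rw [W.corner_conj_of_b_eq_zero _ _ _ h21 h31, smul_sub, smul_add, Matrix.smul_mul,
      Matrix.smul_mul, Matrix.mul_smul]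
  rw [AddMonoidHom.comp_apply, map_sum, Finset.sum_congr rfl fun i _ => hterm i,
    sum_range_affine_eq_zero (k := k) hp, map_zero]

end HeisGroup

namespace IsWittExt

variable {p : ℕ} {k R : Type} [Field k] [CommRing R] {π : R →+* k} {ε : k →+ R} {n : Type}

theorem exists_eq_add_map_eps (h : IsWittExt p π ε) {S T : Matrix n n R}
    (hST : S.map π = T.map π) : ∃ c : Matrix n n k, S = T + c.map ε := by
  have h1 : ∀ i j, ∃ a, ε a = S i j - T i j := fun i j => h.red_eq_zero _ (by
    rw [map_sub, sub_eq_zero]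
    exact congrFun (congrFun hST i) j)
  choose f hf using h1
  refine ⟨Matrix.of f, ?_⟩
  ext i j
  simp [hf]

theorem map_eps_injective (h : IsWittExt p π ε) {A B : Matrix n n k} (hAB : A.map ε = B.map ε) :
    A = B := by
  ext i j
  exact h.inj (congrFun (congrFun hAB i) j)

variable [Fact p.Prime] [CharP k p]

theorem nsmul_eq_map_eps (h : IsWittExt p π ε) (M : Matrix n n R) :
    p • M = ((M.map π).map (frobenius k p)).map ε := by
  ext i j
  rw [Matrix.smul_apply, nsmul_eq_mul, h.natCast, mul_comm, h.mul_eps, mul_one]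
  rfl

variable [Fintype n] [DecidableEq n]

/-- Multiplication of matrices written as a lift plus a perturbation in the ideal `ε k`. -/
theorem add_map_eps_mul_add_map_eps (h : IsWittExt p π ε) (M N : Matrix n n R)
    (A B : Matrix n n k) : (M + A.map ε) * (N + B.map ε) =
      M * N + ((M.map π).map (frobenius k p) * B + A * (N.map π).map (frobenius k p)).map ε := by
  rw [add_mul, mul_add, mul_add, h.map_eps_mul_map_eps (Fact.out : p.Prime).ne_zero,
    h.mul_map_eps, h.map_eps_mul, add_zero, Matrix.map_add _ (map_add ε), add_assoc]

end IsWittExt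

namespace BlockFrame

variable {n m S : Type} [Fintype n] [DecidableEq n] [Fintype m] [DecidableEq m] [CommRing S]
  (W : BlockFrame n m S)

theorem heis_nsmul (Y : Matrix m m S) (j : ℕ) :
    W.heis 0 0 (j • Y) = 1 + j • (W.heis 0 0 Y - 1) := by
  simp only [heis, Matrix.zero_mul, Matrix.mul_zero, add_zero, Matrix.smul_mul, Matrix.mul_smul,
    add_sub_cancel_left]

theorem corner_heis_sub_one (Y : Matrix m m S) : W.corner (W.heis 0 0 Y - 1) = Y := by
  simp [corner_apply, heis, Matrix.mul_assoc]

theorem corner_heis_mul (Y : Matrix m m S) (a : Matrix n n S) :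
    W.corner (W.heis 0 0 Y * a) = W.corner a + Y * (W.F₃ * (a * W.E₃)) := by
  simp [corner_apply, heis, Matrix.add_mul, Matrix.mul_add, Matrix.mul_assoc]

theorem corner_mul_heis (Y : Matrix m m S) (a : Matrix n n S) :
    W.corner (a * W.heis 0 0 Y) = W.corner a + W.F₁ * (a * W.E₁) * Y := by
  simp [corner_apply, heis, Matrix.add_mul, Matrix.mul_add, Matrix.mul_assoc]

section

variable {p : ℕ} [Fact p.Prime] {k R : Type} [Field k] [CharP k p] [CommRing R] {π : R →+* k}
  {ε : k →+ R} (e : m ⊕ Unit ⊕ m ↪ n)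

theorem map_map_heis (X : Matrix m Unit R) (B : Matrix Unit m R) (Y : Matrix m m R) :
    (((ofEmbedding R e).heis X B Y).map π).map (frobenius k p) =
      (ofEmbedding k e).heis ((X.map π).map (frobenius k p)) ((B.map π).map (frobenius k p))
        ((Y.map π).map (frobenius k p)) := by
  rw [map_heis_ofEmbedding, map_heis_ofEmbedding]

theorem heis_nsmul_eq_map_eps (h : IsWittExt p π ε) (Y : Matrix m m R) :
    (ofEmbedding R e).heis 0 0 (p • Y) =
      1 + ((ofEmbedding k e).heis 0 0 ((Y.map π).map (frobenius k p)) - 1).map ε := by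
  rw [heis_nsmul, h.nsmul_eq_map_eps, Matrix.map_sub _ (map_sub π),
    Matrix.map_sub _ (map_sub (frobenius k p)), map_map_heis]
  simp [Matrix.map_zero, Matrix.map_one]

end

/-- Two commuting lifts of corner transvections in characteristic two: the corners of their
squares cannot both be trivial. -/
theorem trace_eq_zero_of_commuting_corner_lifts {k R : Type} [Field k] [CharP k 2] [CommRing R]
    {π : R →+* k} {ε : k →+ R} (h : IsWittExt 2 π ε) (e : m ⊕ Unit ⊕ m ↪ n) (y₀ : Matrix m m k)
    {S T : Matrix n n R} {v w : Matrix n n k} (hS : S.map π = (ofEmbedding k e).heis 0 0 1)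
    (hT : T.map π = (ofEmbedding k e).heis 0 0 y₀) (hST : S * T = T * S)
    (hv : S ^ 2 = 1 + v.map ε) (hw : T ^ 2 = 1 + w.map ε) {y z : Matrix m m k}
    (hy : y = y₀.map (frobenius k 2)) (hz : z * y = y * z)
    (h₁ : (z * (ofEmbedding k e).corner w).trace = 0)
    (h₂ : (z * (y * y) * (ofEmbedding k e).corner v).trace = 0) :
    (z * (y - y * y)).trace = 0 := by
  obtain ⟨Y, rfl⟩ : ∃ Y : Matrix m m R, Y.map π = y₀ := by
    choose f hf using h.surj
    exact ⟨y₀.map f, by ext i j; simp [hf]⟩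
  have h1 : (1 : Matrix m m R).map π = 1 := Matrix.map_one π (map_zero π) (map_one π)
  have h1' : (1 : Matrix m m k).map (frobenius k 2) = 1 :=
    Matrix.map_one _ (map_zero _) (map_one _)
  have hm : ∀ Y : Matrix m m R, (((ofEmbedding R e).heis 0 0 Y).map π).map (frobenius k 2) =
      (ofEmbedding k e).heis 0 0 ((Y.map π).map (frobenius k 2)) := fun Y => by
    rw [map_map_heis]
    simp [Matrix.map_zero]
  obtain ⟨a, rfl⟩ := h.exists_eq_add_map_eps (S := S) (T := (ofEmbedding R e).heis 0 0 1) (by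
    rw [hS, map_heis_ofEmbedding, h1]
    simp [Matrix.map_zero])
  obtain ⟨b, rfl⟩ := h.exists_eq_add_map_eps (S := T) (T := (ofEmbedding R e).heis 0 0 Y) (by
    rw [hT, map_heis_ofEmbedding]
    simp [Matrix.map_zero])
  set W := ofEmbedding k e
  rw [pow_two, h.add_map_eps_mul_add_map_eps, heis_mul, hm, add_zero, add_zero, Matrix.zero_mul,
    add_zero, ← two_nsmul, heis_nsmul_eq_map_eps e h, add_assoc, add_right_inj,
    ← Matrix.map_add _ (map_add ε)] at hv hw
  rw [h.add_map_eps_mul_add_map_eps, h.add_map_eps_mul_add_map_eps, heis_mul, heis_mul, hm, hm,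
    Matrix.zero_mul, add_zero, add_comm Y, add_right_inj] at hST
  have hv' := h.map_eps_injective hv
  have hw' := h.map_eps_injective hw
  have hST' := congrArg W.corner (h.map_eps_injective hST)
  rw [h1, h1', ← hy] at *
  simp only [map_add, corner_heis_mul, corner_mul_heis, Matrix.mul_one, Matrix.one_mul] at hST'
  rw [← hv', map_add, map_add, corner_heis_mul, corner_mul_heis, corner_heis_sub_one] at h₂
  rw [← hw', map_add, map_add, corner_heis_mul, corner_mul_heis, corner_heis_sub_one] at h₁
  simp only [Matrix.one_mul, Matrix.mul_one] at h₂
  generalize W.F₁ * (a * W.E₁) = a₁ at *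
  generalize W.F₃ * (a * W.E₃) = a₃ at *
  generalize W.F₁ * (b * W.E₁) = b₁ at *
  generalize W.F₃ * (b * W.E₃) = b₃ at *
  generalize W.corner a = a₀ at *
  generalize W.corner b = b₀ at *
  have htwo : (2 : k) = 0 := CharTwo.two_eq_zero
  have hcomm : b₃ = y * a₃ + b₁ - a₁ * y := by
    rw [← sub_eq_zero] at hST' ⊢
    rw [← hST']
    abel
  rw [hcomm] at h₁
  have e₁ : (z * (b₁ * y)).trace = (z * (y * b₁)).trace := by
    rw [← Matrix.mul_assoc, Matrix.trace_mul_comm, ← Matrix.mul_assoc, ← hz, Matrix.mul_assoc]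
  have e₂ : (z * (y * (a₁ * y))).trace = (z * (y * (y * a₁))).trace := by
    rw [← Matrix.mul_assoc, ← Matrix.mul_assoc, Matrix.trace_mul_comm, ← Matrix.mul_assoc,
      ← Matrix.mul_assoc, ← hz, Matrix.mul_assoc, Matrix.mul_assoc]
  simp only [Matrix.mul_add, Matrix.mul_sub, Matrix.trace_add, Matrix.trace_sub,
    Matrix.mul_assoc, Matrix.mul_one, e₁, e₂] at h₁ h₂ ⊢
  linear_combination h₁ - h₂ - ((z * b₀).trace + (z * (y * b₁)).trace -
    (z * (y * (y * a₁))).trace - (z * (y * (y * a₀))).trace) * htwo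

/-- A commuting pair of lifts of elementary matrices in odd characteristic: the corner of the
`p`-th power of the second one. -/
theorem corner_eq_one_of_commuting_lifts {p : ℕ} [Fact p.Prime] (hp : p ≠ 2) {k R : Type} [Field k]
    [CharP k p] [CommRing R] {π : R →+* k} {ε : k →+ R} (h : IsWittExt p π ε)
    (e : Unit ⊕ Unit ⊕ Unit ↪ n) {S T : Matrix n n R} {w : Matrix n n k}
    (hS : S.map π = (ofEmbedding k e).heis 1 0 0) (hT : T.map π = (ofEmbedding k e).heis 0 0 1)
    (hST : S * T = T * S) (hw : T ^ p = 1 + w.map ε) :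
    (ofEmbedding k e).corner w = 1 := by
  have h1 : (1 : Matrix Unit Unit R).map π = 1 := Matrix.map_one π (map_zero π) (map_one π)
  have h1' : (1 : Matrix Unit Unit k).map (frobenius k p) = 1 :=
    Matrix.map_one _ (map_zero _) (map_one _)
  have hm₁ : (((ofEmbedding R e).heis 1 0 0).map π).map (frobenius k p) =
      (ofEmbedding k e).heis 1 0 0 := by
    rw [map_map_heis, h1, h1']
    simp [Matrix.map_zero]
  have hm₃ : ∀ j : ℕ, (((ofEmbedding R e).heis 0 0 (j • 1)).map π).map (frobenius k p) =
      (ofEmbedding k e).heis 0 0 (j • 1) := fun j => by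
    have hj : ((j • (1 : Matrix Unit Unit R)).map π).map (frobenius k p) = j • 1 := by
      ext u v
      simp only [Matrix.map_apply, Matrix.smul_apply, map_nsmul, Matrix.one_apply_eq, map_one]
    rw [map_map_heis, hj]
    simp [Matrix.map_zero]
  have hm₂ := hm₃ 1
  rw [one_smul, one_smul] at hm₂
  obtain ⟨a, rfl⟩ := h.exists_eq_add_map_eps (S := S) (T := (ofEmbedding R e).heis 1 0 0) (by
    rw [hS, map_heis_ofEmbedding, h1]
    simp [Matrix.map_zero])
  obtain ⟨b, rfl⟩ := h.exists_eq_add_map_eps (S := T) (T := (ofEmbedding R e).heis 0 0 1) (by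
    rw [hT, map_heis_ofEmbedding, h1]
    simp [Matrix.map_zero])
  set W := ofEmbedding k e
  have hb : W.F₃ * (b * W.E₁) = 0 := by
    rw [h.add_map_eps_mul_add_map_eps, h.add_map_eps_mul_add_map_eps, heis_mul, heis_mul, hm₁, hm₂,
      Matrix.zero_mul, Matrix.mul_zero, add_comm 0 (1 : Matrix Unit Unit R), add_right_inj] at hST
    have := congrArg (fun c => W.F₃ * (c * W.E₂)) (h.map_eps_injective hST)
    simp only [heis, Matrix.add_mul, Matrix.mul_add, Matrix.mul_assoc] at this
    simpa [add_comm] using this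
  have key : ∀ j : ℕ, ∃ c : Matrix n n k,
      ((ofEmbedding R e).heis 0 0 1 + b.map ε) ^ j =
        (ofEmbedding R e).heis 0 0 (j • 1) + c.map ε ∧
      W.F₁ * (c * W.E₁) = j • (W.F₁ * (b * W.E₁)) ∧
      W.corner c = ∑ i ∈ Finset.range j,
        (W.corner b + i • (W.F₁ * (b * W.E₁) + W.F₃ * (b * W.E₃))) := by
    intro j
    induction j with
    | zero => exact ⟨0, by simp [heis_zero, Matrix.map_zero], by simp, by simp⟩
    | succ j ih =>
      obtain ⟨c, hc, hc₁, hc₂⟩ := ih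
      refine ⟨W.heis 0 0 (j • 1) * b + c * W.heis 0 0 1, ?_, ?_, ?_⟩
      · rw [pow_succ, hc, h.add_map_eps_mul_add_map_eps, heis_mul, hm₂, hm₃, add_zero,
          Matrix.zero_mul, add_zero, ← succ_nsmul]
      · simp only [heis, Matrix.add_mul, Matrix.mul_add, Matrix.mul_assoc]
        simp [hc₁, hb, add_comm, add_mul]
      · rw [map_add, corner_heis_mul, corner_mul_heis, hc₁, hc₂, Finset.sum_range_succ]
        simp only [Matrix.mul_one, Matrix.smul_mul, Matrix.one_mul, smul_add]
        abel
  obtain ⟨c, hc, -, hc₂⟩ := key p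
  rw [sum_range_affine_eq_zero (k := k) hp] at hc₂
  rw [hc, heis_nsmul_eq_map_eps e h, h1, h1', add_assoc, add_right_inj,
    ← Matrix.map_add _ (map_add ε)] at hw
  rw [← h.map_eps_injective hw, map_add, corner_heis_sub_one, hc₂, add_zero]

end BlockFrame

namespace HeisGroup

theorem normal_closure_corner_pair {μ S : Type} [Fintype μ] [CommRing S] (y z : Matrix μ μ S) :
    (Subgroup.closure ({⟨0, 0, y⟩, ⟨0, 0, z⟩} : Set (HeisGroup μ S))).Normal := by
  have h : Subgroup.closure ({⟨0, 0, y⟩, ⟨0, 0, z⟩} : Set (HeisGroup μ S)) ≤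
      Subgroup.center _ := by
    rw [Subgroup.closure_le]
    rintro _ (rfl | rfl) <;> exact mem_center _
  refine ⟨fun n hn g => ?_⟩
  rw [Subgroup.mem_center_iff.mp (h hn) g, mul_inv_cancel_right]
  exact hn

theorem mk_pow_card {μ : Type} [Fintype μ] (p : ℕ) (x : Matrix μ Unit (ZMod p))
    (y : Matrix μ μ (ZMod p)) : (⟨x, 0, y⟩ : HeisGroup μ (ZMod p)) ^ p = 1 := by
  rw [mk_pow_of_b_eq_zero, one_def]
  congr 1 <;> ext i j <;> simp

theorem frobenius_comp_eq {p : ℕ} [Fact p.Prime] {k : Type} [Field k] [CharP k p]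
    (c : ZMod p →+* k) : (frobenius k p).comp c = c :=
  Subsingleton.elim _ _

theorem trace_eq_zero_of_liftable {k R : Type} [Field k] [CharP k 2] [CommRing R]
    {π : R →+* k} {ε : k →+ R} (h : IsWittExt 2 π ε) {n : Type} [Fintype n] [DecidableEq n]
    (hlift : ∀ (F : Type) [Field F],
      ∀ ρ : AbsGal F →* GL n k, IsOpen (ρ.ker : Set (AbsGal F)) →
        ∃ ρ₂ : AbsGal F →* GL n R,
          IsOpen (ρ₂.ker : Set (AbsGal F)) ∧
          (Matrix.GeneralLinearGroup.map π).comp ρ₂ = ρ)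
    {m μ : Type} [Fintype m] [DecidableEq m] [Fintype μ] [DecidableEq μ]
    (e : m ⊕ Unit ⊕ m ↪ n) (c : ZMod 2 →+* k) (hμ : 1 < Fintype.card μ) {P Q : Matrix m μ k}
    (hPQ : Q = P.map (frobenius k 2)) {T₁ T₂ : Matrix μ μ (ZMod 2)}
    (hT₁ : P * T₁.map c * P.transpose = 1)
    (hQ : ∀ x : Matrix μ Unit (ZMod 2), x ≠ 0 → Q * x.map c ≠ 0) {y z : Matrix m m k}
    (hy : y = Q * T₂.map c * Q.transpose) (hu : IsUnit y) (hu' : IsUnit (1 + y))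
    (hz : z * y = y * z) : (z * (y - y * y)).trace = 0 := by
  have hmap : ∀ T : Matrix μ μ (ZMod 2), (P * T.map c * P.transpose).map (frobenius k 2) =
      Q * T.map c * Q.transpose := fun T => by
    have h1 : (T.map c).map (frobenius k 2) = T.map c := by
      ext i j
      exact DFunLike.congr_fun (frobenius_comp_eq c) _
    rw [Matrix.map_mul, Matrix.map_mul, h1, hPQ, Matrix.transpose_map]
  have hT₁' : Q * T₁.map c * Q.transpose = 1 := by
    rw [← hmap, hT₁, Matrix.map_one _ (map_zero _) (map_one _)]
  obtain ⟨S, T, v, w, hS, hT, hST, hv, hw, hκ⟩ := exists_commuting_lifts h hlift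
    (isPGroup (μ := μ) 2) (rep (BlockFrame.ofEmbedding k e) c P) ⟨0, 0, T₁⟩ ⟨0, 0, T₂⟩
    (by simp [mul_def, add_comm]) (mk_pow_card 2 _ _) (mk_pow_card 2 _ _) _
    (normal_closure_corner_pair T₁ T₂) rfl
  rw [map_comp_rep e _ c P (frobenius_comp_eq c), ← hPQ] at hκ
  have hκ' : ∀ z' : Matrix m m k, z' * y = y * z' →
      (z' * (BlockFrame.ofEmbedding k e).corner v).trace = 0 ∧
      (z' * (BlockFrame.ofEmbedding k e).corner w).trace = 0 := fun z' hz' => by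
    have h1 := hκ ((traceMul z').comp (BlockFrame.ofEmbedding k e).corner)
      (conjNormVanish_closure_corner_pair rfl hT₁' (hy ▸ hu) (hy ▸ hu') (hy ▸ hz'))
      (conjNormVanish_of_two_le hμ hT₁' hQ _)
    exact ⟨h1.1 (mem_center _) (mem_commutator _), h1.2 (mem_center _) (mem_commutator _)⟩
  refine BlockFrame.trace_eq_zero_of_commuting_corner_lifts h e (P * T₂.map c * P.transpose) ?_ ?_
    hST hv hw (hy.trans (hmap T₂).symm) hz (hκ' z hz).2 (hκ' (z * (y * y)) ?_).1
  · rw [hS, rep_val, hT₁]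
    simp [Matrix.map_zero]
  · rw [hT, rep_val]
    simp [Matrix.map_zero]
  · rw [Matrix.mul_assoc, Matrix.mul_assoc, ← Matrix.mul_assoc, hz, Matrix.mul_assoc]

theorem not_liftable_of_ne_two {p : ℕ} [Fact p.Prime] (hp : p ≠ 2) {k R : Type} [Field k]
    [CharP k p] [CommRing R] {π : R →+* k} {ε : k →+ R} (h : IsWittExt p π ε) {n : Type}
    [Fintype n] [DecidableEq n]
    (hlift : ∀ (F : Type) [Field F],
      ∀ ρ : AbsGal F →* GL n k, IsOpen (ρ.ker : Set (AbsGal F)) →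
        ∃ ρ₂ : AbsGal F →* GL n R,
          IsOpen (ρ₂.ker : Set (AbsGal F)) ∧
          (Matrix.GeneralLinearGroup.map π).comp ρ₂ = ρ)
    (e : Unit ⊕ Unit ⊕ Unit ↪ n) (c : ZMod p →+* k) : False := by
  let M : Subgroup (HeisGroup Unit (ZMod p)) :=
    { carrier := {g | g.b = 0}
      one_mem' := rfl
      mul_mem' := fun {g h} hg hh => by
        change g.b + h.b = 0
        rw [show g.b = 0 from hg, show h.b = 0 from hh, add_zero]
      inv_mem' := fun {g} hg => by
        change -g.b = 0
        rw [show g.b = 0 from hg, neg_zero] }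
  have hM : ∀ g, g ∈ M ↔ g.b = 0 := fun g => Iff.rfl
  have hMn : M.Normal := ⟨fun g hg h => by
    rw [hM] at hg ⊢
    simp [mul_def, inv_def, hg]⟩
  have hMc : M = Subgroup.closure {⟨1, 0, 0⟩, ⟨0, 0, 1⟩} := by
    refine le_antisymm (fun g hg => ?_) ((Subgroup.closure_le _).mpr ?_)
    · have h1 : g = (⟨1, 0, 0⟩ : HeisGroup Unit (ZMod p)) ^ (g.x () ()).val *
          (⟨0, 0, 1⟩ : HeisGroup Unit (ZMod p)) ^ (g.y () ()).val := by
        rw [mk_pow_of_b_eq_zero, mk_pow_of_b_eq_zero, mul_def]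
        refine HeisGroup.ext ?_ ?_ ?_
        · ext i j
          simp only [smul_zero, add_zero, Matrix.smul_apply, Matrix.one_apply_eq]
          rw [nsmul_eq_mul, mul_one, ZMod.natCast_zmod_val]
        · simpa using (hM g).mp hg
        · ext i j
          simp only [smul_zero, zero_add, add_zero, Matrix.mul_zero, Matrix.smul_apply,
            Matrix.one_apply_eq]
          rw [nsmul_eq_mul, mul_one, ZMod.natCast_zmod_val]
      rw [h1]
      exact mul_mem (pow_mem (Subgroup.subset_closure (by simp)) _)
        (pow_mem (Subgroup.subset_closure (by simp)) _)
    · rintro _ (rfl | rfl) <;> rfl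
  have h1 : (1 : Matrix Unit Unit (ZMod p)).map c = 1 :=
    Matrix.map_one _ (map_zero _) (map_one _)
  obtain ⟨S, T, v, w, hS, hT, hST, -, hw, hκ⟩ := exists_commuting_lifts h hlift
    (isPGroup (μ := Unit) p) (rep (BlockFrame.ofEmbedding k e) c (1 : Matrix Unit Unit k))
    ⟨1, 0, 0⟩ ⟨0, 0, 1⟩ (by simp [mul_def]) (mk_pow_card p _ _) (mk_pow_card p _ _) M hMn hMc
  rw [map_comp_rep e _ c _ (frobenius_comp_eq c), Matrix.map_one _ (map_zero _) (map_one _)] at hκ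
  have h2 := (hκ ((traceMul 1).comp (BlockFrame.ofEmbedding k e).corner)
    (conjNormVanish_of_b_eq_zero hp hM _) (conjNormVanish_of_ne_two hp _)).2 (mem_center _)
      (mem_commutator _)
  rw [AddMonoidHom.comp_apply, traceMul_apply,
    BlockFrame.corner_eq_one_of_commuting_lifts hp h e (by
      rw [hS, rep_val, h1]
      simp [Matrix.map_zero]) (by
      rw [hT, rep_val, h1]
      simp [Matrix.map_zero]) hST hw] at h2
  simp at h2

end HeisGroup

theorem embedding_fin {m : Type} [Fintype m] {d : ℕ} (h : Fintype.card m ≤ d) :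
    Nonempty (m ↪ Fin d) :=
  Function.Embedding.nonempty_of_card_le (by rwa [Fintype.card_fin])

section Two

variable {k R : Type} [Field k] [CharP k 2] [CommRing R] {π : R →+* k} {ε : k →+ R} {n : Type}
  [Fintype n] [DecidableEq n]

theorem not_liftable_of_element (h : IsWittExt 2 π ε)
    (hlift : ∀ (F : Type) [Field F],
      ∀ ρ : AbsGal F →* GL n k, IsOpen (ρ.ker : Set (AbsGal F)) →
        ∃ ρ₂ : AbsGal F →* GL n R,
          IsOpen (ρ₂.ker : Set (AbsGal F)) ∧
          (Matrix.GeneralLinearGroup.map π).comp ρ₂ = ρ)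
    (e : Unit ⊕ Unit ⊕ Unit ↪ n) {α : k} (h0 : α ≠ 0) (h1 : α ≠ 1) : False := by
  let c : ZMod 2 →+* k := ZMod.castHom dvd_rfl k
  have hsq : α ^ 2 ≠ 1 := fun h2 => h1 (frobenius_inj k 2 (by simpa [frobenius_def] using h2))
  have hβ : α ^ 2 ≠ 0 := pow_ne_zero 2 h0
  have hadd : 1 + α ^ 2 ≠ 0 := fun h2 => hsq (by
    rw [add_comm, CharTwo.add_eq_zero] at h2
    exact h2)
  have htr := HeisGroup.trace_eq_zero_of_liftable h hlift e c (μ := Fin 2) (by simp)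
    (P := Matrix.of fun _ : Unit => ![1, α]) (Q := Matrix.of fun _ : Unit => ![1, α ^ 2])
    (T₁ := !![1, 0; 0, 0]) (T₂ := !![0, 1; 0, 0]) (y := Matrix.of fun _ _ => α ^ 2) (z := 1)
    (by
      ext i j
      fin_cases j <;> simp [frobenius_def])
    (by
      ext i j
      simp [Matrix.mul_apply, Fin.sum_univ_two])
    (fun x hx hQ => by
      have h2 : c (x 0 ()) + α ^ 2 * c (x 1 ()) = 0 := by
        have := congrFun (congrFun hQ ()) ()
        simpa [Matrix.mul_apply, Fin.sum_univ_two] using this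
      have h3 : ∀ t : ZMod 2, t = 0 ∨ t = 1 := by decide
      apply hx
      rcases h3 (x 0 ()) with hx0 | hx0 <;> rcases h3 (x 1 ()) with hx1 | hx1 <;>
        simp only [hx0, hx1, map_zero, map_one, mul_one, mul_zero, add_zero, zero_add] at h2
      · ext i j
        fin_cases i
        exacts [hx0, hx1]
      · exact absurd h2 hβ
      · exact absurd h2 one_ne_zero
      · exact absurd h2 hadd)
    (by
      ext i j
      simp [Matrix.mul_apply, Fin.sum_univ_two])
    (by
      rw [Matrix.isUnit_iff_isUnit_det]
      simpa using h0)
    (by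
      rw [Matrix.isUnit_iff_isUnit_det]
      simpa using hadd)
    (by rw [Matrix.one_mul, Matrix.mul_one])
  have h4 : α ^ 2 * (1 - α ^ 2) = 0 := by
    have : α ^ 2 - α ^ 2 * α ^ 2 = 0 := by
      simpa [Matrix.trace, Matrix.mul_apply] using htr
    linear_combination this
  rcases mul_eq_zero.mp h4 with h5 | h5
  · exact hβ h5
  · exact hsq (sub_eq_zero.mp h5).symm

theorem not_liftable_of_five_le (h : IsWittExt 2 π ε)
    (hlift : ∀ (F : Type) [Field F],
      ∀ ρ : AbsGal F →* GL n k, IsOpen (ρ.ker : Set (AbsGal F)) →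
        ∃ ρ₂ : AbsGal F →* GL n R,
          IsOpen (ρ₂.ker : Set (AbsGal F)) ∧
          (Matrix.GeneralLinearGroup.map π).comp ρ₂ = ρ)
    (e : Fin 2 ⊕ Unit ⊕ Fin 2 ↪ n) : False := by
  let c : ZMod 2 →+* k := ZMod.castHom dvd_rfl k
  have hmap : ∀ T : Matrix (Fin 2) (Fin 2) (ZMod 2), (1 : Matrix (Fin 2) (Fin 2) k) * T.map c *
      (1 : Matrix (Fin 2) (Fin 2) k).transpose = T.map c := fun T => by
    rw [Matrix.one_mul, Matrix.transpose_one, Matrix.mul_one]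
  have htr := HeisGroup.trace_eq_zero_of_liftable h hlift e c (μ := Fin 2) (by simp)
    (P := (1 : Matrix (Fin 2) (Fin 2) k)) (Q := 1)
    (T₁ := 1) (T₂ := !![0, 1; 1, 1]) (y := !![0, 1; 1, 1]) (z := !![0, 1; 1, 1])
    (Matrix.map_one _ (map_zero _) (map_one _)).symm
    (by rw [hmap, Matrix.map_one _ (map_zero _) (map_one _)])
    (fun x hx hQ => by
      rw [Matrix.one_mul] at hQ
      exact hx (Matrix.map_injective c.injective (hQ.trans
        (Matrix.map_zero _ (map_zero c)).symm)))
    (by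
      rw [hmap]
      ext i j
      fin_cases i <;> fin_cases j <;> simp)
    (by
      rw [Matrix.isUnit_iff_isUnit_det]
      simp [Matrix.det_fin_two])
    (by
      rw [Matrix.isUnit_iff_isUnit_det]
      simp [Matrix.det_fin_two, CharTwo.add_self_eq_zero])
    rfl
  simp [Matrix.trace_fin_two] at htr

end Two

theorem exists_ne_zero_ne_one {k : Type} [Field k] (h : 3 ≤ Cardinal.mk k) :
    ∃ α : k, α ≠ 0 ∧ α ≠ 1 := by
  by_contra! hα
  have h1 : Set.univ ⊆ ({0, 1} : Set k) := fun x _ => by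
    by_cases hx : x = 0
    · exact Or.inl hx
    · exact Or.inr (hα x hx)
  have h2 := Cardinal.mk_le_mk_of_subset h1
  rw [Cardinal.mk_univ] at h2
  have h3 : Cardinal.mk ({0, 1} : Set k) ≤ 2 := by
    refine Cardinal.mk_insert_le.trans ?_
    rw [Cardinal.mk_singleton, one_add_one_eq_two]
  exact absurd (h.trans (h2.trans h3)) (by norm_num)

theorem stmt_4 (p : ℕ) [Fact p.Prime] (k : Type) [Field k] [CharP k p]
    (d : ℕ) (hd : 1 ≤ d) :
    (∀ (F : Type) [Field F],
      ∀ ρ : AbsGal F →* GL (Fin d) k, IsOpen (ρ.ker : Set (AbsGal F)) →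
        ∃ ρ₂ : AbsGal F →* GL (Fin d) (TruncatedWittVector p 2 k),
          IsOpen (ρ₂.ker : Set (AbsGal F)) ∧
          (Matrix.GeneralLinearGroup.map (wittRed p k)).comp ρ₂ = ρ) ↔
    ((3 ≤ Cardinal.mk k → d ≤ 2) ∧ (Cardinal.mk k = 2 → d ≤ 4)) := by
  constructor
  · intro hlift
    refine ⟨fun hk => ?_, fun hk => ?_⟩
    · by_contra! h3
      obtain ⟨e⟩ := embedding_fin (m := Unit ⊕ Unit ⊕ Unit) (d := d) (by simp; omega)
      by_cases hp : p = 2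
      · subst hp
        obtain ⟨α, h0, h1⟩ := exists_ne_zero_ne_one hk
        exact not_liftable_of_element (isWittExt 2 k) hlift e h0 h1
      · exact HeisGroup.not_liftable_of_ne_two hp (isWittExt p k) hlift e
          (ZMod.castHom dvd_rfl k)
    · by_contra! h5
      obtain ⟨e⟩ := embedding_fin (m := Fin 2 ⊕ Unit ⊕ Fin 2) (d := d) (by simp; omega)
      have hp : p = 2 := prime_eq_two_of_card (k := k) (by simp [Nat.card, hk])
      subst hp
      exact not_liftable_of_five_le (isWittExt 2 k) hlift e
  · exact fun ⟨h3, h2⟩ F _ ρ hρ =>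
      exists_lift_of_hasBlockShape (isWittExt p k) (hasBlockShape_of_small p k d hd h3 h2) ρ hρ
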